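/- Let n ≥ 3 and let p ∈ P^log(ℝ^n) be a variable exponent with n/(n−1) < p⁻ ≤ p⁺ < p⁻ (n−1). Then the spherical maximal operator 𝓜 is bounded on L^{p(·)}(ℝ^n): there is a constant C such that ‖𝓜 f‖_{p(·)} ≤ C ‖f‖_{p(·)} for all f ∈ L^{p(·)}(ℝ^n). -/

import Mathlib

open MeasureTheory Metric Filter Topology
open scoped ENNReal NNReal FourierTransform SchwartzMap

noncomputable section

/-- Euclidean space `ℝⁿ`. -/
abbrev Rn (n : ℕ) := EuclideanSpace ℝ (Fin n)

/-- The modular `ρ_{p(·)}(f)` of the variable Lebesgue space `L^{p(·)}(ℝⁿ)`: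
`∫_{ℝⁿ \ ℝⁿ_∞} |f|^{p(x)} dx + ‖f‖_{L^∞(ℝⁿ_∞)}`, where `ℝⁿ_∞ = {p = ∞}`. -/
def varModular {n : ℕ} {E : Type*} [NormedAddCommGroup E]
    (p : Rn n → ℝ≥0∞) (f : Rn n → E) : ℝ≥0∞ :=
  (∫⁻ x in {x | p x ≠ ∞}, ENNReal.ofReal ‖f x‖ ^ (p x).toReal) +
    essSup (fun x => ENNReal.ofReal ‖f x‖) (volume.restrict {x | p x = ∞})

/-- The Luxemburg norm `‖f‖_{p(·)} = inf {λ > 0 : ρ_{p(·)}(f/λ) ≤ 1}`. -/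
def varNorm {n : ℕ} {E : Type*} [NormedAddCommGroup E]
    (p : Rn n → ℝ≥0∞) (f : Rn n → E) : ℝ :=
  sInf {c : ℝ | 0 < c ∧ varModular p (fun x => ‖f x‖ / c) ≤ 1}

/-- Membership in the variable Lebesgue space `L^{p(·)}(ℝⁿ)`. -/
def MemVarLp {n : ℕ} {E : Type*} [NormedAddCommGroup E]
    (p : Rn n → ℝ≥0∞) (f : Rn n → E) : Prop :=
  AEStronglyMeasurable f volume ∧ ∃ c : ℝ, 0 < c ∧ varModular p (fun x => ‖f x‖ / c) < ∞

/-- The Hardy–Littlewood maximal function `Mf(x) = sup_{r>0} |B(x,r)|⁻¹ ∫_{B(x,r)} |f|`. -/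
def hlMax {n : ℕ} {E : Type*} [NormedAddCommGroup E] (f : Rn n → E) (x : Rn n) : ℝ :=
  ⨆ r : {r : ℝ // 0 < r},
    ((volume (ball x r.1)).toReal)⁻¹ * ∫ y in ball x r.1, ‖f y‖

/-- The class `B(ℝⁿ)` of variable exponents `p : ℝⁿ → [1,∞]` for which the
Hardy–Littlewood maximal operator is bounded on `L^{p(·)}(ℝⁿ)`. -/
def MemClassB {n : ℕ} (p : Rn n → ℝ≥0∞) : Prop :=
  Measurable p ∧ (∀ x, 1 ≤ p x) ∧
    ∃ C : ℝ, 0 < C ∧ ∀ f : Rn n → ℝ, MemVarLp p f →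
      varNorm p (hlMax f) ≤ C * varNorm p f

/-- The class `P^log(ℝⁿ)`: variable exponents `p : ℝⁿ → [1,∞]` such that `1/p` is
globally log-Hölder continuous (locally log-Hölder plus log-Hölder decay). -/
def MemPLog {n : ℕ} (p : Rn n → ℝ≥0∞) : Prop :=
  Measurable p ∧ (∀ x, 1 ≤ p x) ∧
    (∃ c₁ : ℝ, 0 < c₁ ∧ ∀ x y : Rn n, dist x y < 1/2 →
      |((p x)⁻¹).toReal - ((p y)⁻¹).toReal| ≤ c₁ / Real.log (Real.exp 1 + (dist x y)⁻¹)) ∧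
    (∃ pinf c₂ : ℝ, 0 < c₂ ∧ ∀ x : Rn n,
      |((p x)⁻¹).toReal - pinf| ≤ c₂ / Real.log (Real.exp 1 + ‖x‖))

/-- The Fourier multiplier `(2π|ξ|)^{-iu}` of the imaginary power `I_{iu} = (-Δ)^{-iu/2}`. -/
def impMult {n : ℕ} (u : ℝ) (ξ : Rn n) : ℂ :=
  ((2 * Real.pi * ‖ξ‖ : ℝ) : ℂ) ^ (-(Complex.I * u))

/-- A weight `w` on `ℝⁿ` belongs to the Muckenhoupt class `A_p` with constant (at most) `A`:
it is nonnegative, locally integrable, and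
`(|B|⁻¹∫_B w)·(|B|⁻¹∫_B w^{1-p'})^{p-1} ≤ A` for every ball `B`, where `p' = p/(p-1)`
(so that `1 - p' = -1/(p-1)`). -/
def IsAp {n : ℕ} (p : ℝ) (w : Rn n → ℝ) (A : ℝ) : Prop :=
  (∀ x, 0 ≤ w x) ∧ LocallyIntegrable w volume ∧
    ∀ (x : Rn n) (r : ℝ), 0 < r →
      (((volume (ball x r)).toReal)⁻¹ * ∫ y in ball x r, w y) *
        (((volume (ball x r)).toReal)⁻¹ * ∫ y in ball x r, (w y) ^ (-(p - 1)⁻¹)) ^ (p - 1) ≤ A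

/-- The weighted Lebesgue norm `‖f‖_{p,w} = (∫ |f|^p w dx)^{1/p}`. -/
def wNorm {n : ℕ} (p : ℝ) (w : Rn n → ℝ) (f : Rn n → ℂ) : ℝ :=
  (∫ x : Rn n, ‖f x‖ ^ p * w x) ^ (1 / p)

/-- The Bessel function of the first kind of order `ν`. -/
def besselJ (ν x : ℝ) : ℝ :=
  ∑' m : ℕ, ((-1 : ℝ) ^ m / (m.factorial * Real.Gamma (m + ν + 1))) * (x / 2) ^ (2 * m + ν)

/-- `F_α(λ) = π^{-α+1} λ^{-n/2-α+1} J_{n/2+α-1}(2πλ)`, the Fourier multiplier profile of the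
spherical mean operator `M_t^α` (meaningful for `λ > 0`). -/
def sphF (n : ℕ) (α l : ℝ) : ℝ :=
  Real.pi ^ (-α + 1) * l ^ (-(n : ℝ)/2 - α + 1) * besselJ ((n : ℝ)/2 + α - 1) (2 * Real.pi * l)

/-- The spherical maximal function `M^α f(x) = sup_{t>0} |M_t^α f(x)|` associated with a family
`S` of spherical mean operators (`S t f = M_t^α f`). -/
def sphMax {n : ℕ} (S : ℝ → 𝓢(Rn n, ℂ) → (Rn n → ℂ)) (f : 𝓢(Rn n, ℂ)) (x : Rn n) : ℝ :=
  ⨆ t : {t : ℝ // 0 < t}, ‖S t.1 f x‖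

/-- The normalized surface measure `μ` on the unit sphere of `ℝⁿ` (the `(n-1)`-dimensional
Hausdorff measure restricted to the sphere, normalized to total mass one). -/
def unitSphereMeasure (n : ℕ) : Measure (Rn n) :=
  ((μH[(n : ℝ) - 1] : Measure (Rn n)).restrict (sphere (0 : Rn n) 1) Set.univ)⁻¹ •
    ((μH[(n : ℝ) - 1] : Measure (Rn n)).restrict (sphere (0 : Rn n) 1))

/-- Stein's spherical maximal function
`𝓜 f(x) = sup_{t>0} |∫_{|y|=1} f(x - ty) dμ(y)|`. -/
def steinSphericalMax {n : ℕ} (f : Rn n → ℂ) (x : Rn n) : ℝ :=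
  ⨆ t : {t : ℝ // 0 < t}, ‖∫ y, f (x - t.1 • y) ∂(unitSphereMeasure n)‖

open ENNReal (ofReal)
open Real (exp)

/-- HL maximal function, extended valued. -/
def mx {n : ℕ} (f : Rn n → ℝ≥0∞) (x : Rn n) : ℝ≥0∞ :=
  ⨆ (r : ℝ) (_ : 0 < r), (volume (ball x r))⁻¹ * ∫⁻ y in ball x r, f y

lemma avg_le_mx {n : ℕ} (f : Rn n → ℝ≥0∞) (x : Rn n) {r : ℝ} (hr : 0 < r) :
    (volume (ball x r))⁻¹ * ∫⁻ y in ball x r, f y ≤ mx f x :=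
  le_iSup₂ (f := fun (r : ℝ) (_ : 0 < r) => (volume (ball x r))⁻¹ * ∫⁻ y in ball x r, f y) r hr

lemma vol_ball_pos {n : ℕ} (x : Rn n) {r : ℝ} (hr : 0 < r) : volume (ball x r) ≠ 0 :=
  (measure_ball_pos volume x hr).ne'

lemma vol_ball_top {n : ℕ} (x : Rn n) (r : ℝ) : volume (ball x r) ≠ ∞ :=
  measure_ball_lt_top.ne

lemma lintegral_ball_le_mx {n : ℕ} (f : Rn n → ℝ≥0∞) (x : Rn n) {r : ℝ} (hr : 0 < r) :
    ∫⁻ y in ball x r, f y ≤ volume (ball x r) * mx f x := by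
  calc ∫⁻ y in ball x r, f y
      = volume (ball x r) * ((volume (ball x r))⁻¹ * ∫⁻ y in ball x r, f y) := by
        rw [← mul_assoc, ENNReal.mul_inv_cancel (vol_ball_pos x hr) (vol_ball_top x r), one_mul]
    _ ≤ _ := by gcongr; exact avg_le_mx f x hr

lemma lt_mx_iff {n : ℕ} (f : Rn n → ℝ≥0∞) (x : Rn n) (l : ℝ≥0∞) :
    l < mx f x ↔ ∃ r : ℝ, 0 < r ∧ l * volume (ball x r) < ∫⁻ y in ball x r, f y := by
  unfold mx
  simp only [lt_iSup_iff]
  constructor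
  · rintro ⟨r, hr, h⟩
    refine ⟨r, hr, ?_⟩
    rw [mul_comm, ← div_eq_mul_inv] at h
    exact (ENNReal.lt_div_iff_mul_lt (Or.inl (vol_ball_pos x hr)) (Or.inl (vol_ball_top x r))).1 h
  · rintro ⟨r, hr, h⟩
    refine ⟨r, hr, ?_⟩
    rw [mul_comm, ← div_eq_mul_inv]
    exact (ENNReal.lt_div_iff_mul_lt (Or.inl (vol_ball_pos x hr)) (Or.inl (vol_ball_top x r))).2 h

lemma isOpen_lt_mx {n : ℕ} (f : Rn n → ℝ≥0∞) (l : ℝ≥0∞) : IsOpen {x | l < mx f x} := by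
  rw [Metric.isOpen_iff]
  intro x hx
  obtain ⟨r, hr, h⟩ := (lt_mx_iff f x l).1 hx
  have hU : ball x r = ⋃ k : ℕ, ball x (r - 1 / ((k : ℝ) + 1)) := by
    ext y
    simp only [mem_ball, Set.mem_iUnion]
    constructor
    · intro hy
      obtain ⟨k, hk⟩ := exists_nat_one_div_lt (sub_pos.2 hy)
      exact ⟨k, by linarith⟩
    · rintro ⟨k, hk⟩
      have : 0 < 1 / ((k : ℝ) + 1) := by positivity
      linarith
  have hmono : Monotone (fun k : ℕ => ball x (r - 1 / ((k : ℝ) + 1))) := by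
    intro a b hab
    apply ball_subset_ball
    have : 1 / ((b : ℝ) + 1) ≤ 1 / ((a : ℝ) + 1) := Nat.one_div_le_one_div hab
    linarith
  have hk : ∃ k : ℕ, l * volume (ball x r) < ∫⁻ y in ball x (r - 1 / ((k : ℝ) + 1)), f y := by
    have e : ∫⁻ y in ball x r, f y = ⨆ k : ℕ, ∫⁻ y in ball x (r - 1 / ((k : ℝ) + 1)), f y := by
      have := (withDensity_apply (μ := volume) f (measurableSet_ball (x := x) (ε := r)))
      rw [← this]
      conv_lhs => rw [hU]
      rw [hmono.measure_iUnion]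
      congr 1; ext k
      rw [withDensity_apply f measurableSet_ball]
    rw [e] at h
    exact lt_iSup_iff.1 h
  obtain ⟨k, hk⟩ := hk
  refine ⟨1 / ((k : ℝ) + 1), by positivity, ?_⟩
  intro z hz
  refine (lt_mx_iff f z l).2 ⟨r, hr, ?_⟩
  have e1 : volume (ball z r) = volume (ball x r) := by
    rw [Measure.addHaar_ball_of_pos _ _ hr, Measure.addHaar_ball_of_pos _ x hr]
  rw [e1]
  refine hk.trans_le (lintegral_mono_set ?_)
  apply ball_subset_ball'
  rw [dist_comm]
  have := mem_ball.1 hz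
  linarith

lemma measurable_mx {n : ℕ} (f : Rn n → ℝ≥0∞) : Measurable (mx f) :=
  measurable_of_Ioi fun l => (isOpen_lt_mx f l).measurableSet

lemma mx_weak {n : ℕ} (f : Rn n → ℝ≥0∞) (hf : Measurable f) {l : ℝ≥0∞} (hl : l ≠ 0) (hl' : l ≠ ∞)
    (hn : 0 < n) :
    volume {x | l < mx f x} ≤ 5 ^ n * l⁻¹ * ∫⁻ y, f y := by
  by_cases htop : ∫⁻ y, f y = ∞
  · rw [htop, ENNReal.mul_top]
    · exact le_top
    · simp [hl']
  have hfin : Module.finrank ℝ (Rn n) = n := by simp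
  have : ∀ x : {x | l < mx f x}, ∃ r : ℝ, 0 < r ∧ l * volume (ball x.1 r) < ∫⁻ y in ball x.1 r, f y :=
    fun x => (lt_mx_iff f x.1 l).1 x.2
  choose r hr hlt using this
  set v := volume (ball (0 : Rn n) 1) with hv
  have hv0 : v ≠ 0 := vol_ball_pos 0 one_pos
  have hvt : v ≠ ∞ := vol_ball_top 0 1
  -- radii bounded
  have hR : ∃ R : ℝ, ∀ x, r x ≤ R := by
    refine ⟨max 1 ((∫⁻ y, f y) / (l * v)).toReal, fun x => ?_⟩
    by_cases h1 : r x ≤ 1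
    · exact le_max_of_le_left h1
    push Not at h1
    apply le_max_of_le_right
    have h2 : l * (ofReal (r x ^ n) * v) < ∫⁻ y, f y := by
      have := hlt x
      rw [Measure.addHaar_ball_of_pos _ _ (hr x), hfin] at this
      exact this.trans_le (setLIntegral_le_lintegral _ _)
    have hlv0 : l * v ≠ 0 := mul_ne_zero hl hv0
    have hlvt : l * v ≠ ∞ := ENNReal.mul_ne_top hl' hvt
    have h3 : ofReal (r x ^ n) ≤ (∫⁻ y, f y) / (l * v) := by
      rw [ENNReal.le_div_iff_mul_le (Or.inl hlv0) (Or.inl hlvt)]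
      calc _ = l * (ofReal (r x ^ n) * v) := by ring
        _ ≤ _ := h2.le
    have h4 : r x ^ n ≤ ((∫⁻ y, f y) / (l * v)).toReal :=
      (ENNReal.ofReal_le_iff_le_toReal (ENNReal.div_ne_top htop hlv0)).1 h3
    refine le_trans ?_ h4
    exact le_self_pow₀ h1.le hn.ne'
  obtain ⟨R, hR⟩ := hR
  obtain ⟨u, -, hdis, hcov⟩ := Vitali.exists_disjoint_subfamily_covering_enlargement_closedBall
    (Set.univ : Set {x | l < mx f x}) (fun x => x.1) r R (fun a _ => hR a) 5 (by norm_num)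
  have hcount : u.Countable := by
    refine hdis.countable_of_nonempty_interior fun a _ => ?_
    exact ⟨a.1, ball_subset_interior_closedBall (mem_ball_self (hr a))⟩
  have hsub : {x | l < mx f x} ⊆ ⋃ b ∈ u, closedBall b.1 (5 * r b) := by
    intro x hx
    obtain ⟨b, hb, hb'⟩ := hcov ⟨x, hx⟩ trivial
    simp only [Set.mem_iUnion]
    exact ⟨b, hb, hb' (mem_closedBall_self (hr _).le)⟩
  have hone : ∀ b, volume (closedBall b.1 (5 * r b)) ≤ 5 ^ n * l⁻¹ * ∫⁻ y in closedBall b.1 (r b), f y := by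
    intro b
    rw [Measure.addHaar_closedBall _ _ (by have := hr b; positivity), hfin, mul_pow,
      ENNReal.ofReal_mul (by positivity), mul_assoc]
    have hb := Measure.addHaar_ball_of_pos volume b.1 (hr b)
    rw [hfin] at hb
    rw [← hb, mul_assoc]
    have e5 : ofReal (5 ^ n) = 5 ^ n := by
      rw [ENNReal.ofReal_pow (by norm_num)]; norm_num
    rw [e5]
    gcongr
    have := (hlt b).le
    calc volume (ball b.1 (r b)) = l⁻¹ * (l * volume (ball b.1 (r b))) := by
          rw [← mul_assoc, ENNReal.inv_mul_cancel hl hl', one_mul]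
      _ ≤ l⁻¹ * ∫⁻ y in closedBall b.1 (r b), f y := by
          gcongr
          exact this.trans (lintegral_mono_set ball_subset_closedBall)
  calc volume {x | l < mx f x} ≤ volume (⋃ b ∈ u, closedBall b.1 (5 * r b)) := measure_mono hsub
    _ ≤ ∑' b : u, volume (closedBall b.1.1 (5 * r b)) := measure_biUnion_le _ hcount _
    _ ≤ ∑' b : u, 5 ^ n * l⁻¹ * ∫⁻ y in closedBall b.1.1 (r b), f y :=
        ENNReal.tsum_le_tsum fun b => hone b
    _ = 5 ^ n * l⁻¹ * ∫⁻ y in ⋃ b ∈ u, closedBall b.1 (r b), f y := by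
        rw [ENNReal.tsum_mul_left, lintegral_biUnion hcount (fun b _ => measurableSet_closedBall) hdis]
    _ ≤ _ := by gcongr; exact Measure.restrict_le_self

lemma mx_mono {n : ℕ} {f g : Rn n → ℝ≥0∞} (h : ∀ x, f x ≤ g x) (x : Rn n) : mx f x ≤ mx g x := by
  unfold mx
  gcongr
  exact h _

lemma mx_add_const {n : ℕ} (f : Rn n → ℝ≥0∞) (c : ℝ≥0∞) (x : Rn n) :
    mx (fun y => f y + c) x ≤ mx f x + c := by
  refine iSup₂_le fun r hr => ?_
  rw [lintegral_add_right _ measurable_const, mul_add]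
  gcongr
  · exact avg_le_mx f x hr
  · simp only [lintegral_const, Measure.restrict_apply MeasurableSet.univ, Set.univ_inter]
    rw [mul_comm c, ← mul_assoc, ENNReal.inv_mul_cancel (vol_ball_pos x hr) (vol_ball_top x r), one_mul]

lemma mx_weak2 {n : ℕ} (f : Rn n → ℝ≥0∞) (hf : Measurable f) {t : ℝ} (ht : 0 < t) (hn : 0 < n) :
    volume {x | ofReal t < mx f x} ≤
      2 * 5 ^ n * (ofReal t)⁻¹ * ∫⁻ y in {y | ofReal t < 2 * f y}, f y := by
  set l := ofReal t
  have hl0 : l ≠ 0 := by simp [l, ht]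
  have hlt : l ≠ ∞ := ENNReal.ofReal_ne_top
  have hS : MeasurableSet {y | l < 2 * f y} := measurableSet_lt measurable_const (hf.const_mul 2)
  set g : Rn n → ℝ≥0∞ := Set.indicator {y | l < 2 * f y} f
  have h1 : ∀ x, mx f x ≤ mx g x + l / 2 := fun x => by
    refine le_trans (mx_mono (g := fun y => g y + l / 2) (fun y => ?_) x) (mx_add_const _ _ _)
    by_cases hy : l < 2 * f y
    · simp [g, hy]
    · push Not at hy
      have : f y ≤ l / 2 := by
        rw [ENNReal.le_div_iff_mul_le (by simp) (by simp), mul_comm]; exact hy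
      exact this.trans le_add_self
  have h2 : {x | l < mx f x} ⊆ {x | l / 2 < mx g x} := by
    intro x hx
    by_contra hcon
    simp only [Set.mem_ofPred_eq, not_lt] at hcon hx
    have := (h1 x).trans (add_le_add_left hcon _)
    rw [ENNReal.add_halves] at this
    exact absurd hx (not_lt.2 this)
  calc _ ≤ volume {x | l / 2 < mx g x} := measure_mono h2
    _ ≤ 5 ^ n * (l / 2)⁻¹ * ∫⁻ y, g y := mx_weak g (hf.indicator hS) (by simp [hl0]) (ENNReal.div_ne_top hlt (by simp)) hn
    _ = _ := by
      rw [lintegral_indicator hS, ENNReal.inv_div (by simp) (by simp), div_eq_mul_inv]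
      ring

lemma mx_strong {n : ℕ} (hn : 0 < n) {s : ℝ} (hs : 1 < s) :
    ∃ C : ℝ≥0∞, C ≠ ∞ ∧ ∀ f : Rn n → ℝ≥0∞, Measurable f →
      ∫⁻ x, mx f x ^ s ≤ C * ∫⁻ x, f x ^ s := by
  refine ⟨ofReal s * (2 * 5 ^ n) * (ofReal (s - 1))⁻¹ * 2 ^ (s - 1), ?_, ?_⟩
  · refine ENNReal.mul_ne_top (ENNReal.mul_ne_top (ENNReal.mul_ne_top ENNReal.ofReal_ne_top (ENNReal.mul_ne_top (by simp) (by simp))) ?_) ?_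
    · simp [hs]
    · exact ENNReal.rpow_ne_top_of_nonneg (by linarith) (by simp)
  intro f hf
  by_cases htop : ∫⁻ x, f x ^ s = ∞
  · rw [htop, ENNReal.mul_top]
    · exact le_top
    · have : (0:ℝ≥0∞) < 2 ^ (s-1) := ENNReal.rpow_pos (by simp) (by simp)
      have h5 : ofReal s ≠ 0 := by simp; linarith
      exact mul_ne_zero (mul_ne_zero (mul_ne_zero h5 (by simp)) (by simp)) this.ne'
  have hfin : ∀ᵐ x, f x < ∞ := by
    filter_upwards [ae_lt_top (hf.pow_const s) htop] with x hx
    by_contra h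
    simp only [not_lt, top_le_iff] at h
    rw [h, ENNReal.top_rpow_of_pos (by linarith)] at hx
    exact lt_irrefl _ hx
  set ν := volume.withDensity f
  have hν : ν ≪ volume := withDensity_absolutelyContinuous _ _
  -- truncated
  have key : ∀ N : ℕ, ∫⁻ x, (min (mx f x) N) ^ s ≤
      ofReal s * (2 * 5 ^ n) * (ofReal (s - 1))⁻¹ * 2 ^ (s - 1) * ∫⁻ x, f x ^ s := by
    intro N
    have hmin : ∀ x, min (mx f x) N ≠ ∞ := fun x => (min_lt_of_right_lt (by simp)).ne
    have hm : Measurable fun x => (min (mx f x) (N:ℝ≥0∞)).toReal :=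
      ((measurable_mx f).min measurable_const).ennreal_toReal
    have e1 : ∀ x, (min (mx f x) N) ^ s = ofReal ((min (mx f x) N).toReal ^ s) := fun x => by
      rw [← ENNReal.ofReal_rpow_of_nonneg ENNReal.toReal_nonneg (by linarith), ENNReal.ofReal_toReal (hmin x)]
    simp_rw [e1]
    rw [lintegral_rpow_eq_lintegral_meas_lt_mul _ (Eventually.of_forall fun x => ENNReal.toReal_nonneg) hm.aemeasurable (by linarith)]
    have e2 : ∀ t ∈ Set.Ioi (0:ℝ), volume {a | t < (min (mx f a) (N:ℝ≥0∞)).toReal} * ofReal (t ^ (s-1))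
        ≤ 2 * 5 ^ n * (ν {a | t < 2 * (f a).toReal} * ofReal (t ^ (s - 1 - 1))) := by
      intro t ht
      have ht : 0 < t := ht
      have h3 : volume {a | t < (min (mx f a) (N:ℝ≥0∞)).toReal} ≤ volume {x | ofReal t < mx f x} := by
        apply measure_mono
        intro a ha
        exact ((ENNReal.ofReal_lt_iff_lt_toReal ht.le (hmin a)).2 ha).trans_le (min_le_left _ _)
      have h4 : ∫⁻ y in {y | ofReal t < 2 * f y}, f y = ν {a | t < 2 * (f a).toReal} := by
        rw [← withDensity_apply f (measurableSet_lt measurable_const (hf.const_mul 2))]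
        apply measure_congr
        filter_upwards [hν.ae_le hfin] with a ha
        have : (ofReal t < 2 * f a) = (t < 2 * (f a).toReal) := by
          rw [ENNReal.ofReal_lt_iff_lt_toReal ht.le (ENNReal.mul_ne_top (by simp) ha.ne)]
          simp
        exact this
      have h5 : (ofReal t)⁻¹ * ofReal (t ^ (s-1)) = ofReal (t ^ (s - 1 - 1)) := by
        rw [← ENNReal.ofReal_inv_of_pos ht, ← ENNReal.ofReal_mul (by positivity), Real.rpow_sub_one ht.ne' (s-1)]
        congr 1
        field_simp
      calc _ ≤ (2 * 5 ^ n * (ofReal t)⁻¹ * ν {a | t < 2 * (f a).toReal}) * ofReal (t ^ (s-1)) := by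
            gcongr
            rw [← h4]
            exact h3.trans (mx_weak2 f hf ht hn)
        _ = 2 * 5 ^ n * (ν {a | t < 2 * (f a).toReal} * ((ofReal t)⁻¹ * ofReal (t ^ (s-1)))) := by ring
        _ = _ := by rw [h5]
    have e3 := lintegral_rpow_eq_lintegral_meas_lt_mul ν (f := fun a => 2 * (f a).toReal)
      (Eventually.of_forall fun x => by positivity) (hf.ennreal_toReal.const_mul 2).aemeasurable (p := s - 1) (by linarith)
    have e4 : ∫⁻ t in Set.Ioi (0:ℝ), ν {a | t < 2 * (f a).toReal} * ofReal (t ^ (s - 1 - 1))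
        = (ofReal (s-1))⁻¹ * ∫⁻ a, ofReal ((2 * (f a).toReal) ^ (s-1)) ∂ν := by
      rw [e3, ← mul_assoc, ENNReal.inv_mul_cancel (by simp [hs]) (by simp), one_mul]
    have e5 : ∫⁻ a, ofReal ((2 * (f a).toReal) ^ (s-1)) ∂ν = 2 ^ (s-1) * ∫⁻ x, f x ^ s := by
      rw [lintegral_withDensity_eq_lintegral_mul _ hf (by fun_prop), ← lintegral_const_mul _ (hf.pow_const s)]
      apply lintegral_congr_ae
      filter_upwards [hfin] with a ha
      simp only [Pi.mul_apply]
      rw [← ENNReal.ofReal_rpow_of_nonneg (by positivity) (by linarith), ENNReal.ofReal_mul (by norm_num),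
        ENNReal.ofReal_toReal ha.ne, ENNReal.mul_rpow_of_nonneg _ _ (by linarith)]
      have : f a ^ s = f a * f a ^ (s-1) := by
        conv_lhs => rw [show s = 1 + (s - 1) by ring]
        rw [ENNReal.rpow_add_of_nonneg _ _ (by norm_num) (by linarith), ENNReal.rpow_one]
      rw [this]
      simp only [ENNReal.ofReal_ofNat]
      ring
    calc _ ≤ ofReal s * ∫⁻ t in Set.Ioi (0:ℝ), 2 * 5 ^ n * (ν {a | t < 2 * (f a).toReal} * ofReal (t ^ (s - 1 - 1))) := by
          refine mul_le_mul_right ?_ _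
          exact setLIntegral_mono' measurableSet_Ioi e2
      _ = ofReal s * (2 * 5 ^ n * ∫⁻ t in Set.Ioi (0:ℝ), (ν {a | t < 2 * (f a).toReal} * ofReal (t ^ (s - 1 - 1)))) := by
          rw [lintegral_const_mul' _ _ (ENNReal.mul_ne_top (by simp) (by simp))]
      _ = _ := by rw [e4, e5]; ring
  have hlim : ∀ x, mx f x ^ s = ⨆ N : ℕ, (min (mx f x) N) ^ s := by
    intro x
    apply le_antisymm
    · have h1 : mx f x = ⨆ N : ℕ, min (mx f x) N := by
        apply le_antisymm
        · apply le_of_forall_lt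
          intro c hc
          obtain ⟨N, hN⟩ := ENNReal.exists_nat_gt hc.ne_top
          exact (lt_min hc hN).trans_le (le_iSup (fun N : ℕ => min (mx f x) (N:ℝ≥0∞)) N)
        · exact iSup_le fun N => min_le_left _ _
      have h2 := (ENNReal.orderIsoRpow s (by linarith)).map_iSup (fun N : ℕ => min (mx f x) (N:ℝ≥0∞))
      simp only [ENNReal.orderIsoRpow_apply] at h2
      rw [← h1] at h2
      exact h2.le
    · exact iSup_le fun N => ENNReal.rpow_le_rpow (min_le_left _ _) (by linarith)
  simp_rw [hlim]
  rw [lintegral_iSup]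
  · exact iSup_le key
  · intro N
    exact ((measurable_mx f).min measurable_const).pow_const s
  · intro a b hab x
    exact ENNReal.rpow_le_rpow (min_le_min_left _ (by exact_mod_cast hab)) (by linarith)

lemma jensen_rpow {α : Type*} [MeasurableSpace α] (μ : Measure α) (hμ : μ Set.univ ≤ 1)
    {f : α → ℝ≥0∞} (hf : AEMeasurable f μ) {m : ℝ} (hm : 1 ≤ m) :
    (∫⁻ x, f x ∂μ) ^ m ≤ ∫⁻ x, f x ^ m ∂μ := by
  rcases hm.eq_or_lt with rfl | hm
  · simp
  have hpq := Real.HolderConjugate.conjExponent hm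
  have h := ENNReal.lintegral_mul_le_Lp_mul_Lq μ hpq hf (g := fun _ => 1) aemeasurable_const
  simp only [Pi.mul_apply, mul_one, ENNReal.one_rpow, lintegral_one] at h
  have h2 : ∫⁻ x, f x ∂μ ≤ (∫⁻ x, f x ^ m ∂μ) ^ (1 / m) := by
    refine h.trans ?_
    calc _ ≤ (∫⁻ x, f x ^ m ∂μ) ^ (1 / m) * 1 := by
          gcongr
          exact ENNReal.rpow_le_one hμ (one_div_nonneg.2 hpq.symm.nonneg)
      _ = _ := mul_one _
  calc _ ≤ ((∫⁻ x, f x ^ m ∂μ) ^ (1 / m)) ^ m := ENNReal.rpow_le_rpow h2 (by linarith)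
    _ = _ := by rw [← ENNReal.rpow_mul, one_div_mul_cancel (by linarith), ENNReal.rpow_one]

/-- global log-Hölder continuity of a real function -/
def LogH {n : ℕ} (s : Rn n → ℝ) : Prop :=
  (∃ c : ℝ, 0 < c ∧ ∀ x y : Rn n, dist x y < 1/2 →
      |s x - s y| ≤ c / Real.log (exp 1 + (dist x y)⁻¹)) ∧
    (∃ s0 c : ℝ, 0 < c ∧ ∀ x : Rn n, |s x - s0| ≤ c / Real.log (exp 1 + ‖x‖))

lemma one_le_log_e {X : ℝ} (hX : 0 ≤ X) : 1 ≤ Real.log (exp 1 + X) := by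
  calc (1:ℝ) = Real.log (exp 1) := by simp
    _ ≤ _ := Real.log_le_log (Real.exp_pos 1) (by linarith)

lemma LogH.affine {n : ℕ} {s : Rn n → ℝ} (h : LogH s) (a b : ℝ) : LogH (fun x => a * s x + b) := by
  obtain ⟨⟨c, hc, h1⟩, s0, d, hd, h2⟩ := h
  refine ⟨⟨(|a| + 1) * c, by positivity, fun x y hxy => ?_⟩, a * s0 + b, (|a| + 1) * d, by positivity, fun x => ?_⟩
  · have : a * s x + b - (a * s y + b) = a * (s x - s y) := by ring
    rw [this, abs_mul, mul_div_assoc]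
    have := h1 x y hxy
    gcongr
    linarith
  · have : a * s x + b - (a * s0 + b) = a * (s x - s0) := by ring
    rw [this, abs_mul, mul_div_assoc]
    have := h2 x
    gcongr
    linarith

lemma inv_sub_le {u v c : ℝ} (hc : 0 < c) (hu : c ≤ u) (hv : c ≤ v) : |u⁻¹ - v⁻¹| ≤ (c^2)⁻¹ * |u - v| := by
  have hu0 : 0 < u := by linarith
  have hv0 : 0 < v := by linarith
  have : u⁻¹ - v⁻¹ = (u * v)⁻¹ * (v - u) := by field_simp
  rw [this, abs_mul, abs_sub_comm, abs_of_pos (by positivity)]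
  gcongr
  nlinarith

lemma LogH.inv {n : ℕ} {s : Rn n → ℝ} (h : LogH s) {c : ℝ} (hc : 0 < c) (hs : ∀ x, c ≤ s x) :
    LogH (fun x => (s x)⁻¹) := by
  obtain ⟨⟨C, hC, h1⟩, s0, d, hd, h2⟩ := h
  refine ⟨⟨(c^2)⁻¹ * C, by positivity, fun x y hxy => ?_⟩, (max s0 c)⁻¹, (c^2)⁻¹ * d, by positivity, fun x => ?_⟩
  · refine (inv_sub_le hc (hs x) (hs y)).trans ?_
    rw [mul_div_assoc]
    have := h1 x y hxy
    gcongr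
  · refine (inv_sub_le hc (hs x) (le_max_right _ _)).trans ?_
    rw [mul_div_assoc]
    have := h2 x
    gcongr
    refine le_trans ?_ this
    have h3 := hs x
    rcases le_total s0 c with h | h
    · rw [max_eq_right h, abs_of_nonneg (by linarith), abs_of_nonneg (by linarith)]; linarith
    · rw [max_eq_left h]

lemma LogH.continuous {n : ℕ} {s : Rn n → ℝ} (h : LogH s) : Continuous s := by
  obtain ⟨⟨C, hC, h1⟩, -⟩ := h
  rw [Metric.continuous_iff]
  intro x ε hε
  refine ⟨min (1/2) (exp (-(C/ε + 1))), by positivity, fun y hy => ?_⟩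
  rcases eq_or_ne y x with rfl | hne
  · simpa using hε
  have hd : 0 < dist y x := dist_pos.2 hne
  have h2 := h1 y x (hy.trans_le (min_le_left _ _))
  rw [Real.dist_eq]
  refine h2.trans_lt ?_
  have h3 : C/ε + 1 ≤ Real.log (exp 1 + (dist y x)⁻¹) := by
    rw [Real.le_log_iff_exp_le (by positivity)]
    have : dist y x ≤ exp (-(C/ε + 1)) := (hy.trans_le (min_le_right _ _)).le
    rw [Real.exp_neg] at this
    have := (le_inv_comm₀ hd (Real.exp_pos _)).1 this
    have := Real.exp_pos 1
    linarith
  rw [div_lt_iff₀ (by have : 0 < C/ε := by positivity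
                      linarith)]
  calc C = ε * (C/ε) := by field_simp
    _ < _ := by gcongr; linarith

lemma ptw_small (n : ℕ) {u sx sy s0 c X Y : ℝ} (hu : 0 ≤ u) (hu1 : u < 1) (hsx : 1 ≤ sx) (hsy : 1 ≤ sy)
    (hc : 0 < c) (hX : 0 ≤ X) (hY : 0 ≤ Y) (hx : |sx - s0| ≤ c / Real.log (exp 1 + X))
    (hy : |sy - s0| ≤ c / Real.log (exp 1 + Y)) :
    u ^ sx ≤ exp (n * (2 * c)) * u ^ sy + (1 + X) ^ (-(n:ℝ)) + (1 + Y) ^ (-(n:ℝ)) := by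
  set Z := min X Y with hZ
  have hZ0 : 0 ≤ Z := le_min hX hY
  have hl := one_le_log_e hZ0
  have hd : |sx - sy| ≤ 2 * c / Real.log (exp 1 + Z) := by
    have e1 : c / Real.log (exp 1 + X) ≤ c / Real.log (exp 1 + Z) := by
      gcongr
      exact min_le_left _ _
    have e2 : c / Real.log (exp 1 + Y) ≤ c / Real.log (exp 1 + Z) := by
      gcongr
      exact min_le_right _ _
    calc |sx - sy| = |(sx - s0) - (sy - s0)| := by ring_nf
      _ ≤ |sx - s0| + |sy - s0| := abs_sub _ _
      _ ≤ c / Real.log (exp 1 + Z) + c / Real.log (exp 1 + Z) := by linarith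
      _ = _ := by ring
  have hXp : 0 < (1 + X) ^ (-(n:ℝ)) := by positivity
  have hYp : 0 < (1 + Y) ^ (-(n:ℝ)) := by positivity
  have husy : 0 ≤ u ^ sy := by positivity
  rcases le_or_gt u ((1 + Z) ^ (-(n:ℝ))) with h | h
  · have h1 : u ^ sx ≤ u := by
      calc u ^ sx ≤ u ^ (1:ℝ) := Real.rpow_le_rpow_of_exponent_ge_of_imp hu hu1.le hsx (by intro _ h; linarith)
        _ = u := Real.rpow_one u
    have h2 : (1 + Z) ^ (-(n:ℝ)) ≤ (1 + X) ^ (-(n:ℝ)) + (1 + Y) ^ (-(n:ℝ)) := by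
      rcases min_choice X Y with h3 | h3 <;> rw [hZ, h3] <;> linarith
    have : 0 ≤ exp (n * (2 * c)) * u ^ sy := by positivity
    linarith
  · have hu0 : 0 < u := lt_trans (by positivity) h
    have h1 : u ^ sx ≤ u ^ sy * u ^ (-(2 * c / Real.log (exp 1 + Z))) := by
      rw [← Real.rpow_add hu0]
      apply Real.rpow_le_rpow_of_exponent_ge hu0 hu1.le
      have := (abs_le.1 hd).1
      linarith
    have h2 : u ^ (-(2 * c / Real.log (exp 1 + Z))) ≤ exp (n * (2 * c)) := by
      have hD : 0 ≤ 2 * c / Real.log (exp 1 + Z) := by positivity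
      calc _ ≤ ((1 + Z) ^ (-(n:ℝ))) ^ (-(2 * c / Real.log (exp 1 + Z))) :=
            Real.rpow_le_rpow_of_nonpos (by positivity) h.le (by linarith)
        _ = (1 + Z) ^ (n * (2 * c) / Real.log (exp 1 + Z)) := by
            rw [← Real.rpow_mul (by positivity)]; congr 1; ring
        _ = exp (Real.log (1 + Z) * (n * (2 * c) / Real.log (exp 1 + Z))) := by
            rw [Real.rpow_def_of_pos (by positivity)]
        _ ≤ _ := by
            apply Real.exp_le_exp.2
            rw [mul_div_assoc', div_le_iff₀ (by linarith), mul_comm]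
            gcongr
            have := Real.add_one_le_exp (1:ℝ)
            linarith
    calc u ^ sx ≤ u ^ sy * u ^ (-(2 * c / Real.log (exp 1 + Z))) := h1
      _ ≤ u ^ sy * exp (n * (2 * c)) := by gcongr
      _ ≤ _ := by rw [mul_comm]; linarith

/-- the decaying error function -/
def Edec {n : ℕ} (x : Rn n) : ℝ≥0∞ := ofReal ((1 + ‖x‖) ^ (-(n:ℝ)))

lemma measurable_Edec {n : ℕ} : Measurable (Edec (n := n)) := by
  unfold Edec; fun_prop

lemma large_const {n : ℕ} {v : ℝ} (hv : 0 < v) {L b : ℝ} (hL : 0 < L) (hb : 1 ≤ b) :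
    ∃ K : ℝ, 0 < K ∧ ∀ R γ : ℝ, 0 < R → 0 ≤ γ → γ ≤ b →
      (R < 1/2 → γ ≤ L / Real.log (exp 1 + R⁻¹)) → ((v * R ^ n)⁻¹) ^ γ ≤ K := by
  refine ⟨(1 + v⁻¹) ^ b * exp (n * L) * (1 + 2 ^ n) ^ b, by positivity, fun R γ hR hγ hγb h => ?_⟩
  have e1 : ((v * R ^ n)⁻¹) ^ γ = (v⁻¹) ^ γ * ((R ^ n)⁻¹) ^ γ := by
    rw [mul_inv, Real.mul_rpow (by positivity) (by positivity)]
  have e2 : (v⁻¹) ^ γ ≤ (1 + v⁻¹) ^ b :=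
    calc (v⁻¹) ^ γ ≤ (1 + v⁻¹) ^ γ := by gcongr; linarith
      _ ≤ _ := Real.rpow_le_rpow_of_exponent_le (by have : 0 < v⁻¹ := by positivity
                                                    linarith) hγb
  have h1 : (1:ℝ) ≤ (1 + 2 ^ n) ^ b := Real.one_le_rpow (by have : (0:ℝ) < 2 ^ n := by positivity
                                                            linarith) (by linarith)
  have h2 : (1:ℝ) ≤ exp (n * L) := Real.one_le_exp (by positivity)
  have e3 : ((R ^ n)⁻¹) ^ γ ≤ exp (n * L) * (1 + 2 ^ n) ^ b := by
    rcases lt_or_ge R (1/2) with hR2 | hR2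
    · have hg := h hR2
      have h3 : ((R ^ n)⁻¹) ^ γ = exp (n * (γ * Real.log R⁻¹)) := by
        rw [Real.rpow_def_of_pos (by positivity), ← inv_pow, Real.log_pow]; congr 1; ring
      have h4 : γ * Real.log R⁻¹ ≤ L := by
        have hRi : 0 < R⁻¹ := by positivity
        have h5 : Real.log R⁻¹ ≤ Real.log (exp 1 + R⁻¹) :=
          Real.log_le_log hRi (by have := Real.exp_pos 1; linarith)
        have h6 := one_le_log_e hRi.le
        rw [le_div_iff₀ (by linarith)] at hg
        exact (mul_le_mul_of_nonneg_left h5 hγ).trans hg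
      rw [h3]
      calc exp (n * (γ * Real.log R⁻¹)) ≤ exp (n * L) := by gcongr
        _ = exp (n * L) * 1 := by ring
        _ ≤ _ := by gcongr
    · calc ((R ^ n)⁻¹) ^ γ ≤ (1 + 2 ^ n) ^ γ := by
            gcongr
            rw [← inv_pow]
            have : R⁻¹ ≤ 2 := by rw [inv_le_comm₀ hR (by norm_num)]; linarith
            calc R⁻¹ ^ n ≤ 2 ^ n := by gcongr
              _ ≤ _ := by linarith
        _ ≤ (1 + 2 ^ n) ^ b := Real.rpow_le_rpow_of_exponent_le (by have : (0:ℝ) < 2 ^ n := by positivity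
                                                                    linarith) hγb
        _ = 1 * (1 + 2 ^ n) ^ b := by ring
        _ ≤ _ := by gcongr
  rw [e1, mul_assoc]
  gcongr

lemma avg_rpow_le {n : ℕ} {s : Rn n → ℝ} (hs : LogH s) {b : ℝ} (h1 : ∀ x, 1 ≤ s x) (hb : ∀ x, s x ≤ b) :
    ∃ K : ℝ≥0∞, K ≠ ∞ ∧ ∀ f : Rn n → ℝ≥0∞, Measurable f → ∫⁻ x, (if 1 ≤ f x then f x ^ s x else 0) ≤ 1 →
      ∀ x (R : ℝ), 0 < R → ((volume (ball x R))⁻¹ * ∫⁻ y in ball x R, f y) ^ s x ≤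
        K * (mx (fun y => f y ^ s y) x + (Edec x + mx Edec x)) := by
  have hsc := hs.continuous
  have hsm : Measurable s := hsc.measurable
  obtain ⟨⟨L, hL, hloc⟩, s0, c, hc, hdec⟩ := hs
  have hb1 : 1 ≤ b := (h1 0).trans (hb 0)
  have hvpos : 0 < (volume (ball (0 : Rn n) 1)).toReal :=
    ENNReal.toReal_pos (vol_ball_pos _ one_pos) (vol_ball_top _ _)
  obtain ⟨K, hK0, hK⟩ := large_const (n := n) hvpos hL hb1
  set K2 : ℝ := exp (n * (2 * c))
  have hK2 : 1 ≤ K2 := Real.one_le_exp (by positivity)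
  refine ⟨2 ^ b * (ofReal K + ofReal K2), by finiteness, fun f hf hint x R hR => ?_⟩
  set μ : Measure (Rn n) := (volume (ball x R))⁻¹ • volume.restrict (ball x R) with hμ
  have hμ1 : μ Set.univ = 1 := by
    simp only [hμ, Measure.smul_apply, Measure.restrict_apply_univ, smul_eq_mul]
    exact ENNReal.inv_mul_cancel (vol_ball_pos x hR) (vol_ball_top _ _)
  have hav : ∀ g : Rn n → ℝ≥0∞, ∫⁻ y, g y ∂μ = (volume (ball x R))⁻¹ * ∫⁻ y in ball x R, g y := by
    intro g; rw [hμ, lintegral_smul_measure, smul_eq_mul]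
  have hav2 : ∀ g : Rn n → ℝ≥0∞, ∫⁻ y, g y ∂μ ≤ mx g x := by
    intro g; rw [hav]; exact avg_le_mx g x hR
  have hball : ∀ᵐ y ∂μ, y ∈ ball x R := Measure.ae_smul_measure (ae_restrict_mem measurableSet_ball) _
  rw [← hav]
  set f1 : Rn n → ℝ≥0∞ := fun y => if 1 ≤ f y then f y else 0 with hf1
  set f2 : Rn n → ℝ≥0∞ := fun y => if 1 ≤ f y then 0 else f y with hf2
  have hms : MeasurableSet {y | 1 ≤ f y} := measurableSet_le measurable_const hf
  have hf1m : Measurable f1 := Measurable.ite hms hf measurable_const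
  have hf2m : Measurable f2 := Measurable.ite hms measurable_const hf
  have hsum : ∫⁻ y, f y ∂μ = ∫⁻ y, f1 y ∂μ + ∫⁻ y, f2 y ∂μ := by
    rw [← lintegral_add_left hf1m]
    congr 1 with y
    by_cases h : 1 ≤ f y <;> simp [hf1, hf2, h]
  have hsx := h1 x
  have hconv : (∫⁻ y, f y ∂μ) ^ s x ≤ 2 ^ b * ((∫⁻ y, f1 y ∂μ) ^ s x + (∫⁻ y, f2 y ∂μ) ^ s x) := by
    rw [hsum]
    refine (ENNReal.rpow_add_le_mul_rpow_add_rpow _ _ hsx).trans ?_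
    gcongr
    · exact one_le_two
    · linarith [hb x]
  -- part one
  have hp1 : (∫⁻ y, f1 y ∂μ) ^ s x ≤ ofReal K * mx (fun y => f y ^ s y) x := by
    set X : ℝ≥0∞ := ∫⁻ y, (if 1 ≤ f y then f y ^ s y else 0) ∂μ with hX
    have hXv : X ≤ (volume (ball x R))⁻¹ := by
      rw [hX, hav]
      calc _ ≤ (volume (ball x R))⁻¹ * 1 := by
            gcongr
            exact (setLIntegral_le_lintegral _ _).trans hint
        _ = _ := mul_one _
    have hXm : X ≤ mx (fun y => f y ^ s y) x := by
      refine le_trans ?_ (hav2 _)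
      refine lintegral_mono fun y => ?_
      dsimp only
      split_ifs <;> simp
    obtain ⟨m, hm1, hmx, hmy, hγ⟩ : ∃ m : ℝ, 1 ≤ m ∧ m ≤ s x ∧ (∀ y ∈ ball x R, m ≤ s y) ∧
        (R < 1/2 → s x - m ≤ L / Real.log (exp 1 + R⁻¹)) := by
      by_cases hR2 : R < 1/2
      · have hl := one_le_log_e (X := R⁻¹) (by positivity)
        have hp : 0 < L / Real.log (exp 1 + R⁻¹) := by positivity
        refine ⟨max 1 (s x - L / Real.log (exp 1 + R⁻¹)), le_max_left _ _, max_le hsx (by linarith),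
          fun y hy => max_le (h1 y) ?_, fun _ => by linarith [le_max_right 1 (s x - L / Real.log (exp 1 + R⁻¹))]⟩
        rcases eq_or_ne y x with rfl | hne
        · linarith
        have hd : 0 < dist y x := dist_pos.2 hne
        have hyR : dist y x < R := hy
        have h3 := hloc y x (hyR.trans hR2)
        have h4 : L / Real.log (exp 1 + (dist y x)⁻¹) ≤ L / Real.log (exp 1 + R⁻¹) := by
          gcongr
        have := (abs_le.1 h3).1
        linarith
      · exact ⟨1, le_rfl, hsx, fun y _ => h1 y, fun h => absurd h hR2⟩
    have hmX : (∫⁻ y, f1 y ∂μ) ^ m ≤ X := by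
      refine (jensen_rpow μ hμ1.le hf1m.aemeasurable hm1).trans ?_
      refine lintegral_mono_ae ?_
      filter_upwards [hball] with y hy
      simp only [hf1]
      split_ifs with h
      · exact ENNReal.rpow_le_rpow_of_exponent_le h (hmy y hy)
      · rw [ENNReal.zero_rpow_of_pos (by linarith)]
    set γ := s x / m - 1 with hγd
    have hγ0 : 0 ≤ γ := by
      rw [hγd, sub_nonneg, le_div_iff₀ (by linarith)]; linarith
    have hγ1 : γ ≤ s x - m := by
      rw [hγd, div_sub_one (by linarith)]
      exact div_le_self (by linarith) hm1
    have hvol : volume (ball x R) = ofReal ((volume (ball (0 : Rn n) 1)).toReal * R ^ n) := by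
      rw [Measure.addHaar_ball_of_pos _ _ hR, ENNReal.ofReal_mul hvpos.le, ENNReal.ofReal_toReal (vol_ball_top _ _),
        mul_comm]
      simp
    have hXg : X ^ γ ≤ ofReal K := by
      calc X ^ γ ≤ ((volume (ball x R))⁻¹) ^ γ := ENNReal.rpow_le_rpow hXv hγ0
        _ ≤ _ := by
          rw [hvol, ← ENNReal.ofReal_inv_of_pos (by positivity), ENNReal.ofReal_rpow_of_pos (by positivity)]
          exact ENNReal.ofReal_le_ofReal (hK R γ hR hγ0 (by linarith [hb x]) fun h => hγ1.trans (hγ h))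
    calc (∫⁻ y, f1 y ∂μ) ^ s x = ((∫⁻ y, f1 y ∂μ) ^ m) ^ (γ + 1) := by
          rw [← ENNReal.rpow_mul]; congr 1; rw [hγd]; field_simp; ring
      _ ≤ X ^ (γ + 1) := ENNReal.rpow_le_rpow hmX (by linarith)
      _ = X ^ γ * X := by rw [ENNReal.rpow_add_of_nonneg _ _ hγ0 zero_le_one, ENNReal.rpow_one]
      _ ≤ _ := by gcongr
  have hp2 : (∫⁻ y, f2 y ∂μ) ^ s x ≤ ofReal K2 * mx (fun y => f y ^ s y) x + (Edec x + mx Edec x) := by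
    refine (jensen_rpow μ hμ1.le hf2m.aemeasurable hsx).trans ?_
    have hp : ∀ y, f2 y ^ s x ≤ ofReal K2 * f y ^ s y + (Edec x + Edec y) := by
      intro y
      simp only [hf2]
      split_ifs with h
      · rw [ENNReal.zero_rpow_of_pos (by linarith)]; exact zero_le
      push Not at h
      have hfin : f y ≠ ∞ := (h.trans ENNReal.one_lt_top).ne
      set u := (f y).toReal with hu
      have hfu : f y = ofReal u := (ENNReal.ofReal_toReal hfin).symm
      have hu0 : 0 ≤ u := ENNReal.toReal_nonneg
      have hu1 : u < 1 := by
        rw [hfu] at h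
        simpa using h
      rw [hfu, ENNReal.ofReal_rpow_of_nonneg hu0 (by linarith), ENNReal.ofReal_rpow_of_nonneg hu0 (by linarith [h1 y]),
        ← ENNReal.ofReal_mul (by positivity), Edec, Edec, ← ENNReal.ofReal_add (by positivity) (by positivity),
        ← ENNReal.ofReal_add (by positivity) (by positivity)]
      apply ENNReal.ofReal_le_ofReal
      rw [← add_assoc]
      exact ptw_small n hu0 hu1 hsx (h1 y) hc (norm_nonneg x) (norm_nonneg y) (hdec x) (hdec y)
    calc _ ≤ ∫⁻ y, (ofReal K2 * f y ^ s y + (Edec x + Edec y)) ∂μ := lintegral_mono hp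
      _ = ofReal K2 * ∫⁻ y, f y ^ s y ∂μ + (Edec x + ∫⁻ y, Edec y ∂μ) := by
          rw [lintegral_add_left (by fun_prop), lintegral_add_left measurable_const, lintegral_const, hμ1, mul_one,
            lintegral_const_mul _ (by fun_prop)]
      _ ≤ _ := by gcongr <;> exact hav2 _
  calc _ ≤ _ := hconv
    _ ≤ 2 ^ b * (ofReal K * mx (fun y => f y ^ s y) x +
      (ofReal K2 * mx (fun y => f y ^ s y) x + (Edec x + mx Edec x))) := by gcongr
    _ = 2 ^ b * ((ofReal K + ofReal K2) * mx (fun y => f y ^ s y) x + 1 * (Edec x + mx Edec x)) := by ring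
    _ ≤ 2 ^ b * ((ofReal K + ofReal K2) * mx (fun y => f y ^ s y) x + (ofReal K + ofReal K2) * (Edec x + mx Edec x)) := by
        gcongr
        refine le_trans ?_ le_add_self
        simpa using ENNReal.ofReal_le_ofReal hK2
    _ = _ := by ring

lemma lintegral_Edec {n : ℕ} {a : ℝ} (hn : 0 < n) (ha : 1 < a) : ∫⁻ x : Rn n, Edec x ^ a ≠ ∞ := by
  have h := finite_integral_one_add_norm (E := Rn n) (μ := volume) (r := n * a) (by
    simp only [finrank_euclideanSpace, Fintype.card_fin]
    have : (0:ℝ) < n := by exact_mod_cast hn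
    nlinarith)
  refine ne_of_lt ?_
  convert h using 3 with x
  rw [Edec, ENNReal.ofReal_rpow_of_pos (by positivity), ← Real.rpow_mul (by positivity)]
  congr 2; ring

lemma mx_var {n : ℕ} (hn : 0 < n) {r : Rn n → ℝ} (hr : LogH r) {a b : ℝ} (ha : 1 < a)
    (har : ∀ x, a ≤ r x) (hrb : ∀ x, r x ≤ b) :
    ∃ C : ℝ≥0∞, C ≠ ∞ ∧ ∀ f : Rn n → ℝ≥0∞, Measurable f → ∫⁻ x, f x ^ r x ≤ 1 →
      ∫⁻ x, mx f x ^ r x ≤ C := by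
  set s : Rn n → ℝ := fun x => a⁻¹ * r x with hs
  have hsL : LogH s := by simpa [hs] using hr.affine a⁻¹ 0
  have hsr : ∀ x, s x * a = r x := fun x => by simp only [hs]; field_simp
  have h1 : ∀ x, 1 ≤ s x := fun x => by
    simp only [hs]; rw [inv_mul_eq_div, le_div_iff₀ (by linarith)]; linarith [har x]
  have hsle : ∀ x, s x ≤ r x := fun x => by rw [← hsr]; nlinarith [h1 x]
  obtain ⟨K, hK, hKf⟩ := avg_rpow_le hsL h1 (fun x => (hsle x).trans (hrb x))
  obtain ⟨C, hC, hCf⟩ := mx_strong hn ha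
  have hEi := lintegral_Edec hn ha
  have ha0 : 0 ≤ a := by linarith
  refine ⟨K ^ a * (2 ^ (a-1) * (C + 2 ^ (a-1) * ((∫⁻ x : Rn n, Edec x ^ a) + C * ∫⁻ x : Rn n, Edec x ^ a))), ?_, fun f hf hint => ?_⟩
  · have : (2:ℝ≥0∞) ^ (a-1) ≠ ∞ := ENNReal.rpow_ne_top_of_nonneg (by linarith) (by simp)
    have hKa : K ^ a ≠ ∞ := ENNReal.rpow_ne_top_of_nonneg ha0 hK
    exact ENNReal.mul_ne_top hKa (ENNReal.mul_ne_top this (ENNReal.add_ne_top.2 ⟨hC, ENNReal.mul_ne_top this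
      (ENNReal.add_ne_top.2 ⟨hEi, ENNReal.mul_ne_top hC hEi⟩)⟩))
  have hi1 : ∫⁻ x, (if 1 ≤ f x then f x ^ s x else 0) ≤ 1 := by
    refine le_trans (lintegral_mono fun x => ?_) hint
    dsimp only
    split_ifs with h
    · exact ENNReal.rpow_le_rpow_of_exponent_le h (hsle x)
    · exact zero_le
  have hpt : ∀ x, mx f x ^ s x ≤ K * (mx (fun y => f y ^ s y) x + (Edec x + mx Edec x)) := by
    intro x
    have hsx : 0 < s x := by linarith [h1 x]
    rw [← ENNReal.le_rpow_inv_iff hsx]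
    unfold mx
    refine iSup₂_le fun R hR => ?_
    rw [ENNReal.le_rpow_inv_iff hsx]
    exact hKf f hf hi1 x R hR
  have hsm : Measurable s := hsL.continuous.measurable
  calc ∫⁻ x, mx f x ^ r x = ∫⁻ x, (mx f x ^ s x) ^ a := by
        congr 1 with x; rw [← ENNReal.rpow_mul, hsr]
    _ ≤ ∫⁻ x, K ^ a * (2 ^ (a-1) * (mx (fun y => f y ^ s y) x ^ a + 2 ^ (a-1) * (Edec x ^ a + mx Edec x ^ a))) := by
        refine lintegral_mono fun x => ?_
        calc (mx f x ^ s x) ^ a ≤ (K * (mx (fun y => f y ^ s y) x + (Edec x + mx Edec x))) ^ a :=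
              ENNReal.rpow_le_rpow (hpt x) ha0
          _ ≤ _ := by
            rw [ENNReal.mul_rpow_of_nonneg _ _ ha0]
            gcongr
            refine (ENNReal.rpow_add_le_mul_rpow_add_rpow _ _ ha.le).trans ?_
            gcongr
            exact ENNReal.rpow_add_le_mul_rpow_add_rpow _ _ ha.le
    _ = K ^ a * (2 ^ (a-1) * ((∫⁻ x, mx (fun y => f y ^ s y) x ^ a) + 2 ^ (a-1) * ((∫⁻ x : Rn n, Edec x ^ a) + ∫⁻ x : Rn n, mx Edec x ^ a))) := by
        have m1 := measurable_mx (fun y => f y ^ s y)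
        have m2 := measurable_mx (Edec (n := n))
        have m3 := measurable_Edec (n := n)
        rw [lintegral_const_mul _ (by fun_prop), lintegral_const_mul _ (by fun_prop), lintegral_add_left (by fun_prop),
          lintegral_const_mul _ (by fun_prop), lintegral_add_left (by fun_prop)]
    _ ≤ _ := by
        gcongr
        · refine (hCf _ (by fun_prop)).trans ?_
          calc _ = C * ∫⁻ x, f x ^ r x := by
                congr 2 with x; rw [← ENNReal.rpow_mul, hsr]
            _ ≤ C * 1 := by gcongr
            _ = C := mul_one C
        · exact hCf _ measurable_Edec

lemma sph_univ (n : ℕ) : unitSphereMeasure n Set.univ ≤ 1 := by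
  simp only [unitSphereMeasure, Measure.smul_apply, smul_eq_mul]
  exact ENNReal.inv_mul_le_one _

instance sph_fin (n : ℕ) : IsFiniteMeasure (unitSphereMeasure n) :=
  ⟨(sph_univ n).trans_lt ENNReal.one_lt_top⟩

lemma sph_ae (n : ℕ) : ∀ᵐ ω ∂(unitSphereMeasure n), ‖ω‖ = 1 := by
  apply Measure.ae_smul_measure
  filter_upwards [ae_restrict_mem isClosed_sphere.measurableSet] with x hx
  simpa using hx

lemma sph_rot {n : ℕ} (e : Rn n ≃ₗᵢ[ℝ] Rn n) :
    MeasurePreserving e (unitSphereMeasure n) (unitSphereMeasure n) := by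
  have h := (e.toIsometryEquiv.measurePreserving_hausdorffMeasure ((n:ℝ) - 1)).restrict_preimage
    (s := sphere (0 : Rn n) 1) isClosed_sphere.measurableSet
  have h2 : (e.toIsometryEquiv ⁻¹' sphere (0 : Rn n) 1) = sphere 0 1 := by
    ext x; simp
  rw [h2] at h
  exact h.smul_measure _

lemma exists_rot {n : ℕ} {x y : Rn n} (h : ‖x‖ = ‖y‖) : ∃ e : Rn n ≃ₗᵢ[ℝ] Rn n, e x = y :=
  ⟨_, Submodule.reflection_sub h⟩

lemma sph_lint_rot {n : ℕ} (g : ℝ → ℝ≥0∞) {x y : Rn n} (h : ‖x‖ = ‖y‖) :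
    ∫⁻ ω, g ‖x - ω‖ ∂(unitSphereMeasure n) = ∫⁻ ω, g ‖y - ω‖ ∂(unitSphereMeasure n) := by
  obtain ⟨e, rfl⟩ := exists_rot h
  rw [← (sph_rot e).lintegral_comp_emb e.toHomeomorph.measurableEmbedding (fun ω => g ‖e x - ω‖)]
  congr 1 with ω
  rw [← map_sub, e.norm_map]

lemma exists_unit {n : ℕ} (hn : 0 < n) (w : Rn n) : ∃ u : Rn n, ‖u‖ = 1 ∧ w = ‖w‖ • u := by
  by_cases h : w = 0
  · refine ⟨EuclideanSpace.single ⟨0, hn⟩ 1, by simp, by simp [h]⟩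
  · have : ‖w‖ ≠ 0 := norm_ne_zero_iff.2 h
    exact ⟨‖w‖⁻¹ • w, by rw [norm_smul, norm_inv, norm_norm, inv_mul_cancel₀ this], by rw [smul_smul, mul_inv_cancel₀ this, one_smul]⟩

lemma lint_gauss {n : ℕ} {b : ℝ} (hb : 0 < b) (z : Rn n) :
    ∫⁻ x : Rn n, ofReal (exp (-b * ‖x - z‖ ^ 2)) = ofReal ((Real.pi / b) ^ ((n:ℝ)/2)) := by
  rw [lintegral_sub_right_eq_self (fun x => ofReal (exp (-b * ‖x‖ ^ 2))) z]
  have h := GaussianFourier.integral_rexp_neg_mul_sq_norm (V := Rn n) hb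
  rw [finrank_euclideanSpace, Fintype.card_fin] at h
  rw [← h, ofReal_integral_eq_lintegral_ofReal]
  · by_contra hc
    rw [integral_undef hc] at h
    have : 0 < (Real.pi / b) ^ ((n:ℝ)/2) := by positivity
    linarith
  · exact Eventually.of_forall fun x => (Real.exp_pos _).le

lemma sph_gauss {n : ℕ} (hn : 0 < n) : ∃ C : ℝ, 0 < C ∧ ∀ δ : ℝ, 0 < δ → ∀ w : Rn n, ‖w‖ = 1 →
    ∫⁻ ω, ofReal (exp (-‖w - ω‖^2 / (4 * δ^2))) ∂(unitSphereMeasure n) ≤ ofReal (C * (δ^n * δ⁻¹)) := by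
  set v := (volume (ball (0 : Rn n) 1)).toReal with hv
  have hvpos : 0 < v := ENNReal.toReal_pos (vol_ball_pos _ one_pos) (vol_ball_top _ _)
  have hv' : volume (ball (0 : Rn n) 1) = ofReal v := (ENNReal.ofReal_toReal (vol_ball_top _ _)).symm
  have hn' : (0:ℝ) < n := by exact_mod_cast hn
  refine ⟨exp 1 * (8 * Real.pi) ^ ((n:ℝ)/2) / (n * v), by positivity, fun δ hδ w hw => ?_⟩
  set M := ∫⁻ ω, ofReal (exp (-‖w - ω‖^2 / (4 * δ^2))) ∂(unitSphereMeasure n) with hM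
  set A : Set (Rn n) := ball 0 (1 + δ) \ ball 0 1 with hA
  have hAm : MeasurableSet A := measurableSet_ball.diff measurableSet_ball
  have hvol : ofReal (n * δ * v) ≤ volume A := by
    have h1 : volume (ball (0 : Rn n) (1 + δ)) ≤ volume A + volume (ball (0 : Rn n) 1) := by
      refine (measure_mono ?_).trans (measure_union_le _ _)
      rw [hA]; intro x hx
      by_cases hx1 : x ∈ ball (0 : Rn n) 1
      · exact Or.inr hx1
      · exact Or.inl ⟨hx, hx1⟩
    have h2 : ofReal (n * δ * v) + volume (ball (0 : Rn n) 1) ≤ volume (ball (0 : Rn n) (1 + δ)) := by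
      rw [Measure.addHaar_ball_of_pos _ _ (by linarith : 0 < 1 + δ), hv', ← ENNReal.ofReal_add (by positivity) hvpos.le,
        ← ENNReal.ofReal_mul (by positivity)]
      apply ENNReal.ofReal_le_ofReal
      have := one_add_mul_le_pow (a := δ) (by linarith) n
      rw [finrank_euclideanSpace, Fintype.card_fin]
      nlinarith
    exact (ENNReal.add_le_add_iff_right (vol_ball_top (0 : Rn n) 1)).1 (h2.trans h1)
  have hptw : ∀ x ∈ A, ofReal (exp (-1)) * M ≤
      ∫⁻ ω, ofReal (exp (-(8 * δ^2)⁻¹ * ‖x - ω‖^2)) ∂(unitSphereMeasure n) := by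
    intro x hx
    obtain ⟨u, hu, hxu⟩ := exists_unit hn x
    have hx1 : 1 ≤ ‖x‖ ∧ ‖x‖ < 1 + δ := by
      simpa [hA, and_comm] using hx
    have hMu : M = ∫⁻ ω, ofReal (exp (-‖u - ω‖^2 / (4 * δ^2))) ∂(unitSphereMeasure n) :=
      sph_lint_rot (fun r => ofReal (exp (-r^2 / (4 * δ^2)))) (hw.trans hu.symm)
    rw [hMu, ← lintegral_const_mul' _ _ ENNReal.ofReal_ne_top]
    refine lintegral_mono fun ω => ?_
    rw [← ENNReal.ofReal_mul (Real.exp_pos _).le, ← Real.exp_add]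
    apply ENNReal.ofReal_le_ofReal
    apply Real.exp_le_exp.2
    have h3 : ‖x - ω‖ ≤ δ + ‖u - ω‖ := by
      have : x - ω = (x - u) + (u - ω) := by abel
      have h4 : ‖x - u‖ ≤ δ := by
        have : x - u = (‖x‖ - 1) • u := by rw [sub_smul, one_smul, ← hxu]
        rw [this, norm_smul, hu, mul_one, Real.norm_eq_abs, abs_of_nonneg (by linarith)]; linarith
      calc ‖x - ω‖ = ‖(x - u) + (u - ω)‖ := by rw [this]
        _ ≤ _ := norm_add_le _ _
        _ ≤ _ := by gcongr
    have h5 : ‖x - ω‖^2 ≤ 2 * δ^2 + 2 * ‖u - ω‖^2 := by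
      nlinarith [norm_nonneg (x - ω), norm_nonneg (u - ω), sq_nonneg (δ - ‖u - ω‖)]
    have h6 : (8 * δ^2)⁻¹ * ‖x - ω‖^2 ≤ (8 * δ^2)⁻¹ * (2 * δ^2 + 2 * ‖u - ω‖^2) := by gcongr
    have h7 : (8 * δ^2)⁻¹ * (2 * δ^2 + 2 * ‖u - ω‖^2) = 1/4 + ‖u - ω‖^2 / (4 * δ^2) := by field_simp; ring
    rw [h7] at h6
    have : -‖u - ω‖^2 / (4 * δ^2) = -(‖u - ω‖^2 / (4 * δ^2)) := by ring
    rw [this]; linarith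
  have htot : ofReal (exp (-1)) * M * volume A ≤ ofReal ((8 * Real.pi) ^ ((n:ℝ)/2) * δ ^ n) := by
    calc _ = ∫⁻ x in A, ofReal (exp (-1)) * M := by rw [setLIntegral_const]
      _ ≤ ∫⁻ x in A, ∫⁻ ω, ofReal (exp (-(8 * δ^2)⁻¹ * ‖x - ω‖^2)) ∂(unitSphereMeasure n) :=
          setLIntegral_mono' hAm hptw
      _ ≤ ∫⁻ x, ∫⁻ ω, ofReal (exp (-(8 * δ^2)⁻¹ * ‖x - ω‖^2)) ∂(unitSphereMeasure n) :=
          setLIntegral_le_lintegral _ _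
      _ = ∫⁻ ω, ∫⁻ x, ofReal (exp (-(8 * δ^2)⁻¹ * ‖x - ω‖^2)) ∂volume ∂(unitSphereMeasure n) := by
          apply lintegral_lintegral_swap
          apply Measurable.aemeasurable
          unfold Function.uncurry
          fun_prop
      _ = ∫⁻ ω, ofReal ((8 * Real.pi) ^ ((n:ℝ)/2) * δ ^ n) ∂(unitSphereMeasure n) := by
          congr 1 with ω
          rw [lint_gauss (by positivity)]
          congr 1
          rw [div_inv_eq_mul, show Real.pi * (8 * δ^2) = (8 * Real.pi) * δ^2 by ring, Real.mul_rpow (by positivity) (by positivity),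
            ← Real.rpow_natCast δ 2, ← Real.rpow_mul hδ.le, ← Real.rpow_natCast δ n]
          congr 2
          push_cast; ring
      _ ≤ _ := by
          rw [lintegral_const]
          calc _ ≤ ofReal ((8 * Real.pi) ^ ((n:ℝ)/2) * δ ^ n) * 1 := by gcongr; exact sph_univ n
            _ = _ := mul_one _
  have h8 : M * ofReal (exp (-1) * (n * δ * v)) ≤ ofReal ((8 * Real.pi) ^ ((n:ℝ)/2) * δ ^ n) := by
    refine le_trans ?_ htot
    rw [ENNReal.ofReal_mul (Real.exp_pos _).le]
    calc _ = ofReal (exp (-1)) * M * ofReal (n * δ * v) := by ring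
      _ ≤ _ := by gcongr
  have hpos : 0 < exp (-1) * (n * δ * v) := by positivity
  rw [← ENNReal.le_div_iff_mul_le (Or.inl (by simpa using hpos)) (Or.inl ENNReal.ofReal_ne_top), ← ENNReal.ofReal_div_of_pos hpos] at h8
  refine h8.trans (ENNReal.ofReal_le_ofReal (le_of_eq ?_))
  rw [Real.exp_neg]
  field_simp

/-- normalized Gaussian of width `δ`. -/
def gs {n : ℕ} (δ : ℝ) (z : Rn n) : ℝ := (δ ^ n)⁻¹ * exp (-Real.pi * ‖z‖ ^ 2 / δ ^ 2)

lemma gs_nonneg {n : ℕ} {δ : ℝ} (hδ : 0 < δ) (z : Rn n) : 0 ≤ gs δ z := by unfold gs; positivity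

lemma continuous_gs {n : ℕ} (δ : ℝ) : Continuous (gs (n := n) δ) := by unfold gs; fun_prop

lemma sph_gs {n : ℕ} (hn : 0 < n) : ∃ C : ℝ, 0 < C ∧ ∀ δ : ℝ, 0 < δ → δ ≤ 1 → ∀ w : Rn n,
    ∫⁻ ω, ofReal (gs δ (w - ω)) ∂(unitSphereMeasure n) ≤ ofReal (C * δ⁻¹ * exp (-(Real.pi/4) * ‖w‖^2)) := by
  obtain ⟨C, hC, h⟩ := sph_gauss hn
  refine ⟨C * exp (Real.pi / 2), by positivity, fun δ hδ hδ1 w => ?_⟩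
  obtain ⟨u, hu, hwu⟩ := exists_unit hn w
  have hpi := Real.pi_gt_three
  have hp : ∀ ω : Rn n, ‖ω‖ = 1 → gs δ (w - ω) ≤ (δ^n)⁻¹ * (exp (Real.pi / 2) * exp (-(Real.pi/4) * ‖w‖^2)) * exp (-‖u - ω‖^2 / (4 * δ^2)) := by
    intro ω hω
    unfold gs
    rw [mul_assoc]
    gcongr
    rw [← Real.exp_add, ← Real.exp_add]
    apply Real.exp_le_exp.2
    have h1 : |‖w‖ - 1| ≤ ‖w - ω‖ := by rw [← hω]; exact abs_norm_sub_norm_le w ω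
    have h2 : ‖u - ω‖ ≤ 2 * ‖w - ω‖ := by
      have h3 : ‖u - w‖ = |‖w‖ - 1| := by
        have : u - w = (1 - ‖w‖) • u := by rw [sub_smul, one_smul, ← hwu]
        rw [this, norm_smul, hu, mul_one, Real.norm_eq_abs, abs_sub_comm]
      calc ‖u - ω‖ = ‖(u - w) + (w - ω)‖ := by congr 1; abel
        _ ≤ ‖u - w‖ + ‖w - ω‖ := norm_add_le _ _
        _ ≤ _ := by rw [h3]; linarith
    set d := ‖w - ω‖
    have hd : 0 ≤ d := norm_nonneg _
    have h4 : (‖w‖ - 1)^2 ≤ d^2 := by rw [← sq_abs]; gcongr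
    have h5 : ‖u - ω‖^2 ≤ 4 * d^2 := by
      calc ‖u - ω‖^2 ≤ (2 * d)^2 := by gcongr
        _ = _ := by ring
    have h6 : ‖w‖^2 / 2 - 1 ≤ d^2 := by nlinarith [sq_nonneg (‖w‖ - 2)]
    have h7 : -Real.pi * d^2 / δ^2 = -(Real.pi/2) * (d^2/δ^2) - (Real.pi/2) * (d^2/δ^2) := by ring
    have h8 : d^2 ≤ d^2 / δ^2 := by
      rw [le_div_iff₀ (by positivity)]
      have : δ^2 ≤ 1 := pow_le_one₀ hδ.le hδ1
      nlinarith [sq_nonneg d]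
    have h9 : -‖u - ω‖^2 / (4 * δ^2) ≥ - (d^2/δ^2) := by
      rw [ge_iff_le, neg_div, neg_le_neg_iff, div_le_div_iff₀ (by positivity) (by positivity)]
      nlinarith [sq_nonneg δ]
    have h10 : 0 ≤ d^2/δ^2 := by positivity
    rw [h7]
    nlinarith
  calc _ ≤ ∫⁻ ω, ofReal ((δ^n)⁻¹ * (exp (Real.pi / 2) * exp (-(Real.pi/4) * ‖w‖^2)) * exp (-‖u - ω‖^2 / (4 * δ^2))) ∂(unitSphereMeasure n) := by
        refine lintegral_mono_ae ?_
        filter_upwards [sph_ae n] with ω hω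
        exact ENNReal.ofReal_le_ofReal (hp ω hω)
    _ = ofReal ((δ^n)⁻¹ * (exp (Real.pi / 2) * exp (-(Real.pi/4) * ‖w‖^2))) * ∫⁻ ω, ofReal (exp (-‖u - ω‖^2 / (4 * δ^2))) ∂(unitSphereMeasure n) := by
        rw [← lintegral_const_mul' _ _ ENNReal.ofReal_ne_top]
        congr 1 with ω
        rw [← ENNReal.ofReal_mul (by positivity)]
    _ ≤ ofReal ((δ^n)⁻¹ * (exp (Real.pi / 2) * exp (-(Real.pi/4) * ‖w‖^2))) * ofReal (C * (δ^n * δ⁻¹)) := by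
        gcongr
        exact h δ hδ u hu
    _ = _ := by
        rw [← ENNReal.ofReal_mul (by positivity)]
        congr 1
        field_simp

lemma gauss_mx {n : ℕ} {c : ℝ} (hc : 0 < c) : ∃ C : ℝ≥0∞, C ≠ ∞ ∧ ∀ f : Rn n → ℝ≥0∞, Measurable f →
    ∀ t : ℝ, 0 < t → ∀ x, ∫⁻ y, f y * ofReal ((t^n)⁻¹ * exp (-c * ‖t⁻¹ • (x - y)‖^2)) ≤ C * mx f x := by
  set v := volume (ball (0 : Rn n) 1) with hv
  have hsum : Summable fun k : ℕ => ((k:ℝ)+1)^n * exp (-c * k^2) := by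
    have h := Real.summable_pow_mul_exp_neg_nat_mul n hc
    have h2 := ((summable_nat_add_iff 1).2 h).mul_left (exp c)
    refine Summable.of_nonneg_of_le (fun k => by positivity) (fun k => ?_) h2
    push_cast
    calc ((k:ℝ)+1)^n * exp (-c * k^2) ≤ ((k:ℝ)+1)^n * exp (-c * k) := by
          gcongr 2
          have : (k:ℝ) ≤ k^2 := by exact_mod_cast Nat.le_self_pow two_ne_zero k
          nlinarith
      _ = _ := by
          rw [mul_left_comm, ← Real.exp_add]; congr 2; ring
  refine ⟨(∑' k : ℕ, ofReal (((k:ℝ)+1)^n * exp (-c * k^2))) * v,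
    ENNReal.mul_ne_top hsum.tsum_ofReal_ne_top (vol_ball_top _ _), fun f hf t ht x => ?_⟩
  have hp : ∀ y, f y * ofReal ((t^n)⁻¹ * exp (-c * ‖t⁻¹ • (x - y)‖^2)) ≤
      ∑' k : ℕ, ofReal ((t^n)⁻¹ * exp (-c * k^2)) * (ball x (t * (k+1))).indicator f y := by
    intro y
    set d := ‖t⁻¹ • (x - y)‖
    have hd : ‖x - y‖ = t * d := by
      simp only [d]; rw [norm_smul, norm_inv, Real.norm_eq_abs, abs_of_pos ht]; field_simp
    have hd0 : 0 ≤ d := norm_nonneg _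
    refine le_trans ?_ (ENNReal.le_tsum ⌊d⌋₊)
    rw [Set.indicator_of_mem, mul_comm]
    · gcongr ofReal (_ * exp ?_) * _
      have h1 : (⌊d⌋₊ : ℝ) ≤ d := Nat.floor_le hd0
      have : (⌊d⌋₊ : ℝ)^2 ≤ d^2 := by gcongr
      nlinarith
    · rw [mem_ball, dist_comm, dist_eq_norm, hd]
      gcongr
      exact Nat.lt_floor_add_one d
  calc _ ≤ ∫⁻ y, ∑' k : ℕ, ofReal ((t^n)⁻¹ * exp (-c * k^2)) * (ball x (t * (k+1))).indicator f y := lintegral_mono hp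
    _ = ∑' k : ℕ, ofReal ((t^n)⁻¹ * exp (-c * k^2)) * ∫⁻ y in ball x (t * (k+1)), f y := by
        rw [lintegral_tsum]
        · congr 1 with k
          rw [lintegral_const_mul' _ _ ENNReal.ofReal_ne_top, lintegral_indicator measurableSet_ball]
        · intro k
          exact ((hf.indicator measurableSet_ball).const_mul _).aemeasurable
    _ ≤ ∑' k : ℕ, ofReal (((k:ℝ)+1)^n * exp (-c * k^2)) * (v * mx f x) := by
        refine ENNReal.tsum_le_tsum fun k => ?_
        have hk : 0 < t * ((k:ℝ)+1) := by positivity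
        calc _ ≤ ofReal ((t^n)⁻¹ * exp (-c * k^2)) * (volume (ball x (t * (k+1))) * mx f x) := by
              gcongr; exact lintegral_ball_le_mx f x hk
          _ = _ := by
              rw [Measure.addHaar_ball_of_pos _ _ hk, ← hv, finrank_euclideanSpace, Fintype.card_fin, ← mul_assoc, ← mul_assoc, ← ENNReal.ofReal_mul (by positivity), ← mul_assoc]
              congr 3
              rw [mul_pow]
              field_simp
    _ = _ := by rw [ENNReal.tsum_mul_right]; ring

/-- character -/
def ee {n : ℕ} (x ξ : Rn n) : ℂ := Complex.exp (((2 * Real.pi * inner ℝ x ξ : ℝ) : ℂ) * Complex.I)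

lemma norm_ee {n : ℕ} (x ξ : Rn n) : ‖ee x ξ‖ = 1 := Complex.norm_exp_ofReal_mul_I _

lemma ee_add {n : ℕ} (x y ξ : Rn n) : ee (x + y) ξ = ee x ξ * ee y ξ := by
  unfold ee
  rw [← Complex.exp_add, inner_add_left]
  congr 1; push_cast; ring

lemma conj_ee {n : ℕ} (x ξ : Rn n) : (starRingEnd ℂ) (ee x ξ) = ee (-x) ξ := by
  unfold ee
  rw [← Complex.exp_conj, inner_neg_left, map_mul, Complex.conj_ofReal, Complex.conj_I]
  congr 1; push_cast; ring

lemma ee_comm {n : ℕ} (x ξ : Rn n) : ee x ξ = ee ξ x := by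
  unfold ee; rw [real_inner_comm]

@[fun_prop]
lemma continuous_ee {n : ℕ} {X : Type*} [TopologicalSpace X] {f g : X → Rn n} (hf : Continuous f) (hg : Continuous g) :
    Continuous (fun x => ee (f x) (g x)) := by
  unfold ee; fun_prop

lemma gauss_ft {n : ℕ} {δ : ℝ} (hδ : 0 < δ) (z : Rn n) :
    ∫ ξ : Rn n, ((exp (-(Real.pi * δ^2) * ‖ξ‖^2) : ℝ) : ℂ) * ee z ξ = (gs δ z : ℂ) := by
  have h := GaussianFourier.integral_cexp_neg_mul_sq_norm_add (V := Rn n) (b := ((Real.pi * δ^2 : ℝ) : ℂ))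
    (by rw [Complex.ofReal_re]; positivity) (2 * Real.pi * Complex.I) z
  have hpi := Real.pi_pos
  have e1 : (↑Real.pi / ((Real.pi * δ^2 : ℝ) : ℂ)) ^ (((Module.finrank ℝ (Rn n) : ℕ) : ℂ) / 2) = (((δ^n)⁻¹ : ℝ) : ℂ) := by
    rw [← Complex.ofReal_div, finrank_euclideanSpace, Fintype.card_fin,
      show ((n:ℂ)/2) = (((n:ℝ)/2 : ℝ) : ℂ) by push_cast; ring, ← Complex.ofReal_cpow (by positivity)]
    congr 1
    rw [show Real.pi / (Real.pi * δ^2) = (δ^2)⁻¹ by field_simp, Real.inv_rpow (by positivity), ← Real.rpow_natCast δ 2,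
      ← Real.rpow_mul hδ.le, ← Real.rpow_natCast δ n]
    congr 2; push_cast; ring
  rw [e1] at h
  unfold gs
  rw [Complex.ofReal_mul]
  convert h using 2
  · ext ξ
    unfold ee
    rw [Complex.ofReal_exp, ← Complex.exp_add]
    congr 1; push_cast; ring
  · rw [Complex.ofReal_exp]
    congr 1
    push_cast
    rw [mul_pow, mul_pow, Complex.I_sq]
    have : (Real.pi : ℂ) ≠ 0 := by exact_mod_cast hpi.ne'
    have : (δ : ℂ) ≠ 0 := by exact_mod_cast hδ.ne'
    field_simp
    ring

lemma integrable_gauss {n : ℕ} {b : ℝ} (hb : 0 < b) : Integrable (fun ξ : Rn n => exp (-b * ‖ξ‖^2)) := by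
  by_contra hc
  have h := GaussianFourier.integral_rexp_neg_mul_sq_norm (V := Rn n) hb
  rw [integral_undef hc] at h
  have : 0 < (Real.pi / b) ^ (((Module.finrank ℝ (Rn n) : ℕ) : ℝ)/2) := by positivity
  linarith

/-- Fourier transform of `h dν`. -/
def ft {n : ℕ} (ν : Measure (Rn n)) (h : Rn n → ℂ) (ξ : Rn n) : ℂ := ∫ x, h x * ee (-x) ξ ∂ν

lemma norm_ft_le {n : ℕ} (ν : Measure (Rn n)) (h : Rn n → ℂ) (ξ : Rn n) : ‖ft ν h ξ‖ ≤ ∫ x, ‖h x‖ ∂ν := by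
  refine (norm_integral_le_integral_norm _).trans (le_of_eq ?_)
  congr 1 with x
  rw [norm_mul, norm_ee, mul_one]

lemma integrable_mul_ee {n : ℕ} {ν : Measure (Rn n)} {h : Rn n → ℂ} (hh : Integrable h ν) (ξ : Rn n) :
    Integrable (fun x => h x * ee (-x) ξ) ν := by
  refine hh.mono (hh.1.mul (by fun_prop)) (Eventually.of_forall fun x => ?_)
  rw [norm_mul, norm_ee, mul_one]

lemma continuous_ft {n : ℕ} {ν : Measure (Rn n)} {h : Rn n → ℂ} (hh : Integrable h ν) : Continuous (ft ν h) := by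
  refine continuous_of_dominated (bound := fun x => ‖h x‖) (fun ξ => (integrable_mul_ee hh ξ).1) (fun ξ => Eventually.of_forall fun x => ?_)
    hh.norm (Eventually.of_forall fun x => by fun_prop)
  rw [norm_mul, norm_ee, mul_one]

lemma lemmaP {n : ℕ} {ν : Measure (Rn n)} [SFinite ν] {h : Rn n → ℂ} (hh : Integrable h ν) {δ : ℝ} (hδ : 0 < δ) :
    ∫⁻ ξ, ‖ft ν h ξ‖ₑ ^ 2 * ofReal (exp (-(Real.pi * δ^2) * ‖ξ‖^2)) ≤
      ∫⁻ x, ∫⁻ y, ‖h x‖ₑ * ‖h y‖ₑ * ofReal (gs δ (x - y)) ∂ν ∂ν := by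
  set g : Rn n → ℝ := fun ξ => exp (-(Real.pi * δ^2) * ‖ξ‖^2) with hg
  have hgi : Integrable g := integrable_gauss (by positivity)
  set F : Rn n × (Rn n × Rn n) → ℂ := fun z => (g z.1 : ℂ) * (h z.2.1 * (starRingEnd ℂ) (h z.2.2)) * ee (z.2.2 - z.2.1) z.1 with hF
  have hFi0 : Integrable (fun z : Rn n × (Rn n × Rn n) => (g z.1 : ℂ) * (h z.2.1 * (starRingEnd ℂ) (h z.2.2))) (volume.prod (ν.prod ν)) :=
    Integrable.mul_prod hgi.ofReal (hh.mul_prod (Complex.conjLIE.integrable_comp_iff.2 hh))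
  have hFi : Integrable F (volume.prod (ν.prod ν)) := by
    refine hFi0.mono (hFi0.1.mul (by fun_prop)) (Eventually.of_forall fun z => ?_)
    rw [hF, norm_mul, norm_ee, mul_one]
  have hGF : ∀ ξ, ((‖ft ν h ξ‖^2 * g ξ : ℝ) : ℂ) = ∫ z, F (ξ, z) ∂(ν.prod ν) := by
    intro ξ
    have e1 : ((‖ft ν h ξ‖^2 : ℝ) : ℂ) = ft ν h ξ * (starRingEnd ℂ) (ft ν h ξ) := by
      rw [Complex.mul_conj, Complex.normSq_eq_norm_sq]
    have e2 : (starRingEnd ℂ) (ft ν h ξ) = ∫ y, (starRingEnd ℂ) (h y) * ee y ξ ∂ν := by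
      rw [ft, ← integral_conj]
      congr 1 with y
      rw [map_mul, conj_ee, neg_neg]
    rw [Complex.ofReal_mul, e1, e2, ft, ← integral_prod_mul, ← integral_mul_const]
    congr 1 with z
    simp only [hF]
    rw [sub_eq_add_neg, ee_add]
    ring
  have hGi : Integrable (fun ξ => ‖ft ν h ξ‖^2 * g ξ) := by
    have h1 := hFi.integral_prod_left
    have h2 : Integrable (fun ξ => ((‖ft ν h ξ‖^2 * g ξ : ℝ) : ℂ)) := by simpa only [hGF] using h1
    exact (by simpa only [Complex.ofReal_re, RCLike.re_eq_complex_re] using h2.re)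
  have hsw : ∫ ξ, ((‖ft ν h ξ‖^2 * g ξ : ℝ) : ℂ) = ∫ z, h z.1 * (starRingEnd ℂ) (h z.2) * (gs δ (z.2 - z.1) : ℂ) ∂(ν.prod ν) := by
    simp_rw [hGF]
    rw [integral_integral_swap (f := fun ξ z => F (ξ, z)) hFi]
    congr 1 with z
    rw [← gauss_ft hδ, ← integral_const_mul]
    congr 1 with ξ
    simp only [hF, hg]
    ring
  have hnn : ∀ ξ, 0 ≤ ‖ft ν h ξ‖^2 * g ξ := fun ξ => by positivity
  calc _ = ∫⁻ ξ, ofReal (‖ft ν h ξ‖^2 * g ξ) := by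
        congr 1 with ξ
        rw [ENNReal.ofReal_mul (by positivity), ENNReal.ofReal_pow (norm_nonneg _), ofReal_norm]
    _ = ofReal (∫ ξ, ‖ft ν h ξ‖^2 * g ξ) := by
        rw [ofReal_integral_eq_lintegral_ofReal hGi (Eventually.of_forall hnn)]
    _ = ‖∫ ξ, ((‖ft ν h ξ‖^2 * g ξ : ℝ) : ℂ)‖ₑ := by
        rw [integral_complex_ofReal, ← ofReal_norm, Complex.norm_real, Real.norm_of_nonneg (integral_nonneg hnn)]
    _ ≤ ∫⁻ z, ‖h z.1 * (starRingEnd ℂ) (h z.2) * (gs δ (z.2 - z.1) : ℂ)‖ₑ ∂(ν.prod ν) := by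
        rw [hsw]; exact enorm_integral_le_lintegral_enorm _
    _ = ∫⁻ z, ‖h z.1‖ₑ * ‖h z.2‖ₑ * ofReal (gs δ (z.1 - z.2)) ∂(ν.prod ν) := by
        congr 1 with z
        rw [enorm_mul, enorm_mul]
        congr 1
        · congr 1
          rw [← ofReal_norm, RCLike.norm_conj, ofReal_norm]
        · rw [← ofReal_norm, Complex.norm_real, Real.norm_of_nonneg (gs_nonneg hδ _)]
          unfold gs
          rw [norm_sub_rev]
    _ = _ := by
        rw [lintegral_prod]
        have h1 := hh.1.enorm
        have h2 : AEMeasurable (fun z : Rn n × Rn n => ‖h z.1‖ₑ) (ν.prod ν) := h1.comp_fst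
        have h3 : AEMeasurable (fun z : Rn n × Rn n => ‖h z.2‖ₑ) (ν.prod ν) := h1.comp_snd
        refine (h2.mul h3).mul ?_
        have := continuous_gs (n := n) δ
        fun_prop

lemma lint_gs {n : ℕ} {δ : ℝ} (hδ : 0 < δ) (z : Rn n) : ∫⁻ x, ofReal (gs δ (x - z)) = 1 := by
  have h := lint_gauss (n := n) (b := Real.pi / δ^2) (by positivity) z
  unfold gs
  calc _ = ∫⁻ x : Rn n, ofReal ((δ^n)⁻¹) * ofReal (exp (-(Real.pi / δ^2) * ‖x - z‖^2)) := by
        congr 1 with x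
        rw [← ENNReal.ofReal_mul (by positivity)]
        congr 3; ring
    _ = 1 := by
        rw [lintegral_const_mul' _ _ ENNReal.ofReal_ne_top, h, ← ENNReal.ofReal_mul (by positivity), ← ENNReal.ofReal_one]
        congr 1
        have hpi := Real.pi_pos
        rw [show Real.pi / (Real.pi / δ^2) = δ^2 by field_simp, ← Real.rpow_natCast δ 2, ← Real.rpow_mul hδ.le, ← Real.rpow_natCast δ n]
        rw [show ((2:ℕ):ℝ) * (n/2) = n by push_cast; ring]
        exact inv_mul_cancel₀ (by positivity)

lemma plancherel_le {n : ℕ} {h : Rn n → ℂ} (hh : Integrable h) :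
    ∫⁻ ξ, ‖ft volume h ξ‖ₑ ^ 2 ≤ ∫⁻ x, ‖h x‖ₑ ^ 2 := by
  have hm : AEMeasurable (fun x => ‖h x‖ₑ) := hh.1.enorm
  have key : ∀ δ : ℝ, 0 < δ → ∫⁻ ξ, ‖ft volume h ξ‖ₑ ^ 2 * ofReal (exp (-(Real.pi * δ^2) * ‖ξ‖^2)) ≤ ∫⁻ x, ‖h x‖ₑ ^ 2 := by
    intro δ hδ
    refine (lemmaP hh hδ).trans ?_
    have hgm : Measurable (fun z : Rn n × Rn n => ofReal (gs δ (z.1 - z.2))) := by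
      have := continuous_gs (n := n) δ
      fun_prop
    set J := ∫⁻ x, ∫⁻ y, ‖h x‖ₑ * ‖h y‖ₑ * ofReal (gs δ (x - y)) with hJ
    have h1 : ∫⁻ x, ∫⁻ y, ‖h x‖ₑ^2 * ofReal (gs δ (x - y)) = ∫⁻ x, ‖h x‖ₑ^2 := by
      congr 1 with x
      rw [lintegral_const_mul'' _ (by have := continuous_gs (n := n) δ
                                      fun_prop)]
      rw [show (fun y => ofReal (gs δ (x - y))) = fun y => ofReal (gs δ (y - x)) by
        ext y; unfold gs; rw [norm_sub_rev], lint_gs hδ, mul_one]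
    have h2 : ∫⁻ x, ∫⁻ y, ‖h y‖ₑ^2 * ofReal (gs δ (x - y)) = ∫⁻ x, ‖h x‖ₑ^2 := by
      rw [lintegral_lintegral_swap]
      · congr 1 with y
        rw [lintegral_const_mul'' _ (by have := continuous_gs (n := n) δ
                                        fun_prop), lint_gs hδ, mul_one]
      · unfold Function.uncurry
        exact ((hm.comp_snd).pow_const 2).mul hgm.aemeasurable
    have h3 : 2 * J ≤ 2 * ∫⁻ x, ‖h x‖ₑ^2 := by
      calc 2 * J = ∫⁻ x, ∫⁻ y, 2 * (‖h x‖ₑ * ‖h y‖ₑ * ofReal (gs δ (x - y))) := by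
            rw [hJ, ← lintegral_const_mul' _ _ (by simp)]
            congr 1 with x
            rw [← lintegral_const_mul' _ _ (by simp)]
        _ ≤ ∫⁻ x, ∫⁻ y, (‖h x‖ₑ^2 * ofReal (gs δ (x - y)) + ‖h y‖ₑ^2 * ofReal (gs δ (x - y))) := by
            refine lintegral_mono fun x => lintegral_mono fun y => ?_
            dsimp only
            rw [← add_mul, ← mul_assoc, ← mul_assoc]
            gcongr
            have : ∀ z : Rn n, ‖h z‖ₑ = ofReal ‖h z‖ := fun z => (ofReal_norm _).symm
            rw [this, this, ← ENNReal.ofReal_pow (norm_nonneg _), ← ENNReal.ofReal_pow (norm_nonneg _), ← ENNReal.ofReal_add (by positivity) (by positivity),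
              mul_assoc, ← ENNReal.ofReal_mul (norm_nonneg _), show (2:ℝ≥0∞) = ofReal 2 by simp, ← ENNReal.ofReal_mul (by norm_num)]
            apply ENNReal.ofReal_le_ofReal
            nlinarith [sq_nonneg (‖h x‖ - ‖h y‖)]
        _ = _ := by
            have e1 : ∀ x, ∫⁻ y, (‖h x‖ₑ^2 * ofReal (gs δ (x - y)) + ‖h y‖ₑ^2 * ofReal (gs δ (x - y))) =
              (∫⁻ y, ‖h x‖ₑ^2 * ofReal (gs δ (x - y))) + ∫⁻ y, ‖h y‖ₑ^2 * ofReal (gs δ (x - y)) := by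
              intro x
              rw [lintegral_add_left]
              have := continuous_gs (n := n) δ
              fun_prop
            simp_rw [e1]
            rw [lintegral_add_left', h1, h2, two_mul]
            exact AEMeasurable.lintegral_prod_right' (f := fun z : Rn n × Rn n => ‖h z.1‖ₑ^2 * ofReal (gs δ (z.1 - z.2)))
              (((hm.comp_fst).pow_const 2).mul hgm.aemeasurable)
    exact (ENNReal.mul_le_mul_iff_right (by simp) (by simp)).1 h3
  -- limit
  set u : ℕ → ℝ := fun k => 1 / ((k:ℝ) + 1) with hu
  have hu0 : Tendsto u atTop (𝓝 0) := tendsto_one_div_add_atTop_nhds_zero_nat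
  have hF := lintegral_liminf_le' (μ := (volume : Measure (Rn n))) (u := (atTop : Filter ℕ))
    (f := fun (k : ℕ) ξ => ‖ft volume h ξ‖ₑ ^ 2 * ofReal (exp (-(Real.pi * (u k)^2) * ‖ξ‖^2))) (fun k => by
      have := continuous_ft hh
      fun_prop)
  have hlim : ∀ ξ, liminf (fun k : ℕ => ‖ft volume h ξ‖ₑ ^ 2 * ofReal (exp (-(Real.pi * (u k)^2) * ‖ξ‖^2))) atTop = ‖ft volume h ξ‖ₑ ^ 2 := by
    intro ξ
    apply Tendsto.liminf_eq
    have h1 : Tendsto (fun k => ofReal (exp (-(Real.pi * (u k)^2) * ‖ξ‖^2))) atTop (𝓝 (ofReal (exp (-(Real.pi * 0^2) * ‖ξ‖^2)))) := by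
      have hc : Continuous fun s : ℝ => ofReal (exp (-(Real.pi * s^2) * ‖ξ‖^2)) := ENNReal.continuous_ofReal.comp (by fun_prop)
      exact (hc.tendsto 0).comp hu0
    have h2 := ENNReal.Tendsto.const_mul (a := ‖ft volume h ξ‖ₑ ^ 2) h1 (Or.inr (by simp))
    simpa using h2
  simp_rw [hlim] at hF
  refine hF.trans ?_
  refine (liminf_le_limsup).trans ?_
  refine limsup_le_of_le (h := Eventually.of_forall fun k => key (u k) ?_)
  simp only [hu]; positivity

/-- multiplier operator -/
def um {n : ℕ} (w κ : Rn n → ℂ) (x : Rn n) (t : ℝ) : ℂ := ∫ ξ, w ξ * κ (t • ξ) * ee x ξ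

lemma um_integrable {n : ℕ} {w κ : Rn n → ℂ} (hw : Continuous w) {D : ℝ} (hwD : ∀ ξ, ‖w ξ‖ ≤ D)
    (hκ : Continuous κ) {A c : ℝ} (hc : 0 < c) (hκb : ∀ η, ‖κ η‖ ≤ A * exp (-c * ‖η‖^2)) {t : ℝ} (ht : 0 < t) :
    Integrable (fun ξ => w ξ * κ (t • ξ)) := by
  have hD : 0 ≤ D := (norm_nonneg _).trans (hwD 0)
  refine ((integrable_gauss (n := n) (b := c * t^2) (by positivity)).const_mul (D * A)).mono' (by fun_prop) (Eventually.of_forall fun ξ => ?_)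
  rw [norm_mul, mul_assoc]
  refine mul_le_mul (hwD ξ) ((hκb _).trans (le_of_eq ?_)) (norm_nonneg _) hD
  rw [norm_smul, mul_pow, Real.norm_eq_abs, sq_abs]
  congr 2; ring

lemma um_plancherel {n : ℕ} {f κ : Rn n → ℂ} (hf : Integrable f)
    (hκ : Continuous κ) {A c : ℝ} (hc : 0 < c) (hκb : ∀ η, ‖κ η‖ ≤ A * exp (-c * ‖η‖^2)) {t : ℝ} (ht : 0 < t) :
    ∫⁻ x, ‖um (ft volume f) κ x t‖ₑ ^ 2 ≤ ∫⁻ ξ, ‖ft volume f ξ‖ₑ ^ 2 * ‖κ (t • ξ)‖ₑ ^ 2 := by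
  have hi := um_integrable (continuous_ft hf) (norm_ft_le volume f) hκ hc hκb ht
  have h := plancherel_le hi
  calc _ = ∫⁻ x, ‖ft volume (fun ξ => ft volume f ξ * κ (t • ξ)) x‖ₑ ^ 2 := by
        rw [← lintegral_neg_eq_self]
        congr 1 with x
        unfold um
        conv_rhs => rw [ft]
        congr 3 with ξ
        congr 1
        unfold ee; rw [inner_neg_left, inner_neg_left, real_inner_comm]
    _ ≤ _ := h
    _ = _ := by
        congr 1 with ξ
        rw [enorm_mul, mul_pow]

lemma um_meas {n : ℕ} {w κ : Rn n → ℂ} (hw : Continuous w) (hκ : Continuous κ) :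
    Measurable (fun z : Rn n × ℝ => um w κ z.1 z.2) := by
  have h : StronglyMeasurable (fun z : (Rn n × ℝ) × Rn n => w z.2 * κ (z.1.2 • z.2) * ee z.1.1 z.2) := by
    apply Continuous.stronglyMeasurable; fun_prop
  exact h.integral_prod_right.measurable

lemma um_sq_int {n : ℕ} {f κ : Rn n → ℂ} (hf : Integrable f)
    (hκ : Continuous κ) {A c : ℝ} (hc : 0 < c) (hκb : ∀ η, ‖κ η‖ ≤ A * exp (-c * ‖η‖^2))
    {B : ℝ≥0∞} (hB : ∀ ξ, ∫⁻ t in Set.Ioi (0:ℝ), ‖κ (t • ξ)‖ₑ ^ 2 * ofReal t⁻¹ ≤ B) :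
    ∫⁻ x, ∫⁻ t in Set.Ioi (0:ℝ), ‖um (ft volume f) κ x t‖ₑ ^ 2 * ofReal t⁻¹ ≤ B * ∫⁻ x, ‖f x‖ₑ ^ 2 := by
  have hft := continuous_ft hf
  have hum := um_meas hft hκ
  rw [lintegral_lintegral_swap (by unfold Function.uncurry; fun_prop)]
  calc _ ≤ ∫⁻ t in Set.Ioi (0:ℝ), ∫⁻ ξ, ‖ft volume f ξ‖ₑ ^ 2 * (‖κ (t • ξ)‖ₑ ^ 2 * ofReal t⁻¹) := by
        refine setLIntegral_mono' measurableSet_Ioi fun t ht => ?_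
        rw [lintegral_mul_const' _ _ ENNReal.ofReal_ne_top]
        simp_rw [← mul_assoc]
        rw [lintegral_mul_const' _ _ ENNReal.ofReal_ne_top]
        exact mul_le_mul' (um_plancherel hf hκ hc hκb ht) le_rfl
    _ = ∫⁻ ξ, ∫⁻ t in Set.Ioi (0:ℝ), ‖ft volume f ξ‖ₑ ^ 2 * (‖κ (t • ξ)‖ₑ ^ 2 * ofReal t⁻¹) := by
        rw [lintegral_lintegral_swap (by unfold Function.uncurry; fun_prop)]
    _ ≤ ∫⁻ ξ, ‖ft volume f ξ‖ₑ ^ 2 * B := by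
        refine lintegral_mono fun ξ => ?_
        rw [lintegral_const_mul' _ _ (by simp)]
        gcongr
        exact hB ξ
    _ = B * ∫⁻ ξ, ‖ft volume f ξ‖ₑ ^ 2 := by
        rw [lintegral_mul_const _ (by fun_prop), mul_comm]
    _ ≤ _ := by exact mul_le_mul' le_rfl (plancherel_le hf)

lemma um_deriv {n : ℕ} {w κ L : Rn n → ℂ} (hw : Continuous w) {D : ℝ} (hwD : ∀ ξ, ‖w ξ‖ ≤ D)
    (hκ : Continuous κ) (hL : Continuous L) {A c : ℝ} (hA : 0 ≤ A) (hc : 0 < c) (hκb : ∀ η, ‖κ η‖ ≤ A * exp (-c * ‖η‖^2))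
    (hLb : ∀ η, ‖L η‖ ≤ A * exp (-c * ‖η‖^2))
    (hd : ∀ ξ (t : ℝ), 0 < t → HasDerivAt (fun t : ℝ => κ (t • ξ)) ((t⁻¹ : ℝ) • L (t • ξ)) t)
    (x : Rn n) {t : ℝ} (ht : 0 < t) :
    HasDerivAt (fun t => um w κ x t) ((t⁻¹ : ℝ) • um w L x t) t ∧ ContinuousAt (fun t => um w L x t) t := by
  have hD : 0 ≤ D := (norm_nonneg _).trans (hwD 0)
  have hball : ball t (t/2) ∈ 𝓝 t := ball_mem_nhds _ (by positivity)
  have hlow : ∀ s ∈ ball t (t/2), t/2 < s := by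
    intro s hs
    rw [mem_ball, Real.dist_eq, abs_lt] at hs
    linarith
  have hgb : ∀ s ∈ ball t (t/2), ∀ ξ, ‖w ξ * L (s • ξ) * ee x ξ‖ ≤ D * A * exp (-(c * (t/2)^2) * ‖ξ‖^2) := by
    intro s hs ξ
    have hs' := hlow s hs
    rw [norm_mul, norm_ee, mul_one, norm_mul, mul_assoc]
    refine mul_le_mul (hwD ξ) ((hLb _).trans ?_) (norm_nonneg _) hD
    refine mul_le_mul_of_nonneg_left (Real.exp_le_exp.2 ?_) hA
    rw [norm_smul, mul_pow, Real.norm_eq_abs, sq_abs]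
    have : (t/2)^2 ≤ s^2 := by gcongr
    have := mul_le_mul_of_nonneg_right this (sq_nonneg ‖ξ‖)
    nlinarith
  have hint : Integrable (fun ξ : Rn n => D * A * exp (-(c * (t/2)^2) * ‖ξ‖^2)) := (integrable_gauss (by positivity)).const_mul _
  constructor
  · have h := hasDerivAt_integral_of_dominated_loc_of_deriv_le (μ := volume) (F := fun s ξ => w ξ * κ (s • ξ) * ee x ξ)
      (F' := fun s ξ => (s⁻¹ : ℝ) • (w ξ * L (s • ξ) * ee x ξ)) (x₀ := t) (s := ball t (t/2))
      (bound := fun ξ => (t/2)⁻¹ * (D * A * exp (-(c * (t/2)^2) * ‖ξ‖^2))) hball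
      (Eventually.of_forall fun s => by fun_prop)
      ((um_integrable hw hwD hκ hc hκb ht).mono (by fun_prop) (Eventually.of_forall fun ξ => by rw [norm_mul _ (ee x ξ), norm_ee, mul_one]))
      (by fun_prop) ?_ (hint.const_mul _) ?_
    · have h2 := h.2
      rw [integral_smul] at h2
      exact h2
    · refine Eventually.of_forall fun ξ s hs => ?_
      have hs' := hlow s hs
      have hs0 : 0 < s := by linarith
      rw [norm_smul, norm_inv, Real.norm_of_nonneg hs0.le]
      gcongr
      exact hgb s hs ξ
    · refine Eventually.of_forall fun ξ s hs => ?_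
      have hs0 : 0 < s := by linarith [hlow s hs]
      have e : (s⁻¹ : ℝ) • (w ξ * L (s • ξ) * ee x ξ) = w ξ * ((s⁻¹ : ℝ) • L (s • ξ)) * ee x ξ := by
        rw [mul_smul_comm, smul_mul_assoc]
      rw [e]
      exact ((hd ξ s hs0).const_mul (w ξ)).mul_const (ee x ξ)
  · exact continuousAt_of_dominated (μ := volume) (F := fun s ξ => w ξ * L (s • ξ) * ee x ξ)
      (bound := fun ξ => D * A * exp (-(c * (t/2)^2) * ‖ξ‖^2)) (Eventually.of_forall fun s => by fun_prop)
      (by filter_upwards [hball] with s hs; exact Eventually.of_forall (hgb s hs)) hint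
      (Eventually.of_forall fun ξ => by fun_prop)

lemma um_tendsto {n : ℕ} (hn : 0 < n) {w κ : Rn n → ℂ} (hw : Continuous w) {D : ℝ} (hwD : ∀ ξ, ‖w ξ‖ ≤ D)
    (hκ : Continuous κ) {A c : ℝ} (hA : 0 ≤ A) (hc : 0 < c) (hκb : ∀ η, ‖κ η‖ ≤ A * exp (-c * ‖η‖^2)) (x : Rn n) :
    Tendsto (fun t => um w κ x t) atTop (𝓝 0) := by
  have hD : 0 ≤ D := (norm_nonneg _).trans (hwD 0)
  have hb : ∀ t : ℝ, 1 ≤ t → ‖um w κ x t‖ ≤ D * A * (Real.pi / (c * t^2)) ^ ((n:ℝ)/2) := by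
    intro t ht
    have hg := GaussianFourier.integral_rexp_neg_mul_sq_norm (V := Rn n) (b := c * t^2) (by positivity)
    rw [finrank_euclideanSpace, Fintype.card_fin] at hg
    rw [← hg, ← integral_const_mul]
    refine norm_integral_le_of_norm_le ((integrable_gauss (by positivity)).const_mul _) (Eventually.of_forall fun ξ => ?_)
    rw [norm_mul, norm_ee, mul_one, norm_mul, mul_assoc]
    refine mul_le_mul (hwD ξ) ((hκb _).trans (le_of_eq ?_)) (norm_nonneg _) hD
    rw [norm_smul, mul_pow, Real.norm_eq_abs, sq_abs]
    congr 2; ring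
  have hlim : Tendsto (fun t : ℝ => D * A * (Real.pi / (c * t^2)) ^ ((n:ℝ)/2)) atTop (𝓝 0) := by
    have h1 : Tendsto (fun t : ℝ => Real.pi / (c * t^2)) atTop (𝓝 0) :=
      Tendsto.div_atTop tendsto_const_nhds ((tendsto_pow_atTop two_ne_zero).const_mul_atTop hc)
    have hn' : (0:ℝ) < (n:ℝ)/2 := by have : (0:ℝ) < n := by exact_mod_cast hn
                                     linarith
    have h2 := (h1.rpow_const (p := (n:ℝ)/2) (Or.inr hn'.le)).const_mul (D * A)
    rwa [Real.zero_rpow hn'.ne', mul_zero] at h2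
  refine squeeze_zero_norm' ?_ hlim
  filter_upwards [eventually_ge_atTop 1] with t ht
  exact hb t ht

lemma max_L2 {n : ℕ} (hn : 0 < n) {f κ L : Rn n → ℂ} (hf : Integrable f)
    (hκ : Continuous κ) (hL : Continuous L) {A c : ℝ} (hA : 0 ≤ A) (hc : 0 < c) (hκb : ∀ η, ‖κ η‖ ≤ A * exp (-c * ‖η‖^2))
    (hLb : ∀ η, ‖L η‖ ≤ A * exp (-c * ‖η‖^2))
    (hd : ∀ ξ (t : ℝ), 0 < t → HasDerivAt (fun t : ℝ => κ (t • ξ)) ((t⁻¹ : ℝ) • L (t • ξ)) t)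
    {B1 B2 : ℝ≥0∞} (hB1 : ∀ ξ, ∫⁻ t in Set.Ioi (0:ℝ), ‖κ (t • ξ)‖ₑ ^ 2 * ofReal t⁻¹ ≤ B1)
    (hB2 : ∀ ξ, ∫⁻ t in Set.Ioi (0:ℝ), ‖L (t • ξ)‖ₑ ^ 2 * ofReal t⁻¹ ≤ B2) {l : ℝ} (hl : 0 < l) :
    ∃ W : Rn n → ℝ≥0∞, Measurable W ∧ (∀ x (T : ℝ), 0 < T → ‖um (ft volume f) κ x T‖ₑ ^ 2 ≤ W x) ∧
      ∫⁻ x, W x ≤ (ofReal l * B1 + ofReal l⁻¹ * B2) * ∫⁻ x, ‖f x‖ₑ ^ 2 := by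
  have hft := continuous_ft hf
  have hum := um_meas hft hκ
  have hum2 := um_meas hft hL
  set w := ft volume f
  set W : Rn n → ℝ≥0∞ := fun x => ∫⁻ t in Set.Ioi (0:ℝ), (ofReal l * (‖um w κ x t‖ₑ ^ 2 * ofReal t⁻¹) +
    ofReal l⁻¹ * (‖um w L x t‖ₑ ^ 2 * ofReal t⁻¹)) with hW
  refine ⟨W, ?_, ?_, ?_⟩
  · exact Measurable.lintegral_prod_right' (f := fun z : Rn n × ℝ => (ofReal l * (‖um w κ z.1 z.2‖ₑ ^ 2 * ofReal z.2⁻¹) +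
    ofReal l⁻¹ * (‖um w L z.1 z.2‖ₑ ^ 2 * ofReal z.2⁻¹))) (by fun_prop)
  · intro x T hT
    have hder := fun t (ht : 0 < t) => um_deriv hft (norm_ft_le volume f) hκ hL hA hc hκb hLb hd x ht
    have hN : ∀ N, T ≤ N → ofReal (‖um w κ x T‖ ^ 2) ≤ ofReal (‖um w κ x N‖ ^ 2) + W x := by
      intro N hTN
      have hpos : ∀ t ∈ Set.uIcc T N, 0 < t := fun t ht => by
        rw [Set.uIcc_of_le hTN] at ht; linarith [ht.1]
      set φ' : ℝ → ℝ := fun t => 2 * inner ℝ (um w κ x t) ((t⁻¹ : ℝ) • um w L x t) with hφ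
      have h1 := intervalIntegral.integral_eq_sub_of_hasDerivAt (f := fun t => ‖um w κ x t‖^2) (f' := φ')
        (a := T) (b := N) (fun t ht => (hder t (hpos t ht)).1.norm_sq) (by
          apply ContinuousOn.intervalIntegrable
          intro t ht
          apply ContinuousAt.continuousWithinAt
          have a1 := (hder t (hpos t ht)).1.continuousAt
          have a2 := (hder t (hpos t ht)).2
          have a3 : ContinuousAt (fun t : ℝ => t⁻¹) t := continuousAt_inv₀ (hpos t ht).ne'
          exact (a1.inner (a3.smul a2)).const_mul 2)
      have h2 : ‖∫ t in T..N, φ' t‖ₑ ≤ W x := by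
        rw [intervalIntegral.integral_of_le hTN]
        refine (enorm_integral_le_lintegral_enorm _).trans ?_
        refine (setLIntegral_mono' (g := fun t => ofReal l * (‖um w κ x t‖ₑ ^ 2 * ofReal t⁻¹) +
          ofReal l⁻¹ * (‖um w L x t‖ₑ ^ 2 * ofReal t⁻¹)) measurableSet_Ioc fun t ht => ?_).trans
          (lintegral_mono_set fun t ht => hT.trans ht.1)
        have ht0 : 0 < t := hT.trans ht.1
        rw [← ofReal_norm, ← ofReal_norm, ← ofReal_norm, ← ENNReal.ofReal_pow (norm_nonneg _), ← ENNReal.ofReal_pow (norm_nonneg _),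
          ← ENNReal.ofReal_mul (by positivity), ← ENNReal.ofReal_mul (by positivity), ← ENNReal.ofReal_mul (by positivity), ← ENNReal.ofReal_mul (by positivity),
          ← ENNReal.ofReal_add (by positivity) (by positivity)]
        apply ENNReal.ofReal_le_ofReal
        have h3 := abs_real_inner_le_norm (um w κ x t) ((t⁻¹ : ℝ) • um w L x t)
        rw [norm_smul, norm_inv, Real.norm_of_nonneg ht0.le] at h3
        rw [hφ, Real.norm_eq_abs, abs_mul, abs_two]
        set a := ‖um w κ x t‖
        set b := ‖um w L x t‖
        have h4 : 2 * (a * b) ≤ l * a^2 + l⁻¹ * b^2 := by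
          have : l * a^2 + l⁻¹ * b^2 - 2 * (a * b) = l⁻¹ * (l * a - b)^2 := by field_simp; ring
          have : 0 ≤ l⁻¹ * (l * a - b)^2 := by positivity
          linarith
        have h5 := mul_le_mul_of_nonneg_right h4 (inv_pos.2 ht0).le
        nlinarith
      have h6 : ‖um w κ x T‖^2 ≤ ‖um w κ x N‖^2 + ‖∫ t in T..N, φ' t‖ := by
        have := neg_abs_le (∫ t in T..N, φ' t)
        rw [h1] at this ⊢
        rw [Real.norm_eq_abs]
        linarith
      calc _ ≤ ofReal (‖um w κ x N‖^2 + ‖∫ t in T..N, φ' t‖) := ENNReal.ofReal_le_ofReal h6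
        _ ≤ _ := by
          rw [ENNReal.ofReal_add (by positivity) (norm_nonneg _), ofReal_norm]
          gcongr
    have hlim : Tendsto (fun N => ofReal (‖um w κ x N‖ ^ 2) + W x) atTop (𝓝 (ofReal (‖(0:ℂ)‖^2) + W x)) := by
      refine Tendsto.add ?_ tendsto_const_nhds
      exact (ENNReal.continuous_ofReal.tendsto _).comp (((um_tendsto hn hft (norm_ft_le volume f) hκ hA hc hκb x).norm).pow 2)
    have h7 := ge_of_tendsto hlim (by filter_upwards [eventually_ge_atTop T] with N hN' using hN N hN')
    rw [← ofReal_norm, ← ENNReal.ofReal_pow (norm_nonneg _)]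
    simpa using h7
  · have e1 : ∀ x, W x = ofReal l * (∫⁻ t in Set.Ioi (0:ℝ), ‖um w κ x t‖ₑ ^ 2 * ofReal t⁻¹) +
        ofReal l⁻¹ * ∫⁻ t in Set.Ioi (0:ℝ), ‖um w L x t‖ₑ ^ 2 * ofReal t⁻¹ := by
      intro x
      simp only [hW]
      rw [lintegral_add_left (by fun_prop), lintegral_const_mul' _ _ ENNReal.ofReal_ne_top, lintegral_const_mul' _ _ ENNReal.ofReal_ne_top]
    simp_rw [e1]
    rw [lintegral_add_left, lintegral_const_mul' _ _ ENNReal.ofReal_ne_top, lintegral_const_mul' _ _ ENNReal.ofReal_ne_top, add_mul, mul_assoc, mul_assoc]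
    · gcongr
      · exact um_sq_int hf hκ hc hκb hB1
      · exact um_sq_int hf hL hc hLb hB2
    · refine Measurable.const_mul ?_ _
      exact Measurable.lintegral_prod_right' (f := fun z : Rn n × ℝ => (‖um w κ z.1 z.2‖ₑ ^ 2 * ofReal z.2⁻¹)) (by fun_prop)

lemma polar {n : ℕ} (hn : 0 < n) {F : ℝ → ℝ≥0∞} (hF : Measurable F) :
    ∫⁻ x : Rn n, F ‖x‖ = (volume : Measure (Rn n)).toSphere Set.univ * ∫⁻ t in Set.Ioi (0:ℝ), ofReal (t^(n-1)) * F t := by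
  have : Nonempty (Fin n) := ⟨⟨0, hn⟩⟩
  have hd : Module.finrank ℝ (Rn n) = n := by simp
  calc
    ∫⁻ x : Rn n, F ‖x‖ = ∫⁻ x : ({(0)}ᶜ : Set (Rn n)), F (‖x.1‖) ∂(volume.comap Subtype.val) := by
      rw [lintegral_subtype_comap (measurableSet_singleton _).compl fun x : Rn n ↦ F (‖x‖),
        restrict_compl_singleton]
    _ = ∫⁻ x, F x.2 ∂(volume : Measure (Rn n)).toSphere.prod (.volumeIoiPow (n - 1)) := by
      have := ((volume : Measure (Rn n)).measurePreserving_homeomorphUnitSphereProd).lintegral_comp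
        (f := F ∘ Subtype.val ∘ Prod.snd) (by fun_prop)
      rw [hd] at this
      simpa using this
    _ = _ := by
      rw [lintegral_prod _ (by fun_prop)]
      simp only [lintegral_const]
      rw [mul_comm, Measure.volumeIoiPow, lintegral_withDensity_eq_lintegral_mul _ (by fun_prop) (by fun_prop)]
      rw [← lintegral_subtype_comap measurableSet_Ioi]
      rfl

lemma log_scale {h : ℝ → ℝ≥0∞} (hh : Measurable h) {a : ℝ} (ha : 0 < a) :
    ∫⁻ t in Set.Ioi (0:ℝ), h (a * t) * ofReal t⁻¹ = ∫⁻ t in Set.Ioi (0:ℝ), h t * ofReal t⁻¹ := by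
  rw [← lintegral_indicator measurableSet_Ioi, ← lintegral_indicator measurableSet_Ioi]
  conv_rhs => rw [← Real.smul_map_volume_mul_left ha.ne']
  rw [lintegral_smul_measure, lintegral_map (by
    refine Measurable.indicator ?_ measurableSet_Ioi
    fun_prop) (by fun_prop), smul_eq_mul, ← lintegral_const_mul' _ _ ENNReal.ofReal_ne_top]
  congr 1 with t
  by_cases ht : 0 < t
  · rw [Set.indicator_of_mem (Set.mem_Ioi.2 ht), Set.indicator_of_mem (Set.mem_Ioi.2 (by positivity))]
    rw [mul_left_comm, ← ENNReal.ofReal_mul (by positivity), abs_of_pos ha]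
    congr 2
    field_simp
  · rw [Set.indicator_of_notMem (by simpa using ht), Set.indicator_of_notMem (by
      simp only [Set.mem_Ioi]; intro h; exact ht (by nlinarith)), mul_zero]

lemma polar_log {n : ℕ} (hn : 0 < n) : ∃ C : ℝ, 0 < C ∧ ∀ g : Rn n → ℝ≥0∞, Measurable g → g 0 = 0 →
    (∀ x y, ‖x‖ = ‖y‖ → g x = g y) → ∀ ξ, ∫⁻ t in Set.Ioi (0:ℝ), g (t • ξ) * ofReal t⁻¹ ≤
      ofReal C * ∫⁻ η, g η * ofReal (‖η‖^n)⁻¹ := by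
  have : Nonempty (Fin n) := ⟨⟨0, hn⟩⟩
  set A := (volume : Measure (Rn n)).toSphere Set.univ with hA
  have hA0 : A ≠ 0 := by
    rw [hA]; exact fun h => Measure.toSphere_ne_zero (volume : Measure (Rn n)) (Measure.measure_univ_eq_zero.1 h)
  have hAt : A ≠ ∞ := measure_ne_top _ _
  refine ⟨A.toReal⁻¹, inv_pos.2 (ENNReal.toReal_pos hA0 hAt), fun g hg hg0 hr ξ => ?_⟩
  obtain ⟨u, hu, hξ⟩ := exists_unit hn ξ
  rcases eq_or_ne ξ 0 with h0 | h0
  · simp [h0, hg0]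
  have hξp : 0 < ‖ξ‖ := norm_pos_iff.2 h0
  have hG : Measurable fun t : ℝ => g (t • u) := by fun_prop
  have e1 : ∫⁻ t in Set.Ioi (0:ℝ), g (t • ξ) * ofReal t⁻¹ = ∫⁻ t in Set.Ioi (0:ℝ), g (t • u) * ofReal t⁻¹ := by
    rw [← log_scale hG hξp]
    conv_lhs => rw [hξ]
    simp only [smul_smul, mul_comm]
  have e2 := polar hn (F := fun t => g (t • u) * ofReal (t^n)⁻¹) (by fun_prop)
  have e3 : ∫⁻ η : Rn n, g η * ofReal (‖η‖^n)⁻¹ = ∫⁻ η : Rn n, g (‖η‖ • u) * ofReal (‖η‖^n)⁻¹ := by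
    congr 1 with η
    rw [hr η (‖η‖ • u) (by rw [norm_smul, hu]; simp)]
  have e4 : ∫⁻ t in Set.Ioi (0:ℝ), ofReal (t^(n-1)) * (g (t • u) * ofReal (t^n)⁻¹) = ∫⁻ t in Set.Ioi (0:ℝ), g (t • u) * ofReal t⁻¹ := by
    refine setLIntegral_congr_fun measurableSet_Ioi fun t ht => ?_
    have ht : 0 < t := ht
    rw [mul_left_comm, ← ENNReal.ofReal_mul (by positivity)]
    congr 2
    obtain ⟨m, rfl⟩ := Nat.exists_eq_add_of_lt hn
    simp only [zero_add, Nat.add_sub_cancel]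
    rw [pow_succ]; field_simp
  have e5 : ofReal A.toReal⁻¹ * A = 1 := by
    conv_lhs => rw [← ENNReal.ofReal_toReal hAt]
    rw [ENNReal.toReal_ofReal (by positivity), ← ENNReal.ofReal_mul (by positivity), inv_mul_cancel₀ (ENNReal.toReal_pos hA0 hAt).ne', ENNReal.ofReal_one]
  rw [e1, e3, e2, e4, ← mul_assoc, ← hA, e5, one_mul]

lemma pow_exp_bdd (k : ℕ) {a : ℝ} (ha : 0 < a) : ∃ K : ℝ, 0 < K ∧ ∀ s : ℝ, 0 ≤ s → s^k * exp (-a * s) ≤ K := by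
  refine ⟨k.factorial / a^k, by positivity, fun s hs => ?_⟩
  have h := Real.pow_div_factorial_le_exp (a * s) (by positivity) k
  rw [neg_mul, Real.exp_neg, ← div_eq_mul_inv, div_le_div_iff₀ (Real.exp_pos _) (by positivity)]
  rw [div_le_iff₀ (by positivity), mul_pow] at h
  nlinarith

def Phi (m : ℕ) (s : ℝ) : ℝ := (1 - exp (-s))^m - (1 - exp (-(s/4)))^m
/-- `s * Phi'(s)` -/
def PhiD (m : ℕ) (s : ℝ) : ℝ := s * (m * (1 - exp (-s))^(m-1) * exp (-s) - m * (1 - exp (-(s/4)))^(m-1) * (exp (-(s/4)) / 4))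

lemma continuous_Phi (m : ℕ) : Continuous (Phi m) := by unfold Phi; fun_prop
lemma continuous_PhiD (m : ℕ) : Continuous (PhiD m) := by unfold PhiD; fun_prop

lemma one_sub_exp_bd {s : ℝ} (hs : 0 ≤ s) : 0 ≤ 1 - exp (-s) ∧ 1 - exp (-s) ≤ s := by
  constructor
  · have := Real.exp_le_one_iff.2 (neg_nonpos.2 hs); linarith
  · have := Real.add_one_le_exp (-s); linarith

lemma Phi_bd {m : ℕ} (hm : 0 < m) {s : ℝ} (hs : 0 ≤ s) : |Phi m s| ≤ 2 * m * s^m * exp (-(s/4)) := by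
  obtain ⟨a0, a1⟩ := one_sub_exp_bd hs
  obtain ⟨b0, b1⟩ := one_sub_exp_bd (s := s/4) (by positivity)
  have h := abs_pow_sub_pow_le (1 - exp (-s)) (1 - exp (-(s/4))) m
  refine (show |Phi m s| ≤ _ from h).trans ?_
  have hd : |1 - exp (-s) - (1 - exp (-(s/4)))| ≤ s * exp (-(s/4)) := by
    have e : 1 - exp (-s) - (1 - exp (-(s/4))) = exp (-(s/4)) * (1 - exp (-(s * 3/4))) := by
      rw [mul_sub, ← Real.exp_add]; ring_nf
    obtain ⟨c0, c1⟩ := one_sub_exp_bd (s := s*3/4) (by positivity)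
    rw [e, abs_of_nonneg (by positivity), mul_comm]
    gcongr; linarith
  have hmax : max |1 - exp (-s)| |1 - exp (-(s/4))| ≤ s := by
    rw [abs_of_nonneg a0, abs_of_nonneg b0]
    exact max_le a1 (by linarith)
  calc _ ≤ s * exp (-(s/4)) * m * s^(m-1) := by gcongr
    _ = 1 * m * s^m * exp (-(s/4)) := by
      obtain ⟨k, rfl⟩ := Nat.exists_eq_add_of_lt hm
      simp only [zero_add, Nat.add_sub_cancel]; ring
    _ ≤ _ := by gcongr; norm_num

lemma PhiD_bd {m : ℕ} (hm : 0 < m) {s : ℝ} (hs : 0 ≤ s) : |PhiD m s| ≤ 2 * m * s^m * exp (-(s/4)) := by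
  obtain ⟨a0, a1⟩ := one_sub_exp_bd hs
  obtain ⟨b0, b1⟩ := one_sub_exp_bd (s := s/4) (by positivity)
  unfold PhiD
  rw [abs_mul, abs_of_nonneg hs]
  have h1 : m * (1 - exp (-s))^(m-1) * exp (-s) ≤ m * s^(m-1) * exp (-(s/4)) := by
    gcongr; linarith
  have h2 : m * (1 - exp (-(s/4)))^(m-1) * (exp (-(s/4)) / 4) ≤ m * s^(m-1) * (exp (-(s/4))) := by
    gcongr
    · linarith
    · have := Real.exp_pos (-(s/4)); linarith
  have h3 : 0 ≤ m * (1 - exp (-s))^(m-1) * exp (-s) := by positivity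
  have h4 : 0 ≤ m * (1 - exp (-(s/4)))^(m-1) * (exp (-(s/4)) / 4) := by positivity
  have h5 : 2 * m * s^m * exp (-(s/4)) = s * (2 * (m * s^(m-1) * exp (-(s/4)))) := by
    obtain ⟨k, rfl⟩ := Nat.exists_eq_add_of_lt hm
    simp only [zero_add, Nat.add_sub_cancel]; ring
  rw [h5]
  refine mul_le_mul_of_nonneg_left ?_ hs
  rw [abs_le]; constructor <;> linarith

lemma Phi_zero {m : ℕ} (hm : 0 < m) : Phi m 0 = 0 := by simp [Phi]
lemma PhiD_zero {m : ℕ} : PhiD m 0 = 0 := by simp [PhiD]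

lemma Phi_deriv (m : ℕ) {c t : ℝ} (ht : 0 < t) :
    HasDerivAt (fun t : ℝ => Phi m (c * t^2)) (t⁻¹ * (2 * PhiD m (c * t^2))) t := by
  have h0 : HasDerivAt (fun t : ℝ => c * t^2) (c * (2 * t)) t := by simpa using (hasDerivAt_pow 2 t).const_mul c
  have h1 := ((h0.neg.exp).const_sub 1).pow m
  have h2 := ((((h0.div_const 4).neg).exp).const_sub 1).pow m
  have h3 := h1.sub h2
  refine HasDerivAt.congr_deriv (f' := _) h3 ?_
  unfold PhiD
  simp only [Pi.neg_apply]
  field_simp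

lemma dec_bd {n : ℕ} (hn : 0 < n) : ∃ K : ℝ, 0 < K ∧ ∀ δ : ℝ, 0 < δ → δ ≤ 1 → ∀ r : ℝ, 0 ≤ r →
    (2 * n * (Real.pi * δ^2 * r^2)^n * exp (-((Real.pi * δ^2 * r^2)/4)))^2 * (r^n)⁻¹ ≤ K * δ^n * exp (-(Real.pi * (δ/2)^2) * r^2) ∧
    (2 * n * (Real.pi * δ^2 * r^2)^n * exp (-((Real.pi * δ^2 * r^2)/4)))^2 * (r^n)⁻¹ * r^2 ≤ K * δ^n * (δ^2)⁻¹ * exp (-(Real.pi * (δ/2)^2) * r^2) := by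
  obtain ⟨K1, hK1, h1⟩ := pow_exp_bdd (3*n) (a := 1) (by norm_num)
  obtain ⟨K2, hK2, h2⟩ := pow_exp_bdd (3*n+2) (a := 1) (by norm_num)
  have hn' : (0:ℝ) < n := by exact_mod_cast hn
  -- bound u^k exp(-π u^2/4) ≤ K e
  have key : ∀ u : ℝ, 0 ≤ u → exp (-(Real.pi * u^2/4)) ≤ exp 2 * exp (-1 * u) := by
    intro u hu
    rw [← Real.exp_add]
    apply Real.exp_le_exp.2
    nlinarith [Real.pi_gt_three, sq_nonneg (u - 2), sq_nonneg u]
  refine ⟨4 * n^2 * Real.pi^(2*n) * exp 2 * (K1 + K2), by positivity, fun δ hδ hδ1 r hr => ?_⟩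
  set u := δ * r with hu
  have hu0 : 0 ≤ u := by positivity
  have hs : Real.pi * δ^2 * r^2 = Real.pi * u^2 := by rw [hu]; ring
  rw [hs]
  have hE : exp (-(Real.pi * u^2/4))^2 = exp (-(Real.pi * u^2/4)) * exp (-(Real.pi * (δ/2)^2) * r^2) := by
    rw [sq]; congr 2; rw [hu]; ring
  set G := exp (-(Real.pi * (δ/2)^2) * r^2) with hG
  have hGp : 0 < G := Real.exp_pos _
  have hmain : (2 * n * (Real.pi * u^2)^n * exp (-(Real.pi * u^2/4)))^2 * (r^n)⁻¹ ≤
      4 * n^2 * Real.pi^(2*n) * (u^(3*n) * exp (-(Real.pi * u^2/4))) * δ^n * G := by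
    rcases hr.eq_or_lt with h0 | h0
    · have : (r^n)⁻¹ = 0 := by rw [← h0, zero_pow hn.ne', inv_zero]
      rw [this, mul_zero]; positivity
    · apply le_of_eq
      rw [mul_pow, hE]
      have : (r^n)⁻¹ = δ^n * (u^n)⁻¹ := by rw [hu, mul_pow]; field_simp
      rw [this]
      have hu1 : 0 < u := by positivity
      have : u^(3*n) = u^(4*n) * (u^n)⁻¹ := by
        field_simp; ring
      rw [this]; ring
  have e1 : u^(3*n) * exp (-(Real.pi * u^2/4)) ≤ exp 2 * K1 := by
    calc _ ≤ u^(3*n) * (exp 2 * exp (-1 * u)) := by gcongr; exact key u hu0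
      _ = exp 2 * (u^(3*n) * exp (-1 * u)) := by ring
      _ ≤ _ := by gcongr; exact h1 u hu0
  have e2 : u^(3*n+2) * exp (-(Real.pi * u^2/4)) ≤ exp 2 * K2 := by
    calc _ ≤ u^(3*n+2) * (exp 2 * exp (-1 * u)) := by gcongr; exact key u hu0
      _ = exp 2 * (u^(3*n+2) * exp (-1 * u)) := by ring
      _ ≤ _ := by gcongr; exact h2 u hu0
  constructor
  · refine hmain.trans ?_
    calc _ ≤ 4 * n^2 * Real.pi^(2*n) * (exp 2 * K1) * δ^n * G := by gcongr
      _ ≤ 4 * n^2 * Real.pi^(2*n) * (exp 2 * (K1 + K2)) * δ^n * G := by gcongr; linarith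
      _ = _ := by ring
  · refine (mul_le_mul_of_nonneg_right hmain (sq_nonneg r)).trans ?_
    have hr2 : r^2 = (δ^2)⁻¹ * u^2 := by rw [hu]; field_simp
    calc _ = 4 * n^2 * Real.pi^(2*n) * (u^(3*n+2) * exp (-(Real.pi * u^2/4))) * δ^n * G * (δ^2)⁻¹ := by rw [hr2]; ring
      _ ≤ 4 * n^2 * Real.pi^(2*n) * (exp 2 * K2) * δ^n * G * (δ^2)⁻¹ := by gcongr
      _ ≤ 4 * n^2 * Real.pi^(2*n) * (exp 2 * (K1 + K2)) * δ^n * G * (δ^2)⁻¹ := by gcongr; linarith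
      _ = _ := by ring

lemma sph_P {n : ℕ} (hn : 0 < n) : ∃ C : ℝ, 0 < C ∧ ∀ δ : ℝ, 0 < δ → δ ≤ 1 → ∀ h : Rn n → ℂ, Integrable h (unitSphereMeasure n) →
    (∀ ω, ‖ω‖ = 1 → ‖h ω‖ ≤ 1) → 
    ∫⁻ ξ, ‖ft (unitSphereMeasure n) h ξ‖ₑ ^ 2 * ofReal (exp (-(Real.pi * (δ/2)^2) * ‖ξ‖^2)) ≤ ofReal (C * δ⁻¹) := by
  obtain ⟨C, hC, h⟩ := sph_gs hn
  refine ⟨C * 2, by positivity, fun δ hδ hδ1 f hf hf1 => ?_⟩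
  refine (lemmaP hf (half_pos hδ)).trans ?_
  have hf1' : ∀ ω, ‖ω‖ = 1 → ‖f ω‖ₑ ≤ 1 := fun ω hω => by
    rw [← ofReal_norm, ← ENNReal.ofReal_one]; exact ENNReal.ofReal_le_ofReal (hf1 ω hω)
  calc _ ≤ ∫⁻ x, ofReal (C * (δ/2)⁻¹) ∂(unitSphereMeasure n) := by
        refine lintegral_mono_ae ?_
        filter_upwards [sph_ae n] with x hx
        calc _ ≤ ∫⁻ y, ofReal (gs (δ/2) (x - y)) ∂(unitSphereMeasure n) := by
              refine lintegral_mono_ae ?_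
              filter_upwards [sph_ae n] with y hy
              calc _ ≤ 1 * 1 * ofReal (gs (δ/2) (x - y)) := by
                    gcongr
                    · exact hf1' x hx
                    · exact hf1' y hy
                _ = _ := by simp
          _ ≤ _ := h (δ/2) (half_pos hδ) (by linarith) x
          _ ≤ _ := by
              apply ENNReal.ofReal_le_ofReal
              refine mul_le_of_le_one_right (by positivity) (Real.exp_le_one_iff.2 ?_)
              have := Real.pi_pos
              nlinarith [sq_nonneg ‖x‖]
    _ ≤ ofReal (C * (δ/2)⁻¹) * 1 := by
        rw [lintegral_const]; exact mul_le_mul' le_rfl (sph_univ n)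
    _ = _ := by rw [mul_one]; congr 1; field_simp

def sig {n : ℕ} (η : Rn n) : ℂ := ft (unitSphereMeasure n) (fun _ => 1) η
def sgm {n : ℕ} (i : Fin n) (η : Rn n) : ℂ := ft (unitSphereMeasure n) (fun ω => (ω i : ℂ)) η
def S1 {n : ℕ} (η : Rn n) : ℂ := ∫ ω, ((inner ℝ ω η : ℝ) : ℂ) * ee (-ω) η ∂(unitSphereMeasure n)

lemma coord_le {n : ℕ} (ω : Rn n) (i : Fin n) : ‖(ω i : ℂ)‖ ≤ ‖ω‖ := by
  rw [Complex.norm_real]; exact PiLp.norm_apply_le ω i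

lemma coord_int {n : ℕ} (i : Fin n) : Integrable (fun ω : Rn n => (ω i : ℂ)) (unitSphereMeasure n) := by
  refine Integrable.of_bound (C := 1) (by fun_prop) ?_
  filter_upwards [sph_ae n] with ω hω
  rw [← hω]; exact coord_le ω i

lemma S1_eq {n : ℕ} (η : Rn n) : S1 η = ∑ i, (η i : ℂ) * sgm i η := by
  unfold S1 sgm ft
  simp_rw [← integral_const_mul]
  rw [← integral_finsetSum _ (fun i _ => (integrable_mul_ee (coord_int i) η).const_mul _)]
  congr 1 with ω
  rw [PiLp.inner_apply]
  push_cast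
  rw [Finset.sum_mul]
  refine Finset.sum_congr rfl fun i _ => ?_
  simp; ring

lemma continuous_sig {n : ℕ} : Continuous (sig (n := n)) := continuous_ft (integrable_const _)
lemma continuous_sgm {n : ℕ} (i : Fin n) : Continuous (sgm i) := continuous_ft (coord_int i)
lemma continuous_S1 {n : ℕ} : Continuous (S1 (n := n)) := by
  have : S1 (n := n) = fun η => ∑ i, (η i : ℂ) * sgm i η := funext S1_eq
  rw [this]
  have := continuous_sgm (n := n)
  fun_prop

lemma sig_le {n : ℕ} (η : Rn n) : ‖sig η‖ ≤ 1 := by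
  refine (norm_ft_le _ _ _).trans ?_
  simp only [norm_one, integral_const, smul_eq_mul, mul_one]
  exact ENNReal.toReal_le_of_le_ofReal zero_le_one (by simpa using sph_univ n)

lemma S1_le {n : ℕ} (η : Rn n) : ‖S1 η‖ ≤ ‖η‖ := by
  unfold S1
  have h := norm_integral_le_of_norm_le_const (μ := unitSphereMeasure n) (f := fun ω => ((inner ℝ ω η : ℝ) : ℂ) * ee (-ω) η) (C := ‖η‖) (by
    filter_upwards [sph_ae n] with ω hω
    rw [norm_mul, norm_ee, mul_one, Complex.norm_real]
    have := norm_inner_le_norm (𝕜 := ℝ) ω η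
    rwa [hω, one_mul] at this)
  refine h.trans (mul_le_of_le_one_right (norm_nonneg _) ?_)
  exact ENNReal.toReal_le_of_le_ofReal zero_le_one (by simpa using sph_univ n)

lemma S1_sq {n : ℕ} (η : Rn n) : ‖S1 η‖^2 ≤ ‖η‖^2 * ∑ i, ‖sgm i η‖^2 := by
  rw [S1_eq, EuclideanSpace.norm_sq_eq]
  calc _ ≤ (∑ i, ‖η i‖ * ‖sgm i η‖)^2 := by
        gcongr
        refine (norm_sum_le _ _).trans (le_of_eq ?_)
        simp
    _ ≤ _ := Finset.sum_mul_sq_le_sq_mul_sq _ _ _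

lemma sig_rad {n : ℕ} {x y : Rn n} (h : ‖x‖ = ‖y‖) : sig x = sig y := by
  obtain ⟨e, rfl⟩ := exists_rot h
  symm
  unfold sig ft
  rw [← (sph_rot e).integral_comp e.toHomeomorph.measurableEmbedding]
  congr 1 with ω
  unfold ee
  rw [← map_neg, e.inner_map_map]

lemma S1_rad {n : ℕ} {x y : Rn n} (h : ‖x‖ = ‖y‖) : S1 x = S1 y := by
  obtain ⟨e, rfl⟩ := exists_rot h
  symm
  unfold S1
  rw [← (sph_rot e).integral_comp e.toHomeomorph.measurableEmbedding]
  congr 1 with ω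
  unfold ee
  rw [← map_neg, e.inner_map_map, e.inner_map_map]

lemma sig_deriv {n : ℕ} (ξ : Rn n) {t : ℝ} (ht : 0 < t) :
    HasDerivAt (fun t : ℝ => sig (t • ξ)) ((t⁻¹ : ℝ) • ((-(2 * Real.pi : ℝ) * Complex.I) * S1 (t • ξ))) t := by
  have h := hasDerivAt_integral_of_dominated_loc_of_deriv_le (μ := unitSphereMeasure n) (F := fun s ω => (1:ℂ) * ee (-ω) (s • ξ))
      (F' := fun s ω => (-(2 * Real.pi : ℝ) * Complex.I) * (((inner ℝ ω ξ : ℝ) : ℂ) * ee (-ω) (s • ξ))) (x₀ := t) (s := Set.univ)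
      (bound := fun ω => 2 * Real.pi * ‖ξ‖) univ_mem
      (Eventually.of_forall fun s => by fun_prop) (by
        refine (integrable_const (1:ℝ)).mono' (by fun_prop) (Eventually.of_forall fun ω => ?_)
        rw [one_mul, norm_ee]) (by fun_prop) ?_ (integrable_const _) ?_
  · refine h.2.congr_deriv ?_
    have e : S1 (t • ξ) = (t:ℂ) * ∫ ω, ((inner ℝ ω ξ : ℝ) : ℂ) * ee (-ω) (t • ξ) ∂(unitSphereMeasure n) := by
      rw [S1, ← integral_const_mul]
      congr 1 with ω
      rw [inner_smul_right]; push_cast; ring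
    have ht' : (t:ℂ) ≠ 0 := by exact_mod_cast ht.ne'
    rw [integral_const_mul, e, Complex.real_smul]
    push_cast
    field_simp
  · filter_upwards [sph_ae n] with ω hω s _
    rw [norm_mul, norm_mul, norm_mul, norm_ee, Complex.norm_I, norm_neg, Complex.norm_real, Complex.norm_real]
    have := norm_inner_le_norm (𝕜 := ℝ) ω ξ
    rw [hω, one_mul] at this
    rw [Real.norm_of_nonneg (by positivity), mul_one, mul_one]
    gcongr
  · refine Eventually.of_forall fun ω s _ => ?_
    have h1 : HasDerivAt (fun s : ℝ => (((2 * Real.pi * inner ℝ (-ω) ξ) * s : ℝ) : ℂ) * Complex.I) (((2 * Real.pi * inner ℝ (-ω) ξ : ℝ) : ℂ) * Complex.I) s := by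
      have := ((hasDerivAt_id s).const_mul (2 * Real.pi * inner ℝ (-ω) ξ)).ofReal_comp.mul_const Complex.I
      simpa using this
    have h2 := h1.cexp
    have e : (fun s : ℝ => (1:ℂ) * ee (-ω) (s • ξ)) = fun s : ℝ => Complex.exp ((((2 * Real.pi * inner ℝ (-ω) ξ) * s : ℝ) : ℂ) * Complex.I) := by
      funext s; rw [one_mul, ee, inner_smul_right]; congr 3; ring
    have e' := congrFun e s
    rw [e]
    refine h2.congr_deriv ?_
    rw [← e', one_mul, inner_neg_left]
    push_cast; ring

def kap {n : ℕ} (δ : ℝ) (η : Rn n) : ℂ := (Phi n (Real.pi * δ^2 * ‖η‖^2) : ℂ) * sig η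
def lap {n : ℕ} (δ : ℝ) (η : Rn n) : ℂ := ((2 * PhiD n (Real.pi * δ^2 * ‖η‖^2) : ℝ) : ℂ) * sig η +
  (Phi n (Real.pi * δ^2 * ‖η‖^2) : ℂ) * ((-(2 * Real.pi : ℝ) * Complex.I) * S1 η)

lemma continuous_kap {n : ℕ} (δ : ℝ) : Continuous (kap (n := n) δ) := by
  unfold kap
  have := continuous_Phi n
  have := continuous_sig (n := n)
  fun_prop

lemma continuous_lap {n : ℕ} (δ : ℝ) : Continuous (lap (n := n) δ) := by
  unfold lap
  have := continuous_Phi n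
  have := continuous_PhiD n
  have := continuous_sig (n := n)
  have := continuous_S1 (n := n)
  fun_prop

lemma kap_deriv {n : ℕ} (δ : ℝ) (ξ : Rn n) (t : ℝ) (ht : 0 < t) :
    HasDerivAt (fun t : ℝ => kap δ (t • ξ)) ((t⁻¹ : ℝ) • lap δ (t • ξ)) t := by
  have e : ∀ s : ℝ, Real.pi * δ^2 * ‖s • ξ‖^2 = (Real.pi * δ^2 * ‖ξ‖^2) * s^2 := by
    intro s; rw [norm_smul, mul_pow, Real.norm_eq_abs, sq_abs]; ring
  have h1 := (Phi_deriv n (c := Real.pi * δ^2 * ‖ξ‖^2) ht).ofReal_comp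
  have h2 := h1.mul (sig_deriv ξ ht)
  unfold kap lap
  simp only [e]
  refine h2.congr_deriv ?_
  simp only [Complex.real_smul]
  push_cast
  ring

lemma kap_bd {n : ℕ} (hn : 0 < n) (δ : ℝ) (η : Rn n) : ‖kap δ η‖ ≤
    (2 * n * (Real.pi * δ^2 * ‖η‖^2)^n * exp (-((Real.pi * δ^2 * ‖η‖^2)/4))) * ‖sig η‖ := by
  unfold kap
  rw [norm_mul, Complex.norm_real]
  gcongr
  exact Phi_bd hn (by positivity)

lemma lap_bd {n : ℕ} (hn : 0 < n) (δ : ℝ) (η : Rn n) : ‖lap δ η‖ ≤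
    (2 * n * (Real.pi * δ^2 * ‖η‖^2)^n * exp (-((Real.pi * δ^2 * ‖η‖^2)/4))) * (2 * ‖sig η‖ + 2 * Real.pi * ‖S1 η‖) := by
  unfold lap
  refine (norm_add_le _ _).trans ?_
  rw [mul_add]
  rw [norm_mul, norm_mul, norm_mul, norm_mul, Complex.norm_real, Complex.norm_real, norm_neg, Complex.norm_real, Complex.norm_I, mul_one]
  rw [norm_mul, Real.norm_of_nonneg zero_le_two, Real.norm_of_nonneg (show 0 ≤ 2 * Real.pi by positivity)]
  have h1 := Phi_bd hn (s := Real.pi * δ^2 * ‖η‖^2) (by positivity)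
  have h2 := PhiD_bd hn (s := Real.pi * δ^2 * ‖η‖^2) (by positivity)
  set E := 2 * n * (Real.pi * δ^2 * ‖η‖^2)^n * exp (-((Real.pi * δ^2 * ‖η‖^2)/4))
  rw [Real.norm_eq_abs, Real.norm_eq_abs]
  refine add_le_add ?_ ?_
  · calc _ = |PhiD n (Real.pi * δ^2 * ‖η‖^2)| * (2 * ‖sig η‖) := by ring
      _ ≤ _ := by gcongr
  · gcongr

lemma kaplap_gauss {n : ℕ} (hn : 0 < n) {δ : ℝ} (hδ : 0 < δ) : ∃ A c : ℝ, 0 ≤ A ∧ 0 < c ∧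
    (∀ η : Rn n, ‖kap δ η‖ ≤ A * exp (-c * ‖η‖^2)) ∧ (∀ η : Rn n, ‖lap δ η‖ ≤ A * exp (-c * ‖η‖^2)) := by
  obtain ⟨K1, hK1, h1⟩ := pow_exp_bdd n (a := 1/8) (by norm_num)
  obtain ⟨K2, hK2, h2⟩ := pow_exp_bdd (n+1) (a := 1/8) (by norm_num)
  set a := Real.pi * δ^2 with ha
  have hap : 0 < a := by positivity
  have hpi := Real.pi_gt_three
  set D := 2 * n * (K1 + K2 / a) with hD
  have hD0 : 0 ≤ D := by positivity
  have key : ∀ η : Rn n, (2 * n * (a * ‖η‖^2)^n * exp (-((a * ‖η‖^2)/4))) * (1 + ‖η‖^2) ≤ D * exp (-(a/8) * ‖η‖^2) := by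
    intro η
    set s := a * ‖η‖^2 with hs
    have hs0 : 0 ≤ s := by positivity
    have e1 : exp (-(s/4)) = exp (-(1/8) * s) * exp (-(a/8) * ‖η‖^2) := by
      rw [← Real.exp_add]; congr 1; rw [hs]; ring
    have e2 : ‖η‖^2 = s / a := by rw [hs]; field_simp
    calc _ = 2 * n * (s^n * exp (-(1/8) * s) + (s^(n+1) * exp (-(1/8) * s)) / a) * exp (-(a/8) * ‖η‖^2) := by
          rw [e1]
          generalize exp (-(a/8) * ‖η‖^2) = X
          rw [e2]
          ring
      _ ≤ _ := by
          rw [hD]; gcongr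
          · exact h1 s hs0
          · exact h2 s hs0
  refine ⟨D * (2 + 2 * Real.pi), a/8, by positivity, by positivity, fun η => ?_, fun η => ?_⟩
  · calc _ ≤ _ := kap_bd hn δ η
      _ ≤ (2 * n * (a * ‖η‖^2)^n * exp (-((a * ‖η‖^2)/4))) * (1 + ‖η‖^2) := by
          gcongr; exact (sig_le η).trans (by nlinarith [sq_nonneg ‖η‖])
      _ ≤ _ := key η
      _ ≤ _ := by gcongr; nlinarith
  · calc _ ≤ _ := lap_bd hn δ η
      _ ≤ (2 * n * (a * ‖η‖^2)^n * exp (-((a * ‖η‖^2)/4))) * ((1 + ‖η‖^2) * (2 + 2 * Real.pi)) := by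
          gcongr
          have h3 := sig_le η
          have h4 := S1_le η
          have h5 : ‖η‖ ≤ 1 + ‖η‖^2 := by nlinarith [sq_nonneg (‖η‖ - 1), sq_nonneg ‖η‖]
          have h6 : 2 * Real.pi * ‖S1 η‖ ≤ 2 * Real.pi * (1 + ‖η‖^2) := by gcongr; exact h4.trans h5
          nlinarith [sq_nonneg ‖η‖]
      _ = (2 * n * (a * ‖η‖^2)^n * exp (-((a * ‖η‖^2)/4))) * (1 + ‖η‖^2) * (2 + 2 * Real.pi) := by ring
      _ ≤ _ := by
          rw [mul_right_comm D]; exact mul_le_mul_of_nonneg_right (key η) (by positivity)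

lemma sq_enorm (z : ℂ) : ‖z‖ₑ^2 = ofReal (‖z‖^2) := by
  rw [← ofReal_norm, ENNReal.ofReal_pow (norm_nonneg _)]

lemma kap_L2 {n : ℕ} (hn : 0 < n) : ∃ C : ℝ, 0 < C ∧ ∀ δ : ℝ, 0 < δ → δ ≤ 1 → ∀ f : Rn n → ℂ, Integrable f →
    ∃ W : Rn n → ℝ≥0∞, Measurable W ∧ (∀ x (T : ℝ), 0 < T → ‖um (ft volume f) (kap δ) x T‖ₑ ^ 2 ≤ W x) ∧
      ∫⁻ x, W x ≤ ofReal (C * (δ^n * (δ^2)⁻¹)) * ∫⁻ x, ‖f x‖ₑ ^ 2 := by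
  obtain ⟨Cp, hCp, hpol⟩ := polar_log hn
  obtain ⟨Cs, hCs, hsph⟩ := sph_P hn
  obtain ⟨K, hK, hdec⟩ := dec_bd hn
  have hpi := Real.pi_pos
  have hn' : (0:ℝ) < n := by exact_mod_cast hn
  set M := Cp * (8 * K * Cs + 8 * Real.pi^2 * K * n * Cs) with hM
  have hMp : 0 < M := by positivity
  refine ⟨2 * M, by positivity, fun δ hδ hδ1 f hf => ?_⟩
  obtain ⟨A, c, hA, hc, hk1, hk2⟩ := kaplap_gauss hn hδ
  have hδ2 : 1 ≤ (δ^2)⁻¹ := (one_le_inv₀ (by positivity)).2 (by nlinarith)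
  have hP1 := hsph δ hδ hδ1 (fun _ => 1) (integrable_const _) (by simp)
  have hP2 := fun i : Fin n => hsph δ hδ hδ1 (fun ω => (ω i : ℂ)) (coord_int i) (fun ω hω => hω ▸ coord_le ω i)
  have hB1 : ∀ ξ : Rn n, ∫⁻ t in Set.Ioi (0:ℝ), ‖kap δ (t • ξ)‖ₑ ^ 2 * ofReal t⁻¹ ≤ ofReal (M * (δ^n * δ⁻¹)) := by
    intro ξ
    refine (hpol (fun η => ‖kap δ η‖ₑ^2) ((continuous_kap δ).measurable.enorm.pow_const 2) (by simp [kap, Phi_zero hn])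
      (fun x y h => by simp only [kap]; rw [h, sig_rad h]) ξ).trans ?_
    have : ∫⁻ η : Rn n, ‖kap δ η‖ₑ^2 * ofReal (‖η‖^n)⁻¹ ≤ ofReal (K * δ^n) * ofReal (Cs * δ⁻¹) := by
      refine le_trans ?_ (mul_le_mul' le_rfl hP1)
      rw [← lintegral_const_mul' _ _ ENNReal.ofReal_ne_top]
      refine lintegral_mono fun η => ?_
      rw [sq_enorm, sq_enorm, ← ENNReal.ofReal_mul (by positivity), ← ENNReal.ofReal_mul (by positivity), ← ENNReal.ofReal_mul (by positivity)]
      apply ENNReal.ofReal_le_ofReal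
      calc _ ≤ ((2 * n * (Real.pi * δ^2 * ‖η‖^2)^n * exp (-((Real.pi * δ^2 * ‖η‖^2)/4))) * ‖sig η‖)^2 * (‖η‖^n)⁻¹ := by
            gcongr; exact kap_bd hn δ η
        _ = ‖sig η‖^2 * ((2 * n * (Real.pi * δ^2 * ‖η‖^2)^n * exp (-((Real.pi * δ^2 * ‖η‖^2)/4)))^2 * (‖η‖^n)⁻¹) := by ring
        _ ≤ ‖sig η‖^2 * (K * δ^n * exp (-(Real.pi * (δ/2)^2) * ‖η‖^2)) := 
            mul_le_mul_of_nonneg_left (hdec δ hδ hδ1 ‖η‖ (norm_nonneg _)).1 (by positivity)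
        _ = _ := by rw [sig]; ring
    refine (mul_le_mul' le_rfl this).trans ?_
    rw [← ENNReal.ofReal_mul (by positivity), ← ENNReal.ofReal_mul (by positivity)]
    apply ENNReal.ofReal_le_ofReal
    have e : M * (δ^n * δ⁻¹) = Cp * (K * δ^n * (Cs * δ⁻¹)) + (7 * K * Cs + 8 * Real.pi^2 * K * n * Cs) * Cp * (δ^n * δ⁻¹) := by rw [hM]; ring
    rw [e]
    have : 0 ≤ (7 * K * Cs + 8 * Real.pi^2 * K * n * Cs) * Cp * (δ^n * δ⁻¹) := by positivity
    linarith
  have hB2 : ∀ ξ : Rn n, ∫⁻ t in Set.Ioi (0:ℝ), ‖lap δ (t • ξ)‖ₑ ^ 2 * ofReal t⁻¹ ≤ ofReal (M * (δ^n * (δ^2)⁻¹ * δ⁻¹)) := by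
    intro ξ
    refine (hpol (fun η => ‖lap δ η‖ₑ^2) ((continuous_lap δ).measurable.enorm.pow_const 2) (by simp [lap, Phi_zero hn, PhiD_zero])
      (fun x y h => by simp only [lap]; rw [h, sig_rad h, S1_rad h]) ξ).trans ?_
    have : ∫⁻ η : Rn n, ‖lap δ η‖ₑ^2 * ofReal (‖η‖^n)⁻¹ ≤ ofReal (8 * K * δ^n) * ofReal (Cs * δ⁻¹) +
        ofReal (8 * Real.pi^2 * K * δ^n * (δ^2)⁻¹) * ∑ i : Fin n, ofReal (Cs * δ⁻¹) := by
      refine le_trans ?_ (add_le_add (mul_le_mul' le_rfl hP1) (mul_le_mul' le_rfl (Finset.sum_le_sum fun i _ => hP2 i)))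
      rw [← lintegral_finsetSum _ (fun i _ => by have := (continuous_sgm i).measurable; unfold sgm at this; fun_prop)]
      rw [← lintegral_const_mul' _ _ ENNReal.ofReal_ne_top, ← lintegral_const_mul' _ _ ENNReal.ofReal_ne_top,
        ← lintegral_add_left (by have := (continuous_sig (n := n)).measurable; unfold sig at this; fun_prop)]
      refine lintegral_mono fun η => ?_
      simp only [sq_enorm]
      rw [← Finset.sum_mul, ← ENNReal.ofReal_sum_of_nonneg (fun i _ => by positivity)]
      rw [← ENNReal.ofReal_mul (by positivity), ← ENNReal.ofReal_mul (by positivity), ← ENNReal.ofReal_mul (by positivity),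
        ← ENNReal.ofReal_mul (by positivity), ← ENNReal.ofReal_mul (by positivity), ← ENNReal.ofReal_add (by positivity) (by positivity)]
      apply ENNReal.ofReal_le_ofReal
      obtain ⟨d1, d2⟩ := hdec δ hδ hδ1 ‖η‖ (norm_nonneg _)
      have hl := lap_bd hn δ η
      have hS := S1_sq η
      set E := 2 * n * (Real.pi * δ^2 * ‖η‖^2)^n * exp (-((Real.pi * δ^2 * ‖η‖^2)/4))
      set G := exp (-(Real.pi * (δ/2)^2) * ‖η‖^2)
      set Q := ∑ i, ‖sgm i η‖^2 with hQ
      have hQ0 : 0 ≤ Q := by positivity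
      change _ ≤ 8 * K * δ^n * (‖sig η‖^2 * G) + 8 * Real.pi^2 * K * δ^n * (δ^2)⁻¹ * (Q * G)
      calc _ ≤ (E * (2 * ‖sig η‖ + 2 * Real.pi * ‖S1 η‖))^2 * (‖η‖^n)⁻¹ := by gcongr
        _ = E^2 * (‖η‖^n)⁻¹ * (2 * ‖sig η‖ + 2 * Real.pi * ‖S1 η‖)^2 := by ring
        _ ≤ E^2 * (‖η‖^n)⁻¹ * (8 * ‖sig η‖^2 + 8 * Real.pi^2 * (‖η‖^2 * Q)) := by
            gcongr
            have : (2 * ‖sig η‖ + 2 * Real.pi * ‖S1 η‖)^2 ≤ 8 * ‖sig η‖^2 + 8 * Real.pi^2 * ‖S1 η‖^2 := by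
              nlinarith [sq_nonneg (2 * ‖sig η‖ - 2 * Real.pi * ‖S1 η‖)]
            refine this.trans ?_
            gcongr
        _ = 8 * ‖sig η‖^2 * (E^2 * (‖η‖^n)⁻¹) + 8 * Real.pi^2 * Q * (E^2 * (‖η‖^n)⁻¹ * ‖η‖^2) := by ring
        _ ≤ 8 * ‖sig η‖^2 * (K * δ^n * G) + 8 * Real.pi^2 * Q * (K * δ^n * (δ^2)⁻¹ * G) := by gcongr
        _ = _ := by ring
    refine (mul_le_mul' le_rfl this).trans ?_
    rw [Finset.sum_const, Finset.card_univ, Fintype.card_fin, nsmul_eq_mul, ← ENNReal.ofReal_natCast, 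
      ← ENNReal.ofReal_mul (by positivity), ← ENNReal.ofReal_mul (by positivity),
      ← ENNReal.ofReal_mul (by positivity), ← ENNReal.ofReal_add (by positivity) (by positivity), ← ENNReal.ofReal_mul (by positivity)]
    apply ENNReal.ofReal_le_ofReal
    have e : 8 * K * δ^n * (Cs * δ⁻¹) ≤ 8 * K * (δ^n * (δ^2)⁻¹) * (Cs * δ⁻¹) := by
      gcongr; exact le_mul_of_one_le_right (by positivity) hδ2
    calc _ ≤ Cp * (8 * K * (δ^n * (δ^2)⁻¹) * (Cs * δ⁻¹) + 8 * Real.pi^2 * K * δ^n * (δ^2)⁻¹ * (n * (Cs * δ⁻¹))) := by gcongr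
      _ = _ := by rw [hM]; ring
  obtain ⟨W, hW1, hW2, hW3⟩ := max_L2 hn hf (continuous_kap δ) (continuous_lap δ) hA hc hk1 hk2 (kap_deriv δ) hB1 hB2 (inv_pos.2 hδ)
  refine ⟨W, hW1, hW2, hW3.trans (mul_le_mul' (le_of_eq ?_) le_rfl)⟩
  rw [← ENNReal.ofReal_mul (by positivity), ← ENNReal.ofReal_mul (by positivity), ← ENNReal.ofReal_add (by positivity) (by positivity)]
  congr 1
  field_simp
  ring

def ck (n k : ℕ) : ℝ := (-1)^k * (n.choose (k+1) : ℝ)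

lemma ck_sum (n : ℕ) (x : ℝ) : ∑ k ∈ Finset.range n, ck n k * x^(k+1) = 1 - (1 - x)^n := by
  have h : (1 - x)^n = ((-x) + 1)^n := by ring
  rw [h, add_pow, Finset.sum_range_succ']
  simp only [ck, one_pow, mul_one, pow_zero, Nat.choose_zero_right, Nat.cast_one]
  rw [sub_add_cancel_right, ← Finset.sum_neg_distrib]
  refine Finset.sum_congr rfl fun k _ => ?_
  rw [neg_pow x]; ring

def wk (k : ℕ) : ℝ := Real.sqrt (k+1)
lemma wk_sq (k : ℕ) : wk k ^ 2 = k + 1 := Real.sq_sqrt (by positivity)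
lemma wk_one (k : ℕ) : 1 ≤ wk k := Real.one_le_sqrt.2 (by have : (0:ℝ) ≤ k := by positivity
                                                          linarith)
lemma wk_pos (k : ℕ) : 0 < wk k := zero_lt_one.trans_le (wk_one k)

def Qk {n : ℕ} (ρ : ℝ) (z : Rn n) : ℝ := ∑ k ∈ Finset.range n, ck n k * gs (wk k * ρ) z

lemma continuous_Qk {n : ℕ} (ρ : ℝ) : Continuous (Qk (n := n) ρ) := by
  unfold Qk
  exact continuous_finsetSum _ fun k _ => (continuous_gs _).const_mul _

def pw (n : ℕ) (s : ℝ) : ℝ := 1 - (1 - exp (-s))^n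

lemma Phi_pw (n : ℕ) (s : ℝ) : Phi n s = pw n (s/4) - pw n s := by unfold Phi pw; ring

lemma pw_sum (n : ℕ) (ρ r : ℝ) : pw n (Real.pi * ρ^2 * r^2) = ∑ k ∈ Finset.range n, ck n k * exp (-(Real.pi * (wk k * ρ)^2) * r^2) := by
  rw [pw, ← ck_sum]
  refine Finset.sum_congr rfl fun k _ => ?_
  rw [← Real.exp_nat_mul, mul_pow, wk_sq]
  congr 2; push_cast; ring

lemma pw_int {n : ℕ} {ρ : ℝ} (hρ : 0 < ρ) : Integrable (fun ξ : Rn n => pw n (Real.pi * ρ^2 * ‖ξ‖^2)) := by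
  simp_rw [pw_sum]
  refine integrable_finsetSum _ fun k _ => (integrable_gauss ?_).const_mul _
  have := wk_pos k
  positivity

lemma pw_ft {n : ℕ} {ρ : ℝ} (hρ : 0 < ρ) (z : Rn n) : ∫ ξ : Rn n, (pw n (Real.pi * ρ^2 * ‖ξ‖^2) : ℂ) * ee z ξ = (Qk ρ z : ℂ) := by
  simp_rw [pw_sum]
  unfold Qk
  push_cast
  simp_rw [Finset.sum_mul]
  have hint : ∀ k, Integrable (fun ξ : Rn n => (ck n k : ℂ) * Complex.exp (-(Real.pi * (wk k * ρ)^2) * ‖ξ‖^2) * ee z ξ) := by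
    intro k
    have hk := wk_pos k
    have h1 := ((integrable_gauss (n := n) (b := Real.pi * (wk k * ρ)^2) (by positivity)).const_mul (ck n k)).ofReal (𝕜 := ℂ)
    refine h1.mono (by fun_prop) (Eventually.of_forall fun ξ => ?_)
    rw [norm_mul, norm_ee, mul_one]
    simp
  rw [integral_finsetSum _ (fun k _ => hint k)]
  refine Finset.sum_congr rfl fun k _ => ?_
  have hk := wk_pos k
  rw [← gauss_ft (by positivity), ← integral_const_mul]
  congr 1 with ξ
  push_cast; ring

def qk {n : ℕ} (ρ : ℝ) (z : Rn n) : ℝ := Qk (ρ/2) z - Qk ρ z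

lemma Phi_int {n : ℕ} {ρ : ℝ} (hρ : 0 < ρ) : Integrable (fun ξ : Rn n => Phi n (Real.pi * ρ^2 * ‖ξ‖^2)) := by
  have h := (pw_int (n := n) (half_pos hρ)).sub (pw_int (n := n) hρ)
  refine h.congr (Eventually.of_forall fun ξ => ?_)
  simp only [Pi.sub_apply, Phi_pw]
  congr 2; ring

lemma Phi_ft {n : ℕ} {ρ : ℝ} (hρ : 0 < ρ) (z : Rn n) : ∫ ξ : Rn n, (Phi n (Real.pi * ρ^2 * ‖ξ‖^2) : ℂ) * ee z ξ = (qk ρ z : ℂ) := by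
  unfold qk
  push_cast
  rw [← pw_ft hρ, ← pw_ft (half_pos hρ), ← integral_sub]
  · congr 1 with ξ
    rw [Phi_pw, ← sub_mul]; push_cast
    congr 5; ring
  · refine (pw_int (n := n) (half_pos hρ)).ofReal (𝕜 := ℂ) |>.mono (by unfold pw; fun_prop) (Eventually.of_forall fun ξ => ?_)
    rw [norm_mul, norm_ee, mul_one]; rfl
  · refine (pw_int (n := n) hρ).ofReal (𝕜 := ℂ) |>.mono (by unfold pw; fun_prop) (Eventually.of_forall fun ξ => ?_)
    rw [norm_mul, norm_ee, mul_one]; rfl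

/-- main kernel -/
def Mk {n : ℕ} (δ t : ℝ) (z : Rn n) : ℝ := ∫ ω, Qk (δ * t) (z - t • ω) ∂(unitSphereMeasure n)
/-- dyadic piece -/
def kern {n : ℕ} (δ t : ℝ) (z : Rn n) : ℝ := ∫ ω, qk (δ * t) (z - t • ω) ∂(unitSphereMeasure n)

lemma um_kern {n : ℕ} {f : Rn n → ℂ} (hf : Integrable f) {δ t : ℝ} (hδ : 0 < δ) (ht : 0 < t) (x : Rn n) :
    um (ft volume f) (kap δ) x t = ∫ y, f y * (kern δ t (x - y) : ℂ) := by
  set σ := unitSphereMeasure n with hσ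
  set P : Rn n → ℂ := fun ξ => (Phi n (Real.pi * (δ * t)^2 * ‖ξ‖^2) : ℂ) with hP
  have hPi : Integrable P := (Phi_int (by positivity)).ofReal
  have h1 : ∀ ξ, ft volume f ξ * kap δ (t • ξ) * ee x ξ = ∫ p : Rn n × Rn n, P ξ * (f p.1 * ee (x - p.1 - t • p.2) ξ) ∂(volume.prod σ) := by
    intro ξ
    have e := integral_prod_mul (μ := (volume : Measure (Rn n))) (ν := σ) (fun y => f y * ee (-y) ξ) (fun ω => 1 * ee (-ω) (t • ξ))
    unfold ft kap sig ft
    have e2 : Phi n (Real.pi * δ^2 * ‖t • ξ‖^2) = Phi n (Real.pi * (δ * t)^2 * ‖ξ‖^2) := by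
      congr 1; rw [norm_smul, mul_pow, Real.norm_eq_abs, sq_abs]; ring
    rw [e2]
    calc _ = P ξ * ee x ξ * ((∫ y, f y * ee (-y) ξ) * ∫ ω, 1 * ee (-ω) (t • ξ) ∂σ) := by rw [hP]; ring
      _ = _ := by
        rw [← e, ← integral_const_mul]
        congr 1 with p
        have : ee (x - p.1 - t • p.2) ξ = ee x ξ * (ee (-p.1) ξ * ee (-p.2) (t • ξ)) := by
          rw [sub_eq_add_neg, sub_eq_add_neg, ee_add, ee_add, mul_assoc]
          congr 2
          unfold ee; rw [inner_neg_left, inner_neg_left, inner_smul_left, inner_smul_right]; rfl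
        rw [this]; ring
  unfold um
  simp_rw [h1]
  have hFi : Integrable (fun z : Rn n × (Rn n × Rn n) => P z.1 * (f z.2.1 * ee (x - z.2.1 - t • z.2.2) z.1)) (volume.prod (volume.prod σ)) := by
    have h2 : Integrable (fun z : Rn n × (Rn n × Rn n) => P z.1 * (f z.2.1 * 1)) (volume.prod (volume.prod σ)) :=
      hPi.mul_prod (hf.mul_prod (integrable_const (1:ℂ)))
    have hm : AEStronglyMeasurable (fun z : Rn n × (Rn n × Rn n) => ee (x - z.2.1 - t • z.2.2) z.1) (volume.prod (volume.prod σ)) := by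
      apply Continuous.aestronglyMeasurable; fun_prop
    refine (h2.mul_bdd (c := 1) hm (Eventually.of_forall fun z => by rw [norm_ee])).congr (Eventually.of_forall fun z => ?_)
    simp only; ring
  rw [integral_integral_swap hFi]
  have h3 : ∀ p : Rn n × Rn n, ∫ ξ, P ξ * (f p.1 * ee (x - p.1 - t • p.2) ξ) = f p.1 * (qk (δ * t) (x - p.1 - t • p.2) : ℂ) := by
    intro p
    rw [← Phi_ft (by positivity), ← integral_const_mul]
    congr 1 with ξ
    simp only [hP]; ring
  simp_rw [h3]
  have hi := hFi.integral_prod_right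
  simp only [h3] at hi
  rw [integral_prod _ hi]
  congr 1 with y
  simp only
  rw [integral_const_mul, kern, ← integral_complex_ofReal]

lemma gs_scale {n : ℕ} {ρ t : ℝ} (ht : 0 < t) (z ω : Rn n) :
    gs (ρ * t) (z - t • ω) = (t^n)⁻¹ * gs ρ (t⁻¹ • z - ω) := by
  have e : z - t • ω = t • (t⁻¹ • z - ω) := by rw [smul_sub, smul_inv_smul₀ ht.ne']
  rw [e]
  unfold gs
  rw [norm_smul, Real.norm_of_nonneg ht.le, mul_pow, mul_pow, mul_pow]
  rw [mul_comm (t^2), ← mul_assoc, mul_div_mul_right _ _ (by positivity), mul_inv]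
  ring

lemma gs_t {n : ℕ} (hn : 0 < n) : ∃ C : ℝ, 0 < C ∧ ∀ ρ : ℝ, 0 < ρ → ρ ≤ 1 → ∀ t : ℝ, 0 < t → ∀ z : Rn n,
    ∫⁻ ω, ofReal (gs (ρ * t) (z - t • ω)) ∂(unitSphereMeasure n) ≤
      ofReal (C * ρ⁻¹ * ((t^n)⁻¹ * exp (-(Real.pi/4) * ‖t⁻¹ • z‖^2))) := by
  obtain ⟨C, hC, h⟩ := sph_gs hn
  refine ⟨C, hC, fun ρ hρ hρ1 t ht z => ?_⟩
  simp_rw [gs_scale ht]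
  calc _ = ofReal (t^n)⁻¹ * ∫⁻ ω, ofReal (gs ρ (t⁻¹ • z - ω)) ∂(unitSphereMeasure n) := by
        rw [← lintegral_const_mul' _ _ ENNReal.ofReal_ne_top]
        congr 1 with ω
        rw [ENNReal.ofReal_mul (by positivity)]
    _ ≤ ofReal (t^n)⁻¹ * ofReal (C * ρ⁻¹ * exp (-(Real.pi/4) * ‖t⁻¹ • z‖^2)) := mul_le_mul' le_rfl (h ρ hρ hρ1 _)
    _ = _ := by rw [← ENNReal.ofReal_mul (by positivity)]; congr 1; ring

lemma wk_le {n k : ℕ} (hk : k < n) : wk k ≤ n := by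
  have h1 := wk_sq k
  have h2 := wk_one k
  have h3 : (k:ℝ) + 1 ≤ n := by exact_mod_cast hk
  nlinarith

lemma Qk_enorm {n : ℕ} {ρ : ℝ} (hρ : 0 < ρ) (z : Rn n) : ‖Qk ρ z‖ₑ ≤ ∑ k ∈ Finset.range n, ofReal |ck n k| * ofReal (gs (wk k * ρ) z) := by
  unfold Qk
  refine (enorm_sum_le _ _).trans (Finset.sum_le_sum fun k _ => le_of_eq ?_)
  rw [enorm_mul, Real.enorm_eq_ofReal_abs, Real.enorm_of_nonneg (gs_nonneg (mul_pos (wk_pos k) hρ) _)]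

lemma Qk_bd {n : ℕ} (hn : 0 < n) : ∃ C : ℝ, 0 < C ∧ ∀ δ : ℝ, 0 < δ → n * δ ≤ 1 → ∀ t : ℝ, 0 < t → ∀ z : Rn n,
    ∫⁻ ω, ‖Qk (δ * t) (z - t • ω)‖ₑ ∂(unitSphereMeasure n) ≤
      ofReal (C * δ⁻¹ * ((t^n)⁻¹ * exp (-(Real.pi/4) * ‖t⁻¹ • z‖^2))) := by
  obtain ⟨C, hC, h⟩ := gs_t hn
  refine ⟨(∑ k ∈ Finset.range n, |ck n k|) * C + 1, by positivity, fun δ hδ hδ1 t ht z => ?_⟩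
  set X := (t^n)⁻¹ * exp (-(Real.pi/4) * ‖t⁻¹ • z‖^2) with hX
  have hX0 : 0 < X := by positivity
  calc _ ≤ ∫⁻ ω, ∑ k ∈ Finset.range n, ofReal |ck n k| * ofReal (gs (wk k * (δ * t)) (z - t • ω)) ∂(unitSphereMeasure n) :=
        lintegral_mono fun ω => Qk_enorm (by positivity) _
    _ = ∑ k ∈ Finset.range n, ofReal |ck n k| * ∫⁻ ω, ofReal (gs ((wk k * δ) * t) (z - t • ω)) ∂(unitSphereMeasure n) := by
        rw [lintegral_finsetSum _ (fun k _ => by have := continuous_gs (n := n) (wk k * (δ * t)); fun_prop)]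
        refine Finset.sum_congr rfl fun k _ => ?_
        rw [lintegral_const_mul' _ _ ENNReal.ofReal_ne_top]
        simp_rw [mul_assoc]
    _ ≤ ∑ k ∈ Finset.range n, ofReal (|ck n k| * (C * δ⁻¹ * X)) := by
        refine Finset.sum_le_sum fun k hk => ?_
        have hk' := wk_le (Finset.mem_range.1 hk)
        have hk1 := wk_one k
        have hk0 := wk_pos k
        rw [ENNReal.ofReal_mul (abs_nonneg _)]
        refine mul_le_mul' le_rfl ((h (wk k * δ) (by positivity) ((mul_le_mul_of_nonneg_right hk' hδ.le).trans hδ1) t ht z).trans ?_)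
        apply ENNReal.ofReal_le_ofReal
        rw [← hX]
        gcongr
        exact le_mul_of_one_le_left hδ.le hk1
    _ = ofReal ((∑ k ∈ Finset.range n, |ck n k|) * (C * δ⁻¹ * X)) := by
        rw [← ENNReal.ofReal_sum_of_nonneg (fun k _ => by positivity), Finset.sum_mul]
    _ ≤ _ := by
        apply ENNReal.ofReal_le_ofReal
        have : 0 ≤ δ⁻¹ * X := by positivity
        nlinarith

lemma meas_gs {n : ℕ} {X : Type*} [MeasurableSpace X] {a : X → ℝ} {b : X → Rn n} (ha : Measurable a) (hb : Measurable b) :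
    Measurable fun x => gs (a x) (b x) := by unfold gs; fun_prop
lemma meas_Qk {n : ℕ} {X : Type*} [MeasurableSpace X] {a : X → ℝ} {b : X → Rn n} (ha : Measurable a) (hb : Measurable b) :
    Measurable fun x => Qk (a x) (b x) := by
  unfold Qk
  exact Finset.measurable_fun_sum _ fun k _ => (meas_gs (ha.const_mul _) hb).const_mul _
lemma meas_qk {n : ℕ} {X : Type*} [MeasurableSpace X] {a : X → ℝ} {b : X → Rn n} (ha : Measurable a) (hb : Measurable b) :
    Measurable fun x => qk (a x) (b x) := by
  unfold qk
  exact (meas_Qk (ha.div_const 2) hb).sub (meas_Qk ha hb)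
lemma meas_Mk {n : ℕ} {X : Type*} [MeasurableSpace X] (δ : ℝ) {a : X → ℝ} {b : X → Rn n} (ha : Measurable a) (hb : Measurable b) :
    Measurable fun x => Mk δ (a x) (b x) := by
  unfold Mk
  exact (meas_Qk (n := n) (X := X × Rn n) (a := fun p => δ * a p.1) (b := fun p => b p.1 - a p.1 • p.2) (by fun_prop) (by fun_prop)).stronglyMeasurable.integral_prod_right.measurable
lemma meas_kern {n : ℕ} {X : Type*} [MeasurableSpace X] (δ : ℝ) {a : X → ℝ} {b : X → Rn n} (ha : Measurable a) (hb : Measurable b) :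
    Measurable fun x => kern δ (a x) (b x) := by
  unfold kern
  exact (meas_qk (n := n) (X := X × Rn n) (a := fun p => δ * a p.1) (b := fun p => b p.1 - a p.1 • p.2) (by fun_prop) (by fun_prop)).stronglyMeasurable.integral_prod_right.measurable

lemma kern_Mk {n : ℕ} (hn : 0 < n) {δ t : ℝ} (hδ : 0 < δ) (hδ1 : n * δ ≤ 1) (ht : 0 < t) (z : Rn n) :
    kern δ t z = Mk (δ/2) t z - Mk δ t z := by
  obtain ⟨C, hC, h⟩ := Qk_bd hn
  have hi : ∀ δ : ℝ, 0 < δ → n * δ ≤ 1 → Integrable (fun ω => Qk (δ * t) (z - t • ω)) (unitSphereMeasure n) := fun δ hδ hδ1 =>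
    ⟨(meas_Qk measurable_const (by fun_prop)).aestronglyMeasurable, (h δ hδ hδ1 t ht z).trans_lt ENNReal.ofReal_lt_top⟩
  unfold kern Mk
  rw [← integral_sub (hi _ (half_pos hδ) (by nlinarith)) (hi _ hδ hδ1)]
  congr 1 with ω
  unfold qk
  congr 2; ring

lemma MK_bd {n : ℕ} (hn : 0 < n) : ∃ C : ℝ, 0 < C ∧ ∀ δ : ℝ, 0 < δ → n * δ ≤ 1 → ∀ t : ℝ, 0 < t → ∀ z : Rn n,
    ‖Mk δ t z‖ₑ ≤ ofReal (C * δ⁻¹) * ofReal ((t^n)⁻¹ * exp (-(Real.pi/4) * ‖t⁻¹ • z‖^2)) ∧ 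
    ‖kern δ t z‖ₑ ≤ ofReal (C * δ⁻¹) * ofReal ((t^n)⁻¹ * exp (-(Real.pi/4) * ‖t⁻¹ • z‖^2)) := by
  obtain ⟨C, hC, h⟩ := Qk_bd hn
  refine ⟨3 * C, by positivity, fun δ hδ hδ1 t ht z => ?_⟩
  set X := (t^n)⁻¹ * exp (-(Real.pi/4) * ‖t⁻¹ • z‖^2) with hX
  have hX0 : 0 < X := by positivity
  have hM : ∀ δ : ℝ, 0 < δ → n * δ ≤ 1 → ‖Mk δ t z‖ₑ ≤ ofReal (C * δ⁻¹ * X) := fun δ hδ hδ1 =>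
    (enorm_integral_le_lintegral_enorm _).trans (h δ hδ hδ1 t ht z)
  rw [← ENNReal.ofReal_mul (by positivity)]
  have h1 : 0 ≤ C * δ⁻¹ * X := by positivity
  constructor
  · refine (hM δ hδ hδ1).trans (ENNReal.ofReal_le_ofReal ?_)
    nlinarith
  · rw [kern_Mk hn hδ hδ1 ht]
    refine enorm_sub_le.trans ((add_le_add (hM _ (half_pos hδ) (by nlinarith)) (hM δ hδ hδ1)).trans ?_)
    rw [← ENNReal.ofReal_add (by positivity) (by positivity)]
    refine (ENNReal.ofReal_le_ofReal (le_of_eq ?_))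
    field_simp; ring

lemma MK_mx {n : ℕ} (hn : 0 < n) : ∃ C : ℝ, 0 < C ∧ ∀ δ : ℝ, 0 < δ → n * δ ≤ 1 → ∀ t : ℝ, 0 < t → 
    ∀ f : Rn n → ℝ≥0∞, Measurable f → ∀ x,
    ∫⁻ y, f y * ‖Mk δ t (x - y)‖ₑ ≤ ofReal (C * δ⁻¹) * mx f x ∧ 
    ∫⁻ y, f y * ‖kern δ t (x - y)‖ₑ ≤ ofReal (C * δ⁻¹) * mx f x := by
  obtain ⟨C, hC, h⟩ := MK_bd hn
  obtain ⟨D, hD, h2⟩ := gauss_mx (n := n) (c := Real.pi/4) (by positivity)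
  refine ⟨C * (D.toReal + 1), by positivity, fun δ hδ hδ1 t ht f hf x => ?_⟩
  have key : ∀ k : Rn n → ℝ≥0∞, (∀ z, k z ≤ ofReal (C * δ⁻¹) * ofReal ((t^n)⁻¹ * exp (-(Real.pi/4) * ‖t⁻¹ • z‖^2))) →
      ∫⁻ y, f y * k (x - y) ≤ ofReal (C * (D.toReal + 1) * δ⁻¹) * mx f x := by
    intro k hk
    calc _ ≤ ∫⁻ y, ofReal (C * δ⁻¹) * (f y * ofReal ((t^n)⁻¹ * exp (-(Real.pi/4) * ‖t⁻¹ • (x - y)‖^2))) := by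
          refine lintegral_mono fun y => (mul_le_mul' le_rfl (hk (x - y))).trans (le_of_eq ?_)
          ring
      _ = ofReal (C * δ⁻¹) * ∫⁻ y, (f y * ofReal ((t^n)⁻¹ * exp (-(Real.pi/4) * ‖t⁻¹ • (x - y)‖^2))) :=
          lintegral_const_mul' _ _ ENNReal.ofReal_ne_top
      _ ≤ ofReal (C * δ⁻¹) * (D * mx f x) := mul_le_mul' le_rfl (h2 f hf t ht x)
      _ ≤ _ := by
          rw [← mul_assoc]
          refine mul_le_mul' ?_ le_rfl
          rw [← ENNReal.ofReal_toReal hD, ← ENNReal.ofReal_mul (by positivity), ENNReal.toReal_ofReal (by positivity)]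
          apply ENNReal.ofReal_le_ofReal
          have : 0 ≤ C * δ⁻¹ := by positivity
          nlinarith
  exact ⟨key (fun z => ‖Mk δ t z‖ₑ) fun z => (h δ hδ hδ1 t ht z).1, key (fun z => ‖kern δ t z‖ₑ) fun z => (h δ hδ hδ1 t ht z).2⟩

lemma int_gs {n : ℕ} {δ : ℝ} (hδ : 0 < δ) : Integrable (fun z : Rn n => gs δ z) ∧ ∫ z : Rn n, gs δ z = 1 := by
  have h := lint_gs hδ (0 : Rn n)
  simp_rw [sub_zero] at h
  have h0 : 0 ≤ᵐ[volume] fun z : Rn n => gs δ z := ae_of_all _ fun z => gs_nonneg hδ z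
  have hm := (continuous_gs (n := n) δ).aestronglyMeasurable (μ := volume)
  refine ⟨⟨hm, ?_⟩, ?_⟩
  · rw [hasFiniteIntegral_iff_ofReal h0, h]; exact ENNReal.one_lt_top
  · rw [integral_eq_lintegral_of_nonneg_ae h0 hm, h]; rfl

lemma int_Qk {n : ℕ} (hn : 0 < n) {ρ : ℝ} (hρ : 0 < ρ) : Integrable (fun z : Rn n => Qk ρ z) ∧ ∫ z : Rn n, Qk ρ z = 1 := by
  have hi : ∀ k ∈ Finset.range n, Integrable (fun z : Rn n => ck n k * gs (wk k * ρ) z) := fun k _ =>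
    (int_gs (mul_pos (wk_pos k) hρ)).1.const_mul _
  unfold Qk
  refine ⟨integrable_finsetSum _ hi, ?_⟩
  rw [integral_finsetSum _ hi]
  have := ck_sum n 1
  rw [sub_self, zero_pow hn.ne', sub_zero] at this
  rw [← this]
  refine Finset.sum_congr rfl fun k _ => ?_
  rw [integral_const_mul, (int_gs (mul_pos (wk_pos k) hρ)).2]; simp

lemma Qk_scale {n : ℕ} {ρ : ℝ} (hρ : 0 < ρ) (u : Rn n) : Qk ρ (ρ • u) = (ρ^n)⁻¹ * Qk 1 u := by
  unfold Qk
  rw [Finset.mul_sum]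
  refine Finset.sum_congr rfl fun k _ => ?_
  have := gs_scale (ρ := wk k) hρ (ρ • u) 0
  rw [smul_zero, sub_zero, sub_zero, inv_smul_smul₀ hρ.ne'] at this
  rw [this]; ring_nf

lemma conv_Qk {n : ℕ} {ρ : ℝ} (hρ : 0 < ρ) (f : Rn n → ℝ) (a : Rn n) :
    ∫ y, f y * Qk ρ (a - y) = ∫ u, f (a - ρ • u) * Qk 1 u := by
  rw [← integral_sub_left_eq_self (fun y => f y * Qk ρ (a - y)) volume a]
  simp_rw [sub_sub_cancel]
  have h := Measure.integral_comp_smul (volume : Measure (Rn n)) (fun v => f (a - v) * Qk ρ v) ρ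
  simp_rw [Qk_scale hρ] at h
  rw [finrank_euclideanSpace, Fintype.card_fin, abs_of_nonneg (by positivity)] at h
  have e : ∀ u : Rn n, f (a - ρ • u) * ((ρ^n)⁻¹ * Qk 1 u) = (ρ^n)⁻¹ * (f (a - ρ • u) * Qk 1 u) := fun u => by ring
  simp_rw [e] at h
  rw [integral_const_mul, smul_eq_mul] at h
  exact (mul_left_cancel₀ (by positivity) h).symm

lemma conv_Mk {n : ℕ} (hn : 0 < n) {δ t D : ℝ} (hδ : 0 < δ) (ht : 0 < t) {f : Rn n → ℝ} (hf : Continuous f) (hD : ∀ x, |f x| ≤ D) (x : Rn n) :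
    ∫ y, f y * Mk δ t (x - y) = ∫ ω, (∫ u, f (x - t • ω - (δ * t) • u) * Qk 1 u) ∂(unitSphereMeasure n) := by
  have hρ : 0 < δ * t := by positivity
  have hQ := (int_Qk hn hρ).1
  have hi : Integrable (Function.uncurry fun (ω y : Rn n) => f y * Qk (δ * t) (x - y - t • ω)) ((unitSphereMeasure n).prod volume) := by
    have hm : Measurable (Function.uncurry fun (ω y : Rn n) => f y * Qk (δ * t) (x - y - t • ω)) :=
      (hf.measurable.comp measurable_snd).mul (meas_Qk measurable_const (by fun_prop))
    refine ⟨hm.aestronglyMeasurable, ?_⟩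
    rw [HasFiniteIntegral, lintegral_prod _ hm.enorm.aemeasurable]
    have hb : ∀ ω : Rn n, ∫⁻ y, ‖f y * Qk (δ * t) (x - y - t • ω)‖ₑ ≤ ofReal D * ∫⁻ y : Rn n, ‖Qk (δ * t) y‖ₑ := by
      intro ω
      rw [← lintegral_sub_left_eq_self (fun y : Rn n => ‖Qk (δ * t) y‖ₑ) (x - t • ω), ← lintegral_const_mul' _ _ ENNReal.ofReal_ne_top]
      refine lintegral_mono fun y => ?_
      simp only
      rw [enorm_mul, sub_right_comm]
      refine mul_le_mul' ?_ le_rfl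
      rw [Real.enorm_eq_ofReal_abs]; exact ENNReal.ofReal_le_ofReal (hD y)
    refine (lintegral_mono hb).trans_lt ?_
    rw [lintegral_const]
    exact ENNReal.mul_lt_top (ENNReal.mul_lt_top ENNReal.ofReal_lt_top hQ.2) (measure_lt_top _ _)
  calc _ = ∫ y, ∫ ω, f y * Qk (δ * t) (x - y - t • ω) ∂(unitSphereMeasure n) := by
        congr 1 with y
        rw [integral_const_mul]; rfl
    _ = ∫ ω, (∫ y, f y * Qk (δ * t) (x - y - t • ω)) ∂(unitSphereMeasure n) := (integral_integral_swap hi).symm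
    _ = _ := by
        congr 1 with ω
        rw [← conv_Qk hρ]
        congr 1 with y
        rw [sub_right_comm]

lemma Mk_tendsto {n : ℕ} (hn : 0 < n) {t D : ℝ} (ht : 0 < t) {d : ℕ → ℝ} (hd0 : ∀ j, 0 < d j) (hd : Tendsto d atTop (𝓝 0))
    {f : Rn n → ℝ} (hf : Continuous f) (hD : ∀ x, |f x| ≤ D) (x : Rn n) :
    Tendsto (fun j => ∫ y, f y * Mk (d j) t (x - y)) atTop (𝓝 (∫ ω, f (x - t • ω) ∂(unitSphereMeasure n))) := by
  simp_rw [conv_Mk hn (hd0 _) ht hf hD]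
  have hQ := int_Qk (n := n) hn one_pos
  have hin : ∀ ω : Rn n, ∀ s : ℝ, ‖∫ u, f (x - t • ω - s • u) * Qk 1 u‖ ≤ D * ∫ u : Rn n, ‖Qk 1 u‖ := by
    intro ω s
    rw [← integral_const_mul]
    refine norm_integral_le_of_norm_le (hQ.1.norm.const_mul D) (ae_of_all _ fun u => ?_)
    rw [norm_mul]
    exact mul_le_mul_of_nonneg_right (hD _) (norm_nonneg _)
  refine tendsto_integral_of_dominated_convergence (fun _ => D * ∫ u : Rn n, ‖Qk 1 u‖) ?_ (integrable_const _) (fun j => ae_of_all _ fun ω => hin ω _) (ae_of_all _ fun ω => ?_)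
  · intro j
    have : Measurable (Function.uncurry fun (ω u : Rn n) => f (x - t • ω - (d j * t) • u) * Qk 1 u) :=
      (hf.measurable.comp (by fun_prop)).mul (meas_Qk measurable_const (by fun_prop))
    exact this.stronglyMeasurable.integral_prod_right.aestronglyMeasurable
  · have e : f (x - t • ω) = ∫ u : Rn n, f (x - t • ω) * Qk 1 u := by rw [integral_const_mul, hQ.2, mul_one]
    rw [e]
    refine tendsto_integral_of_dominated_convergence (fun u => D * ‖Qk 1 u‖) (fun j => ?_) (hQ.1.norm.const_mul D) (fun j => ae_of_all _ fun u => ?_) (ae_of_all _ fun u => ?_)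
    · have : Measurable fun u : Rn n => f (x - t • ω - (d j * t) • u) * Qk 1 u :=
        (hf.measurable.comp (by fun_prop)).mul (meas_Qk measurable_const (by fun_prop))
      exact this.aestronglyMeasurable
    · rw [norm_mul]
      exact mul_le_mul_of_nonneg_right (hD _) (norm_nonneg _)
    · refine Tendsto.mul_const _ ?_
      have hc : Continuous fun s : ℝ => f (x - t • ω - (s * t) • u) := by fun_prop
      have := (hc.tendsto 0).comp hd
      simpa [Function.comp_def] using this

lemma int_Mk {n : ℕ} (hn : 0 < n) {δ t : ℝ} (hδ : 0 < δ) (hδ1 : n * δ ≤ 1) (ht : 0 < t) : Integrable fun z : Rn n => Mk δ t z := by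
  have hmx : mx (fun _ : Rn n => (1:ℝ≥0∞)) 0 ≤ 1 := by
    refine iSup₂_le fun r hr => ?_
    rw [setLIntegral_const, one_mul, ENNReal.inv_mul_cancel (vol_ball_pos _ hr) (vol_ball_top _ r)]
  refine ⟨(meas_Mk δ measurable_const measurable_id).aestronglyMeasurable, ?_⟩
  obtain ⟨C', hC', h'⟩ := MK_mx hn
  have := (h' δ hδ hδ1 t ht (fun _ => 1) measurable_const 0).1
  simp_rw [one_mul, zero_sub] at this
  rw [HasFiniteIntegral, ← lintegral_neg_eq_self]
  exact this.trans_lt (ENNReal.mul_lt_top ENNReal.ofReal_lt_top (hmx.trans_lt ENNReal.one_lt_top))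

lemma sph_tele {n : ℕ} (hn : 0 < n) {δ t D : ℝ} (hδ : 0 < δ) (hδ1 : n * δ ≤ 1) (ht : 0 < t) 
    {f : Rn n → ℝ} (hf : Continuous f) (hD : ∀ x, |f x| ≤ D) (x : Rn n) :
    ‖∫ ω, f (x - t • ω) ∂(unitSphereMeasure n)‖ₑ ≤ ‖∫ y, f y * Mk δ t (x - y)‖ₑ + ∑' j : ℕ, ‖∫ y, f y * kern (δ/2^j) t (x - y)‖ₑ := by
  have hd0 : ∀ j : ℕ, 0 < δ/2^j := fun j => by positivity
  have hd1 : ∀ j : ℕ, n * (δ/2^j) ≤ 1 := fun j => by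
    refine le_trans ?_ hδ1
    refine mul_le_mul_of_nonneg_left (div_le_self hδ.le (one_le_pow₀ (by norm_num))) (by positivity)
  have hd : Tendsto (fun j : ℕ => δ/2^j) atTop (𝓝 0) := by
    have := (tendsto_pow_atTop_nhds_zero_of_lt_one (r := (1/2:ℝ)) (by norm_num) (by norm_num)).const_mul δ
    rw [mul_zero] at this
    refine this.congr fun j => ?_
    rw [one_div, inv_pow]; rfl
  have hI : ∀ j : ℕ, Integrable fun y => f y * Mk (δ/2^j) t (x - y) := fun j =>
    ((int_Mk hn (hd0 j) (hd1 j) ht).comp_sub_left x).bdd_mul hf.aestronglyMeasurable (ae_of_all _ hD)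
  have hJ : ∀ J : ℕ, ‖∫ y, f y * Mk (δ/2^J) t (x - y)‖ₑ ≤ ‖∫ y, f y * Mk δ t (x - y)‖ₑ + ∑ j ∈ Finset.range J, ‖∫ y, f y * kern (δ/2^j) t (x - y)‖ₑ := by
    intro J
    induction J with
    | zero => simp
    | succ J ih =>
      rw [Finset.sum_range_succ, ← add_assoc]
      refine le_trans ?_ (add_le_add ih le_rfl)
      refine le_trans (le_of_eq ?_) (enorm_add_le _ _)
      congr 1
      have e : ∀ y, f y * kern (δ/2^J) t (x - y) = f y * Mk (δ/2^(J+1)) t (x - y) - f y * Mk (δ/2^J) t (x - y) := fun y => by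
        rw [kern_Mk hn (hd0 J) (hd1 J) ht, div_div, ← pow_succ]; ring
      simp_rw [e]
      rw [integral_sub (hI _) (hI _)]; ring
  have := (Mk_tendsto hn ht hd0 hd hf hD x).enorm
  refine le_of_tendsto this (Eventually.of_forall fun J => (hJ J).trans ?_)
  exact add_le_add le_rfl (ENNReal.sum_le_tsum _)

lemma exp_bd {A a b : ℝ} (ha : |a| ≤ A) (hb : |b| ≤ A) (z : ℂ) : ‖Complex.exp (b + z * a)‖ ≤ exp (A + |z.re| * A) := by
  rw [Complex.norm_exp]
  apply Real.exp_le_exp.2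
  simp only [Complex.add_re, Complex.ofReal_re, Complex.mul_re, Complex.ofReal_im, mul_zero, sub_zero]
  have h1 := le_abs_self (z.re * a)
  rw [abs_mul] at h1
  have h2 := mul_le_mul_of_nonneg_left ha (abs_nonneg z.re)
  linarith [le_abs_self b]

lemma three_lines {X : Type*} [MeasurableSpace X] {μ : Measure X} [IsFiniteMeasure μ] {M : X → ℂ} {α β : X → ℝ} {K A B0 B1 θ : ℝ}
    (hM : Measurable M) (hα : Measurable α) (hβ : Measurable β) (hMK : ∀ x, ‖M x‖ ≤ K) (hαA : ∀ x, |α x| ≤ A) (hβA : ∀ x, |β x| ≤ A)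
    (hθ0 : 0 ≤ θ) (hθ1 : θ ≤ 1)
    (h0 : ∀ z : ℂ, z.re = 0 → ‖∫ x, M x * Complex.exp (β x + z * α x) ∂μ‖ ≤ B0)
    (h1 : ∀ z : ℂ, z.re = 1 → ‖∫ x, M x * Complex.exp (β x + z * α x) ∂μ‖ ≤ B1) :
    ‖∫ x, M x * Complex.exp (β x + (θ : ℂ) * α x) ∂μ‖ ≤ B0 ^ (1 - θ) * B1 ^ θ := by
  rcases isEmpty_or_nonempty X with hX | ⟨⟨x0⟩⟩
  · have e0 : ∀ f : X → ℂ, ∫ x, f x ∂μ = 0 := fun f => by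
      rw [Measure.eq_zero_of_isEmpty μ, integral_zero_measure]
    simp_rw [e0, norm_zero] at h0 h1 ⊢
    have := h0 0 rfl
    have := h1 1 rfl
    positivity
  have hK : 0 ≤ K := (norm_nonneg _).trans (hMK x0)
  have hA : 0 ≤ A := (abs_nonneg _).trans (hαA x0)
  have hm : ∀ z : ℂ, Measurable fun x => M x * Complex.exp (β x + z * α x) := fun z => by fun_prop
  have hb : ∀ z : ℂ, ∀ x, ‖M x * Complex.exp (β x + z * α x)‖ ≤ K * exp (A + |z.re| * A) := fun z x => by
    rw [norm_mul]
    exact mul_le_mul (hMK x) (exp_bd (hαA x) (hβA x) z) (norm_nonneg _) hK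
  have hi : ∀ z : ℂ, Integrable (fun x => M x * Complex.exp (β x + z * α x)) μ := fun z =>
    Integrable.of_bound (hm z).aestronglyMeasurable _ (ae_of_all _ (hb z))
  have hd : Differentiable ℂ fun z : ℂ => ∫ x, M x * Complex.exp (β x + z * α x) ∂μ := by
    intro z0
    refine (hasDerivAt_integral_of_dominated_loc_of_deriv_le (s := ball z0 1) (F' := fun z x => M x * (Complex.exp (β x + z * α x) * α x))
      (bound := fun _ => K * (exp (A + (‖z0‖ + 1) * A) * A)) (ball_mem_nhds _ one_pos) (Eventually.of_forall fun z => (hm z).aestronglyMeasurable) (hi z0) ?_ ?_ (integrable_const _) ?_).2.differentiableAt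
    · have : Measurable fun x => M x * (Complex.exp (β x + z0 * α x) * α x) := by fun_prop
      exact this.aestronglyMeasurable
    · refine ae_of_all _ fun x z hz => ?_
      rw [norm_mul, norm_mul]
      have hz1 : |z.re| ≤ ‖z0‖ + 1 := by
        have := norm_sub_norm_le z z0
        have h2 : ‖z - z0‖ < 1 := by rwa [mem_ball_iff_norm] at hz
        linarith [Complex.abs_re_le_norm z]
      refine mul_le_mul (hMK x) (mul_le_mul ((exp_bd (hαA x) (hβA x) z).trans (Real.exp_le_exp.2 ?_)) ?_ (norm_nonneg _) (Real.exp_pos _).le) (by positivity) hK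
      · nlinarith
      · rw [Complex.norm_real]; exact hαA x
    · refine ae_of_all _ fun x z _ => ?_
      have h2 : HasDerivAt (fun z : ℂ => (β x : ℂ) + z * α x) (α x) z := by
        simpa using ((hasDerivAt_id z).mul_const (α x : ℂ)).const_add (β x : ℂ)
      exact h2.cexp.const_mul (M x)
  have := Complex.HadamardThreeLines.norm_le_interp_of_mem_verticalClosedStrip₀₁' (fun z : ℂ => ∫ x, M x * Complex.exp (β x + z * α x) ∂μ)
    (z := (θ : ℂ)) (a := B0) (b := B1) (by simp [Complex.HadamardThreeLines.verticalClosedStrip, hθ0, hθ1]) hd.diffContOnCl ?_ (fun z hz => h0 z hz) (fun z hz => h1 z hz)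
  · simpa using this
  · refine ⟨K * exp (A + 1 * A) * μ.real Set.univ, ?_⟩
    rintro _ ⟨z, hz, rfl⟩
    refine norm_integral_le_of_norm_le_const (ae_of_all _ fun x => (hb z x).trans ?_)
    refine mul_le_mul_of_nonneg_left (Real.exp_le_exp.2 ?_) hK
    have : |z.re| ≤ 1 := abs_le.2 ⟨by linarith [hz.1], hz.2⟩
    nlinarith

/-- the analytic family -/
def cz {n : ℕ} (u v h : Rn n → ℝ) (z : ℂ) (y : Rn n) : ℂ :=
  if h y = 0 then 0 else Complex.exp (((2 * u y)⁻¹ * Real.log (h y) : ℝ) + z * ((v y - 1/2) * (u y)⁻¹ * Real.log (h y) : ℝ))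

lemma meas_cz {n : ℕ} {u v h : Rn n → ℝ} (hu : Measurable u) (hv : Measurable v) (hh : Measurable h) (z : ℂ) : Measurable (cz u v h z) := by
  unfold cz
  refine Measurable.ite (hh (measurableSet_singleton 0)) measurable_const ?_
  fun_prop

lemma cz_theta {n : ℕ} {u v h : Rn n → ℝ} {θ : ℝ} (hu : ∀ x, 0 < u x) (huv : ∀ x, u x = (1-θ)/2 + θ * v x) (hh : ∀ x, 0 ≤ h x) (y : Rn n) :
    cz u v h (θ:ℂ) y = (h y : ℂ) := by
  unfold cz
  split_ifs with h0
  · rw [h0]; simp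
  · rw [← Complex.ofReal_mul, ← Complex.ofReal_add, ← Complex.ofReal_exp]
    congr 1
    have : (2 * u y)⁻¹ * Real.log (h y) + θ * ((v y - 1/2) * (u y)⁻¹ * Real.log (h y)) = (u y)⁻¹ * Real.log (h y) * ((1-θ)/2 + θ * v y) := by
      rw [mul_inv]; ring
    rw [this, ← huv, mul_comm (u y)⁻¹, mul_assoc, inv_mul_cancel₀ (hu y).ne', mul_one, Real.exp_log ((hh y).lt_of_ne' h0)]

lemma cz_norm {n : ℕ} {u v h : Rn n → ℝ} (hh : ∀ x, 0 ≤ h x) (z : ℂ) {y : Rn n} (h0 : h y ≠ 0) :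
    ‖cz u v h z y‖ = h y ^ ((2 * u y)⁻¹ + z.re * ((v y - 1/2) * (u y)⁻¹)) := by
  unfold cz
  rw [if_neg h0, Complex.norm_exp, Real.rpow_def_of_pos ((hh y).lt_of_ne' h0)]
  congr 1
  simp only [Complex.add_re, Complex.ofReal_re, Complex.mul_re, Complex.ofReal_im, mul_zero, sub_zero]
  ring

lemma cz_zero {n : ℕ} {u v h : Rn n → ℝ} (hh : ∀ x, 0 ≤ h x) (hu : ∀ x, 0 < u x) {z : ℂ} (hz : z.re = 0) (y : Rn n) :
    ‖cz u v h z y‖ₑ ^ (2:ℝ) = ofReal (h y) ^ (u y)⁻¹ := by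
  by_cases h0 : h y = 0
  · simp [cz, h0, hu y]
  · rw [← ofReal_norm, cz_norm hh z h0, hz, zero_mul, add_zero, ← ENNReal.ofReal_rpow_of_pos ((hh y).lt_of_ne' h0), ← ENNReal.rpow_mul]
    congr 1
    rw [mul_inv]; ring

lemma cz_one {n : ℕ} {u v h : Rn n → ℝ} (hh : ∀ x, 0 ≤ h x) (hu : ∀ x, 0 < u x) (hv : ∀ x, 0 < v x) {z : ℂ} (hz : z.re = 1) (y : Rn n) :
    ‖cz u v h z y‖ₑ ^ (v y)⁻¹ = ofReal (h y) ^ (u y)⁻¹ := by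
  by_cases h0 : h y = 0
  · simp [cz, h0, hu y, hv y]
  · rw [← ofReal_norm, cz_norm hh z h0, hz, one_mul, ← ENNReal.ofReal_rpow_of_pos ((hh y).lt_of_ne' h0), ← ENNReal.rpow_mul]
    congr 1
    rw [mul_inv]; have := (hv y).ne'; field_simp; ring

/-- bilinear bound hypothesis -/
def BB {n : ℕ} (K : Rn n → Rn n → ℝ) (P Q : Rn n → ℝ) (B : ℝ) : Prop :=
  ∀ f : Rn n → ℂ, Measurable f → (∃ D, ∀ x, ‖f x‖ ≤ D) → (∃ R, ∀ x, R < ‖x‖ → f x = 0) → ∀ g : Rn n → ℝ≥0∞, Measurable g →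
    ∫⁻ x, ‖f x‖ₑ ^ P x ≤ 1 → ∫⁻ x, g x ^ Q x ≤ 1 → ∫⁻ x, ‖∫ y, f y * (K x y : ℂ)‖ₑ * g x ≤ ofReal B

lemma supp_fin {n : ℕ} {f : Rn n → ℝ} {R : ℝ} (hR : ∀ x, R < ‖x‖ → f x = 0) : volume {x | f x ≠ 0} < ∞ := by
  refine (measure_mono (t := closedBall 0 R) fun x hx => ?_).trans_lt measure_closedBall_lt_top
  rw [mem_closedBall_zero_iff]
  by_contra h
  exact hx (hR x (not_le.1 h))

lemma cz_set {n : ℕ} {u v f : Rn n → ℝ} (hf : Measurable f) (z : ℂ) (F : Rn n → ℂ) :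
    ∫ y in {y | f y ≠ 0}, Complex.exp (((2 * u y)⁻¹ * Real.log (f y) : ℝ) + z * ((v y - 1/2) * (u y)⁻¹ * Real.log (f y) : ℝ)) * F y = ∫ y, cz u v f z y * F y := by
  have hm : MeasurableSet {y | f y ≠ 0} := (hf (measurableSet_singleton 0)).compl
  rw [← integral_indicator hm]
  congr 1 with y
  by_cases h0 : f y = 0
  · simp [cz, h0]
  · simp [cz, h0]

lemma coef_bd {c ε D u v h : ℝ} (hε : 0 < ε) (hc : 0 < c) (hu : c ≤ u) (hv0 : 0 ≤ v) (hv1 : v ≤ 1) (hh : h = 0 ∨ (ε ≤ h ∧ h ≤ D)) :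
    |(2 * u)⁻¹ * Real.log h| ≤ c⁻¹ * (|Real.log ε| + |Real.log D|) ∧ |(v - 1/2) * u⁻¹ * Real.log h| ≤ c⁻¹ * (|Real.log ε| + |Real.log D|) := by
  have hl : |Real.log h| ≤ |Real.log ε| + |Real.log D| := by
    rcases hh with h0 | ⟨h1, h2⟩
    · rw [h0, Real.log_zero, abs_zero]; positivity
    · have a1 := Real.log_le_log hε h1
      have a2 := Real.log_le_log (hε.trans_le h1) h2
      rw [abs_le]
      constructor
      · linarith [neg_abs_le (Real.log ε), abs_nonneg (Real.log D)]
      · linarith [le_abs_self (Real.log D), abs_nonneg (Real.log ε)]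
  have hu0 : 0 < u := hc.trans_le hu
  have hi : u⁻¹ ≤ c⁻¹ := inv_anti₀ hc hu
  have hi0 : 0 < u⁻¹ := by positivity
  constructor
  · rw [abs_mul]
    refine mul_le_mul ?_ hl (abs_nonneg _) (by positivity)
    rw [mul_inv, abs_of_pos (by positivity)]; linarith
  · rw [abs_mul]
    refine mul_le_mul ?_ hl (abs_nonneg _) (by positivity)
    rw [abs_mul, abs_of_pos hi0]
    have : |v - 1/2| ≤ 1 := abs_le.2 ⟨by linarith, by linarith⟩
    nlinarith

lemma interp1 {n : ℕ} {K : Rn n → Rn n → ℝ} {u v : Rn n → ℝ} {θ c Kb B0 B1 : ℝ} (hK : Measurable (Function.uncurry K)) (hKb : ∀ x y, |K x y| ≤ Kb)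
    (hu : Measurable u) (hv : Measurable v) (hc : 0 < c) (hvc : ∀ x, c ≤ v x) (hvc' : ∀ x, v x ≤ 1 - c) (hθ0 : 0 ≤ θ) (hθ1 : θ ≤ 1)
    (huv : ∀ x, u x = (1-θ)/2 + θ * v x) (hB0 : 0 ≤ B0) (hB1 : 0 ≤ B1)
    (H0 : BB K (fun _ => 2) (fun _ => 2) B0) (H1 : BB K (fun x => (v x)⁻¹) (fun x => (1 - v x)⁻¹) B1)
    {f g : Rn n → ℝ} {ε D R : ℝ} (hε : 0 < ε) (hf : Measurable f) (hg : Measurable g) (hfv : ∀ x, f x = 0 ∨ (ε ≤ f x ∧ f x ≤ D)) (hgv : ∀ x, g x = 0 ∨ (ε ≤ g x ∧ g x ≤ D))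
    (hfR : ∀ x, R < ‖x‖ → f x = 0) (hgR : ∀ x, R < ‖x‖ → g x = 0)
    (hf1 : ∫⁻ x, ofReal (f x) ^ (u x)⁻¹ ≤ 1) (hg1 : ∫⁻ x, ofReal (g x) ^ (1 - u x)⁻¹ ≤ 1) :
    ∫⁻ x, ‖∫ y, f y * K x y‖ₑ * ofReal (g x) ≤ ofReal (B0 ^ (1-θ) * B1 ^ θ) := by
  have huc : ∀ x, c ≤ u x ∧ c ≤ 1 - u x := fun x => by
    have a := hvc x; have b := hvc' x
    rw [huv]
    constructor <;> nlinarith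
  have hu0 : ∀ x, 0 < u x := fun x => hc.trans_le (huc x).1
  have hu0' : ∀ x, 0 < 1 - u x := fun x => hc.trans_le (huc x).2
  have hv0 : ∀ x, 0 < v x := fun x => hc.trans_le (hvc x)
  have hv0' : ∀ x, 0 < 1 - v x := fun x => by linarith [hvc' x]
  have hf0 : ∀ x, 0 ≤ f x := fun x => by rcases hfv x with h | h <;> linarith [h]
  have hg0 : ∀ x, 0 ≤ g x := fun x => by rcases hgv x with h | h <;> linarith [h]
  set u' : Rn n → ℝ := fun x => 1 - u x
  set v' : Rn n → ℝ := fun x => 1 - v x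
  have hu'm : Measurable u' := hu.const_sub 1
  have hv'm : Measurable v' := hv.const_sub 1
  set I : Rn n → ℝ := fun x => ∫ y, f y * K x y with hI
  have hIm : Measurable I := ((hf.comp measurable_snd).mul hK).stronglyMeasurable.integral_prod_right.measurable
  set s : Rn n → ℝ := fun x => if 0 ≤ I x then 1 else -1 with hs
  have hsm : Measurable s := Measurable.ite (measurableSet_le measurable_const hIm) measurable_const measurable_const
  have hs1 : ∀ x, |s x| ≤ 1 := fun x => by simp only [hs]; split_ifs <;> simp
  have hsI : ∀ x, s x * I x = |I x| := fun x => by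
    simp only [hs]; split_ifs with h
    · rw [abs_of_nonneg h, one_mul]
    · rw [abs_of_neg (not_le.1 h)]; ring
  have hKb0 : 0 ≤ Kb := (abs_nonneg _).trans (hKb 0 0)
  have : IsFiniteMeasure (volume.restrict {x | g x ≠ 0}) := ⟨by rw [Measure.restrict_apply_univ]; exact supp_fin hgR⟩
  have : IsFiniteMeasure (volume.restrict {x | f x ≠ 0}) := ⟨by rw [Measure.restrict_apply_univ]; exact supp_fin hfR⟩
  set M : Rn n × Rn n → ℂ := fun p => (s p.1 : ℂ) * (K p.1 p.2 : ℂ) with hM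
  have hMm : Measurable M := (Complex.measurable_ofReal.comp (hsm.comp measurable_fst)).mul (Complex.measurable_ofReal.comp hK)
  have hMb : ∀ p, ‖M p‖ ≤ Kb := fun p => by
    rw [hM, norm_mul, Complex.norm_real, Complex.norm_real]
    calc _ ≤ 1 * Kb := mul_le_mul (hs1 _) (hKb _ _) (abs_nonneg _) zero_le_one
      _ = Kb := one_mul _
  set α : Rn n × Rn n → ℝ := fun p => (v' p.1 - 1/2) * (u' p.1)⁻¹ * Real.log (g p.1) + (v p.2 - 1/2) * (u p.2)⁻¹ * Real.log (f p.2) with hα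
  set β : Rn n × Rn n → ℝ := fun p => (2 * u' p.1)⁻¹ * Real.log (g p.1) + (2 * u p.2)⁻¹ * Real.log (f p.2) with hβ
  have hαm : Measurable α := by fun_prop
  have hβm : Measurable β := by fun_prop
  set L := c⁻¹ * (|Real.log ε| + |Real.log D|)
  have hbg : ∀ x, _ := fun x => coef_bd hε hc (huc x).2 (hv0' x).le (by linarith [hv0 x]) (hgv x)
  have hbf : ∀ x, _ := fun x => coef_bd hε hc (huc x).1 (hv0 x).le (by linarith [hv0' x]) (hfv x)
  have hαb : ∀ p, |α p| ≤ L + L := fun p => (abs_add_le _ _).trans (add_le_add (hbg p.1).2 (hbf p.2).2)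
  have hβb : ∀ p, |β p| ≤ L + L := fun p => (abs_add_le _ _).trans (add_le_add (hbg p.1).1 (hbf p.2).1)
  set ν := (volume.restrict {x | g x ≠ 0}).prod (volume.restrict {x | f x ≠ 0}) with hν
  have hG : ∀ z : ℂ, ∫ p, M p * Complex.exp (β p + z * α p) ∂ν = ∫ x, cz u' v' g z x * ((s x : ℂ) * ∫ y, cz u v f z y * (K x y : ℂ)) := by
    intro z
    have hi : Integrable (fun p => M p * Complex.exp (β p + z * α p)) ν := by
      refine Integrable.of_bound (C := Kb * exp ((L+L) + |z.re| * (L+L))) ?_ (ae_of_all _ fun p => ?_)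
      · have : Measurable fun p => M p * Complex.exp (β p + z * α p) := by fun_prop
        exact this.aestronglyMeasurable
      · rw [norm_mul]
        exact mul_le_mul (hMb p) (exp_bd (hαb p) (hβb p) z) (norm_nonneg _) hKb0
    rw [hν, integral_prod _ hi, ← cz_set hg]
    congr 1 with x
    rw [← cz_set hf, ← integral_const_mul, ← integral_const_mul]
    congr 1 with y
    simp only [hM, hα, hβ]
    push_cast
    have e : ∀ a b c d : ℂ, a + b + z * (c + d) = (a + z * c) + (b + z * d) := fun a b c d => by ring
    rw [e, Complex.exp_add]
    ring
  have hfd : ∀ z : ℂ, ∃ D, ∀ x, ‖cz u v f z x‖ ≤ D := fun z => ⟨exp (L + |z.re| * L), fun x => by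
    unfold cz
    split_ifs
    · rw [norm_zero]; positivity
    · exact exp_bd (hbf x).2 (hbf x).1 z⟩
  have hfr : ∀ z : ℂ, ∃ R, ∀ x, R < ‖x‖ → cz u v f z x = 0 := fun z => ⟨R, fun x hx => by unfold cz; rw [if_pos (hfR x hx)]⟩
  have hGb : ∀ z : ℂ, ∀ B : ℝ, 0 ≤ B → ∫⁻ x, ‖∫ y, cz u v f z y * (K x y : ℂ)‖ₑ * ‖cz u' v' g z x‖ₑ ≤ ofReal B →
      ‖∫ p, M p * Complex.exp (β p + z * α p) ∂ν‖ ≤ B := by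
    intro z B hB h
    rw [hG]
    refine (ENNReal.ofReal_le_ofReal_iff hB).1 ?_
    rw [ofReal_norm]
    refine ((enorm_integral_le_lintegral_enorm _).trans (lintegral_mono fun x => ?_)).trans h
    simp only
    rw [enorm_mul, enorm_mul, mul_comm]
    refine mul_le_mul' ?_ le_rfl
    refine (mul_le_mul' (b := 1) ?_ le_rfl).trans (one_mul _).le
    rw [← ofReal_norm, Complex.norm_real, ← ENNReal.ofReal_one]
    exact ENNReal.ofReal_le_ofReal (hs1 x)
  have key := three_lines (μ := ν) hMm hαm hβm hMb hαb hβb hθ0 hθ1 (B0 := B0) (B1 := B1) ?_ ?_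
  · rw [hG] at key
    have e1 : ∀ y, cz u v f θ y = (f y : ℂ) := cz_theta hu0 huv hf0
    have e2 : ∀ y, cz u' v' g θ y = (g y : ℂ) := cz_theta hu0' (fun x => by simp only [u', v', huv]; ring) hg0
    simp_rw [e1, e2, ← Complex.ofReal_mul, integral_complex_ofReal, ← Complex.ofReal_mul, integral_complex_ofReal, Complex.norm_real] at key
    change ‖∫ x, g x * (s x * I x)‖ ≤ _ at key
    simp_rw [hsI] at key
    have hIb : ∀ x, |I x| ≤ D * Kb * volume.real {x | f x ≠ 0} := by
      intro x
      have : I x = ∫ y in {y | f y ≠ 0}, f y * K x y := by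
        have hm : MeasurableSet {y | f y ≠ 0} := (hf (measurableSet_singleton 0)).compl
        rw [hI, ← integral_indicator hm]
        simp only
        congr 1 with y
        by_cases h0 : f y = 0 <;> simp [h0, Set.indicator]
      rw [this, ← Real.norm_eq_abs]
      refine norm_setIntegral_le_of_norm_le_const (supp_fin hfR) fun y hy => ?_
      have hy' := (hfv y).resolve_left hy
      rw [norm_mul, Real.norm_of_nonneg (hf0 y)]
      exact mul_le_mul hy'.2 (hKb _ _) (norm_nonneg _) ((hf0 y).trans hy'.2)
    have hint : Integrable fun x => g x * |I x| := by
      have : IntegrableOn (fun x => g x * |I x|) {x | g x ≠ 0} := by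
        refine Integrable.of_bound (C := |D| * (D * Kb * volume.real {x | f x ≠ 0})) (hg.mul hIm.abs).aestronglyMeasurable (ae_of_all _ fun x => ?_)
        rw [norm_mul, Real.norm_of_nonneg (hg0 x), Real.norm_of_nonneg (abs_nonneg _)]
        refine mul_le_mul ?_ (hIb x) (abs_nonneg _) (abs_nonneg _)
        rcases hgv x with h | h
        · rw [h]; exact abs_nonneg _
        · exact h.2.trans (le_abs_self _)
      refine (integrableOn_iff_integrable_of_support_subset ?_).1 this
      intro x hx hg
      apply hx; simp [hg]
    have h0 : 0 ≤ᵐ[volume] fun x => g x * |I x| := ae_of_all _ fun x => mul_nonneg (hg0 x) (abs_nonneg _)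
    calc _ = ∫⁻ x, ofReal (g x * |I x|) := by
          congr 1 with x
          rw [Real.enorm_eq_ofReal_abs, mul_comm, ENNReal.ofReal_mul (hg0 x)]
      _ = ofReal (∫ x, g x * |I x|) := (ofReal_integral_eq_lintegral_ofReal hint h0).symm
      _ ≤ _ := ENNReal.ofReal_le_ofReal ((le_abs_self _).trans key)
  · intro z hz
    refine hGb z B0 hB0 (H0 _ (meas_cz hu hv hf z) (hfd z) (hfr z) _ (meas_cz hu'm hv'm hg z).enorm ?_ ?_)
    · simp_rw [cz_zero hf0 hu0 hz]; exact hf1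
    · exact (lintegral_congr fun y => cz_zero (u := u') (v := v') hg0 hu0' hz y).le.trans hg1
  · intro z hz
    refine hGb z B1 hB1 (H1 _ (meas_cz hu hv hf z) (hfd z) (hfr z) _ (meas_cz hu'm hv'm hg z).enorm ?_ ?_)
    · exact (lintegral_congr fun y => cz_one hf0 hu0 hv0 hz y).le.trans hf1
    · exact (lintegral_congr fun y => cz_one (u := u') (v := v') hg0 hu0' hv0' hz y).le.trans hg1

lemma trunc_aux {f D : ℝ} (m : ℕ) (hD : f ≤ D) : (if (1:ℝ)/(m+1) ≤ f then f else 0) = 0 ∨ ((1:ℝ)/(m+1) ≤ (if (1:ℝ)/(m+1) ≤ f then f else 0) ∧ (if (1:ℝ)/(m+1) ≤ f then f else 0) ≤ D) := by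
  split_ifs with h
  · exact Or.inr ⟨h, hD⟩
  · exact Or.inl rfl

lemma trunc_le {f : ℝ} (m : ℕ) (h0 : 0 ≤ f) : (if (1:ℝ)/(m+1) ≤ f then f else 0) ≤ f := by
  split_ifs <;> simp [h0]

lemma trunc_ev {f : ℝ} (h0 : 0 ≤ f) : ∀ᶠ m : ℕ in atTop, (if (1:ℝ)/(m+1) ≤ f then f else 0) = f := by
  rcases h0.eq_or_lt with h | h
  · refine Eventually.of_forall fun m => ?_
    rw [← h]; simp
  · filter_upwards [(tendsto_one_div_add_atTop_nhds_zero_nat (𝕜 := ℝ)).eventually_le_const h] with m hm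
    rw [if_pos hm]

lemma interp {n : ℕ} {K : Rn n → Rn n → ℝ} {u v : Rn n → ℝ} {θ c Kb B0 B1 : ℝ} (hK : Measurable (Function.uncurry K)) (hKb : ∀ x y, |K x y| ≤ Kb)
    (hu : Measurable u) (hv : Measurable v) (hc : 0 < c) (hvc : ∀ x, c ≤ v x) (hvc' : ∀ x, v x ≤ 1 - c) (hθ0 : 0 ≤ θ) (hθ1 : θ ≤ 1)
    (huv : ∀ x, u x = (1-θ)/2 + θ * v x) (hB0 : 0 ≤ B0) (hB1 : 0 ≤ B1)
    (H0 : BB K (fun _ => 2) (fun _ => 2) B0) (H1 : BB K (fun x => (v x)⁻¹) (fun x => (1 - v x)⁻¹) B1)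
    {f g : Rn n → ℝ} {D R : ℝ} (hf : Measurable f) (hg : Measurable g) (hf0 : ∀ x, 0 ≤ f x) (hg0 : ∀ x, 0 ≤ g x) (hfD : ∀ x, f x ≤ D) (hgD : ∀ x, g x ≤ D)
    (hfR : ∀ x, R < ‖x‖ → f x = 0) (hgR : ∀ x, R < ‖x‖ → g x = 0)
    (hf1 : ∫⁻ x, ofReal (f x) ^ (u x)⁻¹ ≤ 1) (hg1 : ∫⁻ x, ofReal (g x) ^ (1 - u x)⁻¹ ≤ 1) :
    ∫⁻ x, ‖∫ y, f y * K x y‖ₑ * ofReal (g x) ≤ ofReal (B0 ^ (1-θ) * B1 ^ θ) := by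
  have huc : ∀ x, c ≤ u x ∧ c ≤ 1 - u x := fun x => by
    have a := hvc x; have b := hvc' x
    rw [huv]
    constructor <;> nlinarith
  set tr : ℕ → (Rn n → ℝ) → Rn n → ℝ := fun m f x => if (1:ℝ)/(m+1) ≤ f x then f x else 0 with htr
  have htm : ∀ m f, Measurable f → Measurable (tr m f) := fun m f hf => Measurable.ite (measurableSet_le measurable_const hf) hf measurable_const
  have hb : ∀ m, ∫⁻ x, ‖∫ y, tr m f y * K x y‖ₑ * ofReal (tr m g x) ≤ ofReal (B0 ^ (1-θ) * B1 ^ θ) := by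
    intro m
    refine interp1 hK hKb hu hv hc hvc hvc' hθ0 hθ1 huv hB0 hB1 H0 H1 (ε := (1:ℝ)/(m+1)) (D := D) (R := R) (by positivity) (htm m f hf) (htm m g hg)
      (fun x => trunc_aux m (hfD x)) (fun x => trunc_aux m (hgD x)) (fun x hx => ?_) (fun x hx => ?_)
      ((lintegral_mono fun x => ?_).trans hf1) ((lintegral_mono fun x => ?_).trans hg1)
    · simp [htr, hfR x hx]
    · simp [htr, hgR x hx]
    · exact ENNReal.rpow_le_rpow (ENNReal.ofReal_le_ofReal (trunc_le m (hf0 x))) (inv_nonneg.2 (hc.le.trans (huc x).1))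
    · exact ENNReal.rpow_le_rpow (ENNReal.ofReal_le_ofReal (trunc_le m (hg0 x))) (inv_nonneg.2 (hc.le.trans (huc x).2))
  have hfi : Integrable f := by
    have hm : MeasurableSet {y | f y ≠ 0} := (hf (measurableSet_singleton 0)).compl
    have : IsFiniteMeasure (volume.restrict {x | f x ≠ 0}) := ⟨by rw [Measure.restrict_apply_univ]; exact supp_fin hfR⟩
    have : IntegrableOn f {x | f x ≠ 0} := Integrable.of_bound (C := D) hf.aestronglyMeasurable (ae_of_all _ fun x => by
      rw [Real.norm_of_nonneg (hf0 x)]; exact hfD x)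
    exact (integrableOn_iff_integrable_of_support_subset fun x hx => hx).1 this
  have hlim : ∀ x, Tendsto (fun m => ‖∫ y, tr m f y * K x y‖ₑ * ofReal (tr m g x)) atTop (𝓝 (‖∫ y, f y * K x y‖ₑ * ofReal (g x))) := by
    intro x
    have h1 : Tendsto (fun m => ∫ y, tr m f y * K x y) atTop (𝓝 (∫ y, f y * K x y)) := by
      refine tendsto_integral_of_dominated_convergence (fun y => f y * Kb) (fun m => ?_) (hfi.mul_const _) (fun m => ae_of_all _ fun y => ?_) (ae_of_all _ fun y => ?_)
      · exact ((htm m f hf).mul (hK.comp (measurable_const.prodMk measurable_id))).aestronglyMeasurable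
      · rw [norm_mul]
        have : 0 ≤ tr m f y := by simp only [htr]; split_ifs <;> simp [hf0]
        rw [Real.norm_of_nonneg this]
        exact mul_le_mul (trunc_le m (hf0 y)) (hKb x y) (norm_nonneg _) (hf0 y)
      · exact (tendsto_const_nhds.congr' ((trunc_ev (hf0 y)).mono fun m hm => hm.symm)).mul_const _
    refine Tendsto.congr' (f₁ := fun m => ‖∫ y, tr m f y * K x y‖ₑ * ofReal (g x)) ?_ (ENNReal.Tendsto.mul_const h1.enorm (Or.inr ENNReal.ofReal_ne_top))
    filter_upwards [trunc_ev (hg0 x)] with m hm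
    simp only [htr] at hm ⊢
    rw [hm]
  calc _ = ∫⁻ x, liminf (fun m => ‖∫ y, tr m f y * K x y‖ₑ * ofReal (tr m g x)) atTop := by
        congr 1 with x
        rw [(hlim x).liminf_eq]
    _ ≤ liminf (fun m => ∫⁻ x, ‖∫ y, tr m f y * K x y‖ₑ * ofReal (tr m g x)) atTop := by
        refine lintegral_liminf_le fun m => ?_
        have : Measurable fun x => ∫ y, tr m f y * K x y := (((htm m f hf).comp measurable_snd).mul hK).stronglyMeasurable.integral_prod_right.measurable
        exact this.enorm.mul (htm m g hg).ennreal_ofReal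
    _ ≤ _ := liminf_le_of_le ⟨0, by simp⟩ fun b hb' => by
        obtain ⟨m, hm⟩ := hb'.exists
        exact hm.trans (hb m)

lemma integrable_bdd {n : ℕ} {f : Rn n → ℂ} (hf : Measurable f) (hD : ∃ D, ∀ x, ‖f x‖ ≤ D) (hR : ∃ R, ∀ x, R < ‖x‖ → f x = 0) : Integrable f := by
  obtain ⟨D, hD⟩ := hD
  obtain ⟨R, hR⟩ := hR
  have : IsFiniteMeasure ((volume : Measure (Rn n)).restrict (closedBall 0 R)) := ⟨by rw [Measure.restrict_apply_univ]; exact measure_closedBall_lt_top⟩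
  have : IntegrableOn f (closedBall 0 R) := Integrable.of_bound (C := D) hf.aestronglyMeasurable (ae_of_all _ hD)
  refine (integrableOn_iff_integrable_of_support_subset fun x hx => ?_).1 this
  rw [mem_closedBall_zero_iff]
  by_contra h
  exact hx (hR x (not_le.1 h))

lemma young_mx {n : ℕ} (hn : 0 < n) {v : Rn n → ℝ} (hr : LogH fun x => (v x)⁻¹) {c : ℝ} (hc : 0 < c) (hvc : ∀ x, c ≤ v x) (hvc' : ∀ x, v x ≤ 1 - c) :
    ∃ C : ℝ, 0 < C ∧ ∀ f g : Rn n → ℝ≥0∞, Measurable f → Measurable g → ∫⁻ x, f x ^ (v x)⁻¹ ≤ 1 → ∫⁻ x, g x ^ (1 - v x)⁻¹ ≤ 1 →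
      ∫⁻ x, mx f x * g x ≤ ofReal C := by
  have hv0 : ∀ x, 0 < v x := fun x => hc.trans_le (hvc x)
  have hv1 : ∀ x, 0 < 1 - v x := fun x => by linarith [hvc' x]
  have hc1 : 0 < 1 - c := (hv0 0).trans_le (hvc' 0)
  obtain ⟨C, hC, h⟩ := mx_var hn hr (a := (1-c)⁻¹) (b := c⁻¹) ((one_lt_inv₀ hc1).2 (by linarith)) (fun x => inv_anti₀ (hv0 x) (hvc' x)) (fun x => inv_anti₀ hc (hvc x))
  refine ⟨C.toReal + 1, by positivity, fun f g hf hg hf1 hg1 => ?_⟩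
  have hmp : Measurable fun x => mx f x ^ (v x)⁻¹ := (measurable_mx f).pow hr.continuous.measurable
  calc _ ≤ ∫⁻ x, (mx f x ^ (v x)⁻¹ + g x ^ (1 - v x)⁻¹) := by
        refine lintegral_mono fun x => ?_
        have hpq : (v x)⁻¹.HolderConjugate (1 - v x)⁻¹ := by
          rw [Real.holderConjugate_iff]
          exact ⟨(one_lt_inv₀ (hv0 x)).2 (by linarith [hv1 x]), by rw [inv_inv, inv_inv]; ring⟩
        refine (ENNReal.young_inequality _ _ hpq).trans (add_le_add ?_ ?_)
        · refine ENNReal.div_le_of_le_mul (le_mul_of_one_le_right' ?_)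
          rw [← ENNReal.ofReal_one]; exact ENNReal.ofReal_le_ofReal hpq.lt.le
        · refine ENNReal.div_le_of_le_mul (le_mul_of_one_le_right' ?_)
          rw [← ENNReal.ofReal_one]; exact ENNReal.ofReal_le_ofReal hpq.symm.lt.le
    _ = (∫⁻ x, mx f x ^ (v x)⁻¹) + ∫⁻ x, g x ^ (1 - v x)⁻¹ := lintegral_add_left hmp _
    _ ≤ C + 1 := add_le_add (h f hf hf1) hg1
    _ = _ := by rw [ENNReal.ofReal_add (by positivity) zero_le_one, ENNReal.ofReal_toReal hC, ENNReal.ofReal_one]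

lemma BB1 {n : ℕ} (hn : 0 < n) {v : Rn n → ℝ} (hr : LogH fun x => (v x)⁻¹) {c : ℝ} (hc : 0 < c) (hvc : ∀ x, c ≤ v x) (hvc' : ∀ x, v x ≤ 1 - c) :
    ∃ C : ℝ, 0 < C ∧ ∀ δ : ℝ, 0 < δ → n * δ ≤ 1 → ∀ t : Rn n → ℝ, (∀ x, 0 < t x) →
      BB (fun x y => kern δ (t x) (x - y)) (fun x => (v x)⁻¹) (fun x => (1 - v x)⁻¹) (C * δ⁻¹) := by
  obtain ⟨C, hC, h⟩ := young_mx hn hr hc hvc hvc'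
  obtain ⟨A, hA, h2⟩ := MK_mx hn
  refine ⟨A * C, by positivity, fun δ hδ hδ1 t ht f hf _ _ g hg hf1 hg1 => ?_⟩
  calc _ ≤ ∫⁻ x, ofReal (A * δ⁻¹) * (mx (fun y => ‖f y‖ₑ) x * g x) := by
        refine lintegral_mono fun x => ?_
        rw [← mul_assoc]
        refine mul_le_mul' ?_ le_rfl
        refine le_trans ?_ (h2 δ hδ hδ1 (t x) (ht x) _ hf.enorm x).2
        refine (enorm_integral_le_lintegral_enorm _).trans (lintegral_mono fun y => ?_)
        rw [enorm_mul, ← ofReal_norm (kern δ (t x) (x - y) : ℂ), Complex.norm_real, ofReal_norm]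
    _ = ofReal (A * δ⁻¹) * ∫⁻ x, (mx (fun y => ‖f y‖ₑ) x * g x) := lintegral_const_mul' _ _ ENNReal.ofReal_ne_top
    _ ≤ ofReal (A * δ⁻¹) * ofReal C := mul_le_mul' le_rfl (h _ g hf.enorm hg hf1 hg1)
    _ = _ := by rw [← ENNReal.ofReal_mul (by positivity)]; congr 1; ring

lemma BB0 {n : ℕ} (hn : 0 < n) :
    ∃ C : ℝ, 0 < C ∧ ∀ δ : ℝ, 0 < δ → n * δ ≤ 1 → ∀ t : Rn n → ℝ, Measurable t → (∀ x, 0 < t x) →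
      BB (fun x y => kern δ (t x) (x - y)) (fun _ => 2) (fun _ => 2) (C * δ ^ ((n:ℝ)/2 - 1)) := by
  obtain ⟨C, hC, h⟩ := kap_L2 (n := n) hn
  refine ⟨C ^ (1/2:ℝ), by positivity, fun δ hδ hδ1 t htm ht f hf hfD hfR g hg hf1 hg1 => ?_⟩
  have hd1 : δ ≤ 1 := by
    have : (1:ℝ) ≤ n := by exact_mod_cast hn
    nlinarith
  have hfi := integrable_bdd hf hfD hfR
  obtain ⟨W, hW, hb, hI⟩ := h δ hδ hd1 f hfi
  have hm : Measurable fun x => ∫ y, f y * (kern δ (t x) (x - y) : ℂ) := by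
    have : Measurable (Function.uncurry fun x y : Rn n => f y * (kern δ (t x) (x - y) : ℂ)) :=
      (hf.comp measurable_snd).mul (Complex.measurable_ofReal.comp (meas_kern δ (htm.comp measurable_fst) (by fun_prop)))
    exact this.stronglyMeasurable.integral_prod_right.measurable
  have hsq : ∫⁻ x, ‖∫ y, f y * (kern δ (t x) (x - y) : ℂ)‖ₑ ^ (2:ℝ) ≤ ofReal (C*(δ^n*(δ^2)⁻¹)) := by
    calc _ ≤ ∫⁻ x, W x := lintegral_mono fun x => by
          rw [← um_kern hfi hδ (ht x), ENNReal.rpow_two]; exact hb x _ (ht x)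
      _ ≤ _ := hI
      _ ≤ ofReal (C*(δ^n*(δ^2)⁻¹)) * 1 := mul_le_mul' le_rfl (by simpa using hf1)
      _ = _ := mul_one _
  refine (ENNReal.lintegral_mul_le_Lp_mul_Lq volume (by rw [Real.holderConjugate_iff]; norm_num : (2:ℝ).HolderConjugate 2) hm.enorm.aemeasurable hg.aemeasurable).trans ?_
  calc _ ≤ ofReal (C*(δ^n*(δ^2)⁻¹)) ^ (1/2:ℝ) * 1 ^ (1/2:ℝ) := mul_le_mul' (ENNReal.rpow_le_rpow hsq (by norm_num)) (ENNReal.rpow_le_rpow hg1 (by norm_num))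
    _ = _ := by
      rw [ENNReal.one_rpow, mul_one, ENNReal.ofReal_rpow_of_pos (by positivity)]
      congr 1
      rw [Real.mul_rpow hC.le (by positivity)]
      congr 1
      rw [← Real.rpow_natCast, ← Real.rpow_natCast, ← Real.rpow_neg hδ.le, ← Real.rpow_add hδ, ← Real.rpow_mul hδ.le]
      congr 1
      push_cast; ring

lemma kern_bdd {n : ℕ} (hn : 0 < n) {δ ε : ℝ} (hδ : 0 < δ) (hδ1 : n * δ ≤ 1) (hε : 0 < ε) : ∃ B : ℝ, ∀ t : ℝ, ε ≤ t → ∀ z : Rn n, |kern δ t z| ≤ B := by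
  obtain ⟨C, hC, h⟩ := MK_bd hn
  refine ⟨C * δ⁻¹ * (ε^n)⁻¹, fun t ht z => ?_⟩
  have ht0 := hε.trans_le ht
  have := (h δ hδ hδ1 t ht0 z).2
  rw [← ENNReal.ofReal_mul (by positivity), ← ofReal_norm, ENNReal.ofReal_le_ofReal_iff (by positivity)] at this
  refine this.trans (mul_le_mul_of_nonneg_left ?_ (by positivity))
  have h1 : exp (-(Real.pi/4) * ‖t⁻¹ • z‖^2) ≤ 1 := Real.exp_le_one_iff.2 (by have := Real.pi_pos; have := sq_nonneg ‖t⁻¹ • z‖; nlinarith)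
  have h2 : (t^n)⁻¹ ≤ (ε^n)⁻¹ := inv_anti₀ (by positivity) (pow_le_pow_left₀ hε.le ht n)
  calc _ ≤ (ε^n)⁻¹ * 1 := mul_le_mul h2 h1 (Real.exp_pos _).le (by positivity)
    _ = _ := mul_one _

/-- linearized bound -/
lemma lin_bd {n : ℕ} (hn : 0 < n) {u v : Rn n → ℝ} {θ c : ℝ} (hr : LogH fun x => (v x)⁻¹) (hq : LogH fun x => (u x)⁻¹) (hum : Measurable u) (hvm : Measurable v) (hc : 0 < c) (hvc : ∀ x, c ≤ v x) (hvc' : ∀ x, v x ≤ 1 - c)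
    (hθ0 : 0 ≤ θ) (hθ1 : θ ≤ 1) (hγ : 0 < ((n:ℝ)/2 - 1) * (1 - θ) - θ) (huv : ∀ x, u x = (1-θ)/2 + θ * v x) :
    ∃ C : ℝ, 0 < C ∧ ∀ t : Rn n → ℝ, Measurable t → (∃ ε > 0, ∀ x, ε ≤ t x) → ∀ (f g : Rn n → ℝ) (D R : ℝ), Continuous f → Measurable g →
    (∀ x, 0 ≤ f x) → (∀ x, 0 ≤ g x) → (∀ x, f x ≤ D) → (∀ x, g x ≤ D) → (∀ x, R < ‖x‖ → f x = 0) → (∀ x, R < ‖x‖ → g x = 0) →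
    ∫⁻ x, ofReal (f x) ^ (u x)⁻¹ ≤ 1 → ∫⁻ x, ofReal (g x) ^ (1 - u x)⁻¹ ≤ 1 →
    ∫⁻ x, ‖∫ ω, f (x - t x • ω) ∂(unitSphereMeasure n)‖ₑ * ofReal (g x) ≤ ofReal C := by
  have huc : ∀ x, c ≤ u x ∧ u x ≤ 1 - c := fun x => by
    have a := hvc x; have b := hvc' x
    rw [huv]
    constructor <;> nlinarith
  obtain ⟨C0, hC0, h0⟩ := BB0 hn
  obtain ⟨C1, hC1, h1⟩ := BB1 hn hr hc hvc hvc'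
  obtain ⟨C2, hC2, h2⟩ := young_mx hn hq hc (fun x => (huc x).1) (fun x => (huc x).2)
  obtain ⟨A, hA, h3⟩ := MK_mx hn
  set γ := ((n:ℝ)/2 - 1) * (1 - θ) - θ with hγd
  have hn' : (0:ℝ) < n := by exact_mod_cast hn
  set d : ℝ := (n:ℝ)⁻¹ with hd
  have hd0 : 0 < d := by positivity
  have hdn : n * d ≤ 1 := by rw [hd, mul_inv_cancel₀ hn'.ne']
  set E := C0 ^ (1-θ) * C1 ^ θ * d ^ γ with hE
  have hE0 : 0 < E := by positivity
  set ρ : ℝ := (1/2) ^ γ with hρ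
  have hρ0 : 0 < ρ := by positivity
  have hρ1 : ρ < 1 := Real.rpow_lt_one (by norm_num) (by norm_num) hγ
  have hρ2 : 0 < 1 - ρ := by linarith
  refine ⟨A * d⁻¹ * C2 + E * (1 - ρ)⁻¹, by positivity, ?_⟩
  intro t htm ⟨ε, hε, hte⟩ f g D R hf hg hf0 hg0 hfD hgD hfR hgR hf1 hg1
  have ht : ∀ x, 0 < t x := fun x => hε.trans_le (hte x)
  have hd0j : ∀ j : ℕ, 0 < d/2^j := fun j => by positivity
  have hd1j : ∀ j : ℕ, n * (d/2^j) ≤ 1 := fun j => by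
    refine le_trans ?_ hdn
    refine mul_le_mul_of_nonneg_left (div_le_self hd0.le (one_le_pow₀ (by norm_num))) (by positivity)
  have hKm : ∀ j : ℕ, Measurable (Function.uncurry fun x y : Rn n => kern (d/2^j) (t x) (x - y)) := fun j =>
    meas_kern _ (htm.comp measurable_fst) (by fun_prop)
  have hj : ∀ j : ℕ, ∫⁻ x, ‖∫ y, f y * kern (d/2^j) (t x) (x - y)‖ₑ * ofReal (g x) ≤ ofReal (E * ρ^j) := by
    intro j
    obtain ⟨B, hB⟩ := kern_bdd hn (hd0j j) (hd1j j) hε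
    have hdp := hd0j j
    refine (interp (K := fun x y => kern (d/2^j) (t x) (x - y)) (hKm j) (fun x y => hB _ (hte x) _) hum hvm hc hvc hvc' hθ0 hθ1 huv (by positivity) (by positivity)
      (h0 _ (hd0j j) (hd1j j) t htm ht) (h1 _ (hd0j j) (hd1j j) t ht) hf.measurable hg hf0 hg0 hfD hgD hfR hgR hf1 hg1).trans (le_of_eq ?_)
    congr 1
    rw [Real.mul_rpow hC0.le (by positivity), Real.mul_rpow hC1.le (by positivity), ← Real.rpow_mul hdp.le, Real.inv_rpow hdp.le, ← Real.rpow_neg hdp.le]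
    have e1 : ρ^j = (((1/2:ℝ))^j)^γ := by rw [hρ, ← Real.rpow_natCast, ← Real.rpow_mul (by norm_num), mul_comm, Real.rpow_mul (by norm_num), Real.rpow_natCast]
    rw [hE, e1, mul_assoc _ (d^γ), ← Real.mul_rpow hd0.le (by positivity)]
    have e2 : d * (1/2)^j = d/2^j := by rw [one_div, inv_pow]; rfl
    rw [e2, hγd, sub_eq_add_neg (((n:ℝ)/2 - 1) * (1 - θ)), Real.rpow_add hdp]
    ring
  have hAj : ∀ j : ℕ, Measurable fun x => ‖∫ y, f y * kern (d/2^j) (t x) (x - y)‖ₑ * ofReal (g x) := fun j => by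
    have : Measurable fun x => ∫ y, f y * kern (d/2^j) (t x) (x - y) := ((hf.measurable.comp measurable_snd).mul (hKm j)).stronglyMeasurable.integral_prod_right.measurable
    exact this.enorm.mul hg.ennreal_ofReal
  calc _ ≤ ∫⁻ x, (ofReal (A * d⁻¹) * (mx (fun y => ofReal (f y)) x * ofReal (g x)) + ∑' j : ℕ, ‖∫ y, f y * kern (d/2^j) (t x) (x - y)‖ₑ * ofReal (g x)) := by
        refine lintegral_mono fun x => ?_
        rw [← mul_assoc, ENNReal.tsum_mul_right, ← add_mul]
        refine mul_le_mul' ((sph_tele hn hd0 hdn (ht x) hf (D := D) (fun x => by rw [abs_of_nonneg (hf0 x)]; exact hfD x) x).trans (add_le_add ?_ le_rfl)) le_rfl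
        refine le_trans ?_ (h3 d hd0 hdn (t x) (ht x) _ hf.measurable.ennreal_ofReal x).1
        refine (enorm_integral_le_lintegral_enorm _).trans (lintegral_mono fun y => ?_)
        rw [enorm_mul, Real.enorm_of_nonneg (hf0 y)]
    _ = ofReal (A * d⁻¹) * (∫⁻ x, mx (fun y => ofReal (f y)) x * ofReal (g x)) + ∑' j : ℕ, ∫⁻ x, ‖∫ y, f y * kern (d/2^j) (t x) (x - y)‖ₑ * ofReal (g x) := by
        have hm1 : Measurable fun x => ofReal (A * d⁻¹) * (mx (fun y => ofReal (f y)) x * ofReal (g x)) := ((measurable_mx _).mul hg.ennreal_ofReal).const_mul _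
        rw [lintegral_add_left hm1, lintegral_const_mul' _ _ ENNReal.ofReal_ne_top, lintegral_tsum fun j => (hAj j).aemeasurable]
    _ ≤ ofReal (A * d⁻¹) * ofReal C2 + ∑' j : ℕ, ofReal (E * ρ^j) :=
        add_le_add (mul_le_mul' le_rfl (h2 _ _ hf.measurable.ennreal_ofReal hg.ennreal_ofReal hf1 hg1)) (ENNReal.tsum_le_tsum hj)
    _ = _ := by
        rw [← ENNReal.ofReal_mul (by positivity), ← ENNReal.ofReal_tsum_of_nonneg (fun j => by positivity) ((summable_geometric_of_lt_one hρ0.le hρ1).mul_left _), tsum_mul_left, tsum_geometric_of_lt_one hρ0.le hρ1, ENNReal.ofReal_add (by positivity)]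
        positivity

lemma dual_bd {n : ℕ} {u : Rn n → ℝ} {c : ℝ} (hum : Measurable u) (hc : 0 < c) (huc : ∀ x, c ≤ u x ∧ u x ≤ 1 - c) {w : Rn n → ℝ} {D : ℝ} (hw : Measurable w) (hwD : ∀ x, w x ≤ D)
    (H : ∀ (g : Rn n → ℝ) (D R : ℝ), Measurable g → (∀ x, 0 ≤ g x) → (∀ x, g x ≤ D) → (∀ x, R < ‖x‖ → g x = 0) →
      ∫⁻ x, ofReal (g x) ^ (1 - u x)⁻¹ ≤ 1 → ∫⁻ x, ofReal (w x) * ofReal (g x) ≤ 1) :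
    ∫⁻ x, ofReal (w x) ^ (u x)⁻¹ ≤ 1 := by
  have hu0 : ∀ x, 0 < u x := fun x => hc.trans_le (huc x).1
  have hu1 : ∀ x, 0 < 1 - u x := fun x => by linarith [(huc x).2]
  have hui : ∀ x, 1 ≤ (u x)⁻¹ := fun x => (one_le_inv₀ (hu0 x)).2 (by linarith [hu1 x])
  have huic : ∀ x, (u x)⁻¹ ≤ c⁻¹ := fun x => inv_anti₀ hc (huc x).1
  set W : Rn n → ℝ≥0∞ := fun x => ofReal (w x) with hWd
  have hWm : Measurable W := hw.ennreal_ofReal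
  set E : ℝ≥0∞ := ofReal (max D 1) with hE
  have hE1 : 1 ≤ E := by rw [hE, ← ENNReal.ofReal_one]; exact ENNReal.ofReal_le_ofReal (le_max_right _ _)
  have hWE : ∀ x, W x ≤ E := fun x => ENNReal.ofReal_le_ofReal ((hwD x).trans (le_max_left _ _))
  have hWb : ∀ x, ∀ a : ℝ, 0 ≤ a → a ≤ c⁻¹ → W x ^ a ≤ E ^ c⁻¹ := fun x a h0 h1 =>
    (ENNReal.rpow_le_rpow (hWE x) h0).trans (ENNReal.rpow_le_rpow_of_exponent_le hE1 h1)
  have hEt : E ^ c⁻¹ ≠ ∞ := ENNReal.rpow_ne_top_of_nonneg (by positivity) ENNReal.ofReal_ne_top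
  have hR : ∀ R : ℕ, ∫⁻ x in closedBall 0 (R:ℝ), W x ^ (u x)⁻¹ ≤ 1 := by
    intro R
    set X := ∫⁻ x in closedBall 0 (R:ℝ), W x ^ (u x)⁻¹ with hX
    by_contra hlt
    have hlt : 1 < X := not_le.1 hlt
    have hX0 : X ≠ 0 := (zero_lt_one.trans hlt).ne'
    have hXt : X ≠ ∞ := by
      refine ((lintegral_mono fun x => hWb x _ (by linarith [hui x]) (huic x)).trans_lt ?_).ne
      rw [setLIntegral_const]
      exact ENNReal.mul_lt_top hEt.lt_top measure_closedBall_lt_top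
    set G : Rn n → ℝ≥0∞ := (closedBall 0 (R:ℝ)).indicator fun x => W x ^ ((u x)⁻¹ - 1) * X ^ (-(1 - u x)) with hG
    have hGm : Measurable G := Measurable.indicator (by fun_prop) measurableSet_closedBall
    have hGE : ∀ x, G x ≤ E ^ c⁻¹ := fun x => by
      refine Set.indicator_le_self' (fun _ _ => zero_le) x |>.trans ?_
      refine (mul_le_mul' (hWb x _ (by linarith [hui x]) (by linarith [huic x])) (ENNReal.rpow_le_one_of_one_le_of_neg hlt.le (by linarith [hu1 x]))).trans (mul_one _).le
    have hGt : ∀ x, ofReal (G x).toReal = G x := fun x => ENNReal.ofReal_toReal ((hGE x).trans_lt hEt.lt_top).ne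
    have := H (fun x => (G x).toReal) (E ^ c⁻¹).toReal R hGm.ennreal_toReal (fun x => ENNReal.toReal_nonneg) (fun x => ENNReal.toReal_mono hEt (hGE x)) ?_ ?_
    · simp_rw [hGt] at this
      have h2 : X * X ^ (-(1-c)) ≤ ∫⁻ x, W x * G x := by
        calc _ = ∫⁻ x in closedBall 0 (R:ℝ), W x ^ (u x)⁻¹ * X ^ (-(1-c)) := (lintegral_mul_const _ (by fun_prop)).symm
          _ ≤ ∫⁻ x in closedBall 0 (R:ℝ), W x * (W x ^ ((u x)⁻¹ - 1) * X ^ (-(1 - u x))) := by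
              refine lintegral_mono fun x => ?_
              rw [← mul_assoc]
              refine mul_le_mul' (le_of_eq ?_) (ENNReal.rpow_le_rpow_of_exponent_le hlt.le (by linarith [(huc x).1]))
              conv_lhs => rw [show (u x)⁻¹ = 1 + ((u x)⁻¹ - 1) by ring, ENNReal.rpow_add_of_nonneg _ _ zero_le_one (by linarith [hui x]), ENNReal.rpow_one]
          _ = _ := by
              rw [← lintegral_indicator measurableSet_closedBall]
              congr 1 with x
              by_cases hx : x ∈ closedBall (0 : Rn n) (R:ℝ) <;> simp [hG, hx]
      have h3 : X * X ^ (-(1-c)) = X ^ c := by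
        conv_lhs => rw [← ENNReal.rpow_one X, ← ENNReal.rpow_mul, one_mul, ← ENNReal.rpow_add _ _ hX0 hXt]
        congr 1; ring
      exact absurd (h2.trans this) (not_le.2 (by rw [h3]; exact ENNReal.one_lt_rpow hlt hc))
    · intro x hx
      have : x ∉ closedBall (0 : Rn n) (R:ℝ) := by rw [mem_closedBall_zero_iff]; exact not_le.2 hx
      simp [hG, this]
    · simp_rw [hGt]
      calc _ = ∫⁻ x in closedBall 0 (R:ℝ), W x ^ (u x)⁻¹ * X⁻¹ := by
            rw [← lintegral_indicator measurableSet_closedBall]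
            congr 1 with x
            by_cases hx : x ∈ closedBall (0 : Rn n) (R:ℝ)
            · simp only [hG, Set.indicator_of_mem hx]
              rw [ENNReal.mul_rpow_of_nonneg _ _ (inv_nonneg.2 (hu1 x).le), ← ENNReal.rpow_mul, ← ENNReal.rpow_mul]
              have := (hu0 x).ne'; have h5 := (hu1 x).ne'
              congr 2
              · field_simp
              · rw [neg_mul, mul_inv_cancel₀ h5, ENNReal.rpow_neg_one]
            · simp only [hG, Set.indicator_of_notMem hx]
              exact ENNReal.zero_rpow_of_pos (inv_pos.2 (hu1 x))
        _ = X * X⁻¹ := lintegral_mul_const _ (by fun_prop)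
        _ ≤ 1 := ENNReal.mul_inv_cancel hX0 hXt |>.le
  have hU : ⋃ R : ℕ, closedBall (0 : Rn n) (R:ℝ) = Set.univ := iUnion_closedBall_nat 0
  rw [← setLIntegral_univ, ← hU, setLIntegral_iUnion_of_directed _ (Monotone.directed_le fun a b hab => closedBall_subset_closedBall (by exact_mod_cast hab))]
  exact iSup_le hR

/-- spherical maximal function, extended valued. -/
def SS {n : ℕ} (F : Rn n → ℝ≥0∞) (x : Rn n) : ℝ≥0∞ := ⨆ t : {t : ℝ // 0 < t}, ∫⁻ ω, F (x - t.1 • ω) ∂(unitSphereMeasure n)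

lemma sph_cont {n : ℕ} (hn : 0 < n) {u v : Rn n → ℝ} {θ c : ℝ} (hr : LogH fun x => (v x)⁻¹) (hq : LogH fun x => (u x)⁻¹) (hum : Measurable u) (hvm : Measurable v) (hc : 0 < c) (hvc : ∀ x, c ≤ v x) (hvc' : ∀ x, v x ≤ 1 - c)
    (hθ0 : 0 ≤ θ) (hθ1 : θ ≤ 1) (hγ : 0 < ((n:ℝ)/2 - 1) * (1 - θ) - θ) (huv : ∀ x, u x = (1-θ)/2 + θ * v x) :
    ∃ C : ℝ, 0 < C ∧ ∀ (f : Rn n → ℝ) (D R : ℝ), Continuous f → (∀ x, 0 ≤ f x) → (∀ x, f x ≤ D) → (∀ x, R < ‖x‖ → f x = 0) → 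
    ∫⁻ x, ofReal (f x) ^ (u x)⁻¹ ≤ 1 → Measurable (SS (fun x => ofReal (f x))) ∧ ∫⁻ x, (SS (fun x => ofReal (f x)) x / ofReal C) ^ (u x)⁻¹ ≤ 1 := by
  have huc : ∀ x, c ≤ u x ∧ u x ≤ 1 - c := fun x => by
    have a := hvc x; have b := hvc' x
    rw [huv]
    constructor <;> nlinarith
  obtain ⟨C, hC, h⟩ := lin_bd hn hr hq hum hvm hc hvc hvc' hθ0 hθ1 hγ huv
  refine ⟨C, hC, fun f D R hf hf0 hfD hfR hf1 => ?_⟩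
  set A : Rn n → ℝ → ℝ := fun x t => ∫ ω, f (x - t • ω) ∂(unitSphereMeasure n) with hA
  have hAc : Continuous (Function.uncurry A) := by
    refine continuous_of_dominated (F := fun (p : Rn n × ℝ) (ω : Rn n) => f (p.1 - p.2 • ω)) (bound := fun _ => D) (fun p => ?_) (fun p => ae_of_all _ fun ω => ?_) (integrable_const _) (ae_of_all _ fun ω => by fun_prop)
    · have : Continuous fun ω => f (p.1 - p.2 • ω) := by fun_prop
      exact this.aestronglyMeasurable
    · rw [Real.norm_of_nonneg (hf0 _)]; exact hfD _
  have hA0 : ∀ x t, 0 ≤ A x t := fun x t => integral_nonneg fun ω => hf0 _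
  have hAD : ∀ x t, A x t ≤ D * (unitSphereMeasure n).real Set.univ := fun x t => by
    have := norm_integral_le_of_norm_le_const (μ := unitSphereMeasure n) (f := fun ω => f (x - t • ω)) (C := D) (ae_of_all _ fun ω => by rw [Real.norm_of_nonneg (hf0 _)]; exact hfD _)
    exact (Real.le_norm_self _).trans this
  have hSS : ∀ x, SS (fun x => ofReal (f x)) x = ⨆ t : {t : ℝ // 0 < t}, ofReal (A x t.1) := fun x => by
    refine iSup_congr fun t => (ofReal_integral_eq_lintegral_ofReal ?_ (ae_of_all _ fun ω => hf0 _)).symm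
    have : Continuous fun ω => f (x - t.1 • ω) := by fun_prop
    refine Integrable.of_bound this.aestronglyMeasurable D (ae_of_all _ fun ω => ?_)
    rw [Real.norm_of_nonneg (hf0 _)]; exact hfD _
  -- bound for linearized
  have hlin : ∀ t : Rn n → ℝ, Measurable t → (∃ ε > 0, ∀ x, ε ≤ t x) → ∫⁻ x, (ofReal (A x (t x)) / ofReal C) ^ (u x)⁻¹ ≤ 1 := by
    intro t htm hte
    simp_rw [← ENNReal.ofReal_div_of_pos hC]
    refine dual_bd hum hc huc (w := fun x => A x (t x) / C) (D := D * (unitSphereMeasure n).real Set.univ / C) ((hAc.measurable.comp (measurable_id.prodMk htm)).div_const C)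
      (fun x => div_le_div_of_nonneg_right (hAD _ _) hC.le) ?_
    intro g D' R' hg hg0 hgD hgR hg1
    have := h t htm hte f g (max D D') (max R R') hf hg hf0 hg0 (fun x => (hfD x).trans (le_max_left _ _)) (fun x => (hgD x).trans (le_max_right _ _))
      (fun x hx => hfR x ((le_max_left _ _).trans_lt hx)) (fun x hx => hgR x ((le_max_right _ _).trans_lt hx)) hf1 hg1
    calc _ = ∫⁻ x, ofReal C⁻¹ * (‖A x (t x)‖ₑ * ofReal (g x)) := by
          congr 1 with x
          rw [div_eq_inv_mul, ENNReal.ofReal_mul (by positivity), Real.enorm_of_nonneg (hA0 _ _), mul_assoc]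
      _ = ofReal C⁻¹ * ∫⁻ x, ‖A x (t x)‖ₑ * ofReal (g x) := lintegral_const_mul' _ _ ENNReal.ofReal_ne_top
      _ ≤ ofReal C⁻¹ * ofReal C := mul_le_mul' le_rfl this
      _ = 1 := by rw [← ENNReal.ofReal_mul (by positivity), inv_mul_cancel₀ hC.ne', ENNReal.ofReal_one]
  -- selection
  have : Nonempty {t : ℝ // 0 < t} := ⟨⟨1, one_pos⟩⟩
  set s : ℕ → ℝ := fun j => (TopologicalSpace.denseSeq {t : ℝ // 0 < t} j).1 with hs
  have hs0 : ∀ j, 0 < s j := fun j => (TopologicalSpace.denseSeq {t : ℝ // 0 < t} j).2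
  set T : ℕ → Rn n → ℝ := fun k => Nat.rec (fun _ => s 0) (fun j t x => if A x (t x) < A x (s (j+1)) then s (j+1) else t x) k with hT
  have hTs : ∀ k x, T (k+1) x = if A x (T k x) < A x (s (k+1)) then s (k+1) else T k x := fun k x => rfl
  have hTm : ∀ k, Measurable (T k) ∧ ∃ ε > 0, ∀ x, ε ≤ T k x := by
    intro k
    induction k with
    | zero => exact ⟨measurable_const, s 0, hs0 0, fun x => le_rfl⟩
    | succ k ih =>
      obtain ⟨hm, ε, hε, he⟩ := ih
      refine ⟨Measurable.ite (measurableSet_lt (hAc.measurable.comp (measurable_id.prodMk hm)) (hAc.measurable.comp (measurable_id.prodMk measurable_const))) measurable_const hm, min ε (s (k+1)), lt_min hε (hs0 _), fun x => ?_⟩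
      rw [hTs]
      split_ifs
      · exact min_le_right _ _
      · exact (min_le_left _ _).trans (he x)
  have hstep : ∀ k x, A x (T k x) ≤ A x (T (k+1) x) ∧ A x (s (k+1)) ≤ A x (T (k+1) x) := fun k x => by
    rw [hTs]
    split_ifs with h
    · exact ⟨h.le, le_rfl⟩
    · exact ⟨le_rfl, not_lt.1 h⟩
  have hsT : ∀ k x, A x (s k) ≤ A x (T k x) := fun k x => by
    cases k with
    | zero => exact le_rfl
    | succ k => exact (hstep k x).2
  have hle : ∀ x, SS (fun x => ofReal (f x)) x ≤ ⨆ k, ofReal (A x (T k x)) := by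
    intro x
    rw [hSS]
    refine iSup_le fun t => ?_
    have hcl : IsClosed {t : {t : ℝ // 0 < t} | ofReal (A x t.1) ≤ ⨆ k, ofReal (A x (T k x))} := by
      refine isClosed_le (ENNReal.continuous_ofReal.comp ?_) continuous_const
      exact hAc.comp (continuous_const.prodMk continuous_subtype_val)
    exact (TopologicalSpace.denseRange_denseSeq {t : ℝ // 0 < t}).induction_on t hcl fun j => (ENNReal.ofReal_le_ofReal (hsT j x)).trans (le_iSup (fun k => ofReal (A x (T k x))) j)
  have hu0 : ∀ x, 0 < (u x)⁻¹ := fun x => inv_pos.2 (hc.trans_le (huc x).1)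
  refine ⟨?_, ?_⟩
  · rw [funext hSS]
    refine (lowerSemicontinuous_iSup fun t => Continuous.lowerSemicontinuous ?_).measurable
    exact ENNReal.continuous_ofReal.comp (hAc.comp (continuous_id.prodMk continuous_const))
  calc _ ≤ ∫⁻ x, ⨆ k, (ofReal (A x (T k x)) / ofReal C) ^ (u x)⁻¹ := by
        refine lintegral_mono fun x => (ENNReal.rpow_le_rpow (ENNReal.div_le_div_right (hle x) _) (hu0 x).le).trans (le_of_eq ?_)
        rw [ENNReal.iSup_div]
        exact (ENNReal.orderIsoRpow _ (hu0 x)).map_iSup _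
    _ = ⨆ k, ∫⁻ x, (ofReal (A x (T k x)) / ofReal C) ^ (u x)⁻¹ := by
        refine lintegral_iSup (fun k => ?_) (monotone_nat_of_le_succ fun k x => ?_)
        · have : Measurable fun x => A x (T k x) := hAc.measurable.comp (measurable_id.prodMk (hTm k).1)
          exact (this.ennreal_ofReal.div_const _).pow hum.inv
        · exact ENNReal.rpow_le_rpow (ENNReal.div_le_div_right (ENNReal.ofReal_le_ofReal (hstep k x).1) _) (hu0 x).le
    _ ≤ 1 := iSup_le fun k => hlin _ (hTm k).1 (hTm k).2

/-- continuous compactly supported approximation of lsc functions from below -/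
lemma lsc_approx {n : ℕ} {g : Rn n → ℝ≥0∞} (hg : LowerSemicontinuous g) :
    ∃ h : ℕ → Rn n → ℝ, (∀ k, Continuous (h k)) ∧ (∀ k x, 0 ≤ h k x) ∧ (∀ k x, h k x ≤ k) ∧ (∀ (k : ℕ) x, (k:ℝ) < ‖x‖ → h k x = 0) ∧
      (∀ x, Monotone fun k => h k x) ∧ (∀ k x, ofReal (h k x) ≤ g x) ∧ ∀ x, g x ≤ ⨆ k, ofReal (h k x) := by
  set m : ℕ → Rn n → ℝ := fun k y => (min (g y) k).toReal with hm
  have hm0 : ∀ k y, 0 ≤ m k y := fun k y => ENNReal.toReal_nonneg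
  have hfin : ∀ (k:ℕ) y, min (g y) (k:ℝ≥0∞) ≠ ∞ := fun k y => ((min_le_right _ _).trans_lt (ENNReal.natCast_lt_top k)).ne
  set φ : ℕ → Rn n → ℝ := fun k x => ⨅ y, (m k y + k * dist x y) with hφ
  have hb : ∀ (k:ℕ) x, BddBelow (Set.range fun y => m k y + k * dist x y) := fun k x => ⟨0, by
    rintro _ ⟨y, rfl⟩
    have := hm0 k y
    positivity⟩
  have hφ0 : ∀ k x, 0 ≤ φ k x := fun k x => Real.iInf_nonneg fun y => by have := hm0 k y; positivity
  have hφm : ∀ k x, φ k x ≤ m k x := fun k x => (ciInf_le (hb k x) x).trans (by simp)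
  have hmk : ∀ k x, m k x ≤ k := fun k x => by
    have := ENNReal.toReal_mono (ENNReal.natCast_ne_top k) (min_le_right (g x) k)
    simpa using this
  have hφc : ∀ k, Continuous (φ k) := fun k => by
    refine (LipschitzWith.of_le_add_mul (k:ℝ≥0) fun x x' => ?_).continuous
    rw [← sub_le_iff_le_add]
    refine le_ciInf fun y => ?_
    have h1 := ciInf_le (hb k x) y
    have h2 : (k:ℝ) * dist x y ≤ k * (dist x x' + dist x' y) := mul_le_mul_of_nonneg_left (dist_triangle _ _ _) (by positivity)
    simp only [NNReal.coe_natCast]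
    change φ k x ≤ _ at h1
    linarith
  have hφmono : ∀ x, Monotone fun k => φ k x := fun x k l hkl => by
    refine ciInf_mono (hb k x) fun y => ?_
    have hkl' : (k:ℝ) ≤ l := by exact_mod_cast hkl
    refine add_le_add (ENNReal.toReal_mono (hfin l y) (min_le_min le_rfl (by exact_mod_cast hkl))) (mul_le_mul_of_nonneg_right hkl' dist_nonneg)
  set χ : ℕ → Rn n → ℝ := fun k x => max 0 (min 1 (k - ‖x‖)) with hχ
  have hχ0 : ∀ k x, 0 ≤ χ k x := fun k x => le_max_left _ _
  have hχ1 : ∀ k x, χ k x ≤ 1 := fun k x => max_le zero_le_one (min_le_left _ _)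
  have hle : ∀ k x, φ k x * χ k x ≤ φ k x := fun k x => mul_le_of_le_one_right (hφ0 k x) (hχ1 k x)
  refine ⟨fun k x => φ k x * χ k x, fun k => (hφc k).mul (by fun_prop), fun k x => mul_nonneg (hφ0 k x) (hχ0 k x), fun k x => (hle k x).trans ((hφm k x).trans (hmk k x)),
    fun k x hx => ?_, fun x k l hkl => ?_, fun k x => ?_, fun x => ?_⟩
  · have : χ k x = 0 := max_eq_left ((min_le_right _ _).trans (by linarith))
    simp [this]
  · have hkl' : (k:ℝ) ≤ l := by exact_mod_cast hkl
    exact mul_le_mul (hφmono x hkl) (max_le_max le_rfl (min_le_min le_rfl (by linarith))) (hχ0 k x) (hφ0 l x)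
  · refine (ENNReal.ofReal_le_ofReal ((hle k x).trans (hφm k x))).trans ?_
    rw [hm, ENNReal.ofReal_toReal (hfin k x)]
    exact min_le_left _ _
  · refine le_of_forall_lt fun a ha => ?_
    obtain ⟨b, hab, hbg⟩ := exists_between ha
    have hbt : b ≠ ∞ := hbg.ne_top
    obtain ⟨r, hr, hball⟩ := Metric.eventually_nhds_iff.1 (hg x b hbg)
    obtain ⟨k, hk⟩ := exists_nat_ge (max (b.toReal / r) (max b.toReal (‖x‖ + 1)))
    obtain ⟨hk1, hk2⟩ := max_le_iff.1 hk
    obtain ⟨hk2, hk3⟩ := max_le_iff.1 hk2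
    have h1 : χ k x = 1 := by
      simp only [hχ]
      rw [min_eq_left (by linarith), max_eq_right zero_le_one]
    have h2 : b.toReal ≤ φ k x := by
      refine le_ciInf fun y => ?_
      by_cases hy : dist y x < r
      · have : b.toReal ≤ m k y := ENNReal.toReal_mono (hfin k y) (le_min (hball hy).le (by
          rw [← ENNReal.ofReal_toReal hbt, ← ENNReal.ofReal_natCast]; exact ENNReal.ofReal_le_ofReal hk2))
        have h3 : 0 ≤ (k:ℝ) * dist x y := by positivity
        linarith
      · rw [div_le_iff₀ hr] at hk1
        rw [not_lt, dist_comm] at hy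
        have := mul_le_mul_of_nonneg_left hy (Nat.cast_nonneg (α := ℝ) k)
        have := hm0 k y
        linarith
    refine hab.trans_le (le_iSup_of_le k ?_)
    change b ≤ ofReal (φ k x * χ k x)
    rw [h1, mul_one]
    exact (ENNReal.ofReal_toReal hbt).symm.le.trans (ENNReal.ofReal_le_ofReal h2)

lemma sph_meas {n : ℕ} (hn : 0 < n) {u v : Rn n → ℝ} {θ c : ℝ} (hr : LogH fun x => (v x)⁻¹) (hq : LogH fun x => (u x)⁻¹) (huC : Continuous u) (hvm : Measurable v) (hc : 0 < c) (hvc : ∀ x, c ≤ v x) (hvc' : ∀ x, v x ≤ 1 - c)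
    (hθ0 : 0 ≤ θ) (hθ1 : θ ≤ 1) (hγ : 0 < ((n:ℝ)/2 - 1) * (1 - θ) - θ) (huv : ∀ x, u x = (1-θ)/2 + θ * v x) :
    ∃ C : ℝ, 0 < C ∧ ∀ F : Rn n → ℝ≥0∞, Measurable F → ∫⁻ x, F x ^ (u x)⁻¹ ≤ 1 → ∫⁻ x, (SS F x / ofReal C) ^ (u x)⁻¹ ≤ 1 := by
  have huc : ∀ x, c ≤ u x ∧ u x ≤ 1 - c := fun x => by
    have a := hvc x; have b := hvc' x
    rw [huv]
    constructor <;> nlinarith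
  have hu0 : ∀ x, 0 < u x := fun x => hc.trans_le (huc x).1
  have hui : ∀ x, 0 < (u x)⁻¹ := fun x => inv_pos.2 (hu0 x)
  obtain ⟨C, hC, h⟩ := sph_cont hn hr hq huC.measurable hvm hc hvc hvc' hθ0 hθ1 hγ huv
  refine ⟨2 * C, by positivity, fun F hF hF1 => ?_⟩
  obtain ⟨g, hg, hgl, hgi⟩ := exists_le_lowerSemicontinuous_lintegral_ge volume (fun x => F x ^ (u x)⁻¹) (hF.pow huC.measurable.inv) one_ne_zero
  obtain ⟨H, Hc, H0, Hk, Hs, Hm, Hg, HG⟩ := lsc_approx hgl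
  set f : ℕ → Rn n → ℝ := fun k x => (H k x / 2) ^ u x with hf
  have hf0 : ∀ k x, 0 ≤ f k x := fun k x => Real.rpow_nonneg (by have := H0 k x; positivity) _
  have hfm : ∀ x, Monotone fun k => f k x := fun x k l hkl => Real.rpow_le_rpow (by have := H0 k x; positivity) (div_le_div_of_nonneg_right (Hm x hkl) zero_le_two) (hu0 x).le
  have key : ∀ k, Measurable (SS (fun x => ofReal (f k x))) ∧ ∫⁻ x, (SS (fun x => ofReal (f k x)) x / ofReal C) ^ (u x)⁻¹ ≤ 1 := fun k => by
    refine h (f k) (k + 1) k (((Hc k).div_const 2).rpow huC fun x => Or.inr (hu0 x)) (hf0 k) (fun x => ?_) (fun x hx => ?_) ?_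
    · have h1 := H0 k x
      have h2 := Hk k x
      have h3 : (0:ℝ) ≤ k := by positivity
      calc f k x ≤ ((k:ℝ) + 1) ^ u x := Real.rpow_le_rpow (by positivity) (by linarith) (hu0 x).le
        _ ≤ ((k:ℝ)+1) ^ (1:ℝ) := Real.rpow_le_rpow_of_exponent_le (by linarith) (by linarith [(huc x).2])
        _ = _ := Real.rpow_one _
    · simp only [hf]
      rw [Hs k x hx, zero_div, Real.zero_rpow (hu0 x).ne']
    · calc _ ≤ ∫⁻ x, 2⁻¹ * g x := by
            refine lintegral_mono fun x => ?_
            have h1 := H0 k x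
            rw [ENNReal.ofReal_rpow_of_nonneg (hf0 k x) (hui x).le, ← Real.rpow_mul (by positivity), mul_inv_cancel₀ (hu0 x).ne', Real.rpow_one,
              ENNReal.ofReal_div_of_pos two_pos, ENNReal.div_eq_inv_mul, ENNReal.ofReal_ofNat]
            exact mul_le_mul' le_rfl (Hg k x)
        _ = 2⁻¹ * ∫⁻ x, g x := lintegral_const_mul' _ _ (by simp)
        _ ≤ 2⁻¹ * (1 + 1) := mul_le_mul' le_rfl (hgi.trans (add_le_add hF1 le_rfl))
        _ = 1 := by rw [one_add_one_eq_two]; exact ENNReal.inv_mul_cancel (by simp) (by simp)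
  have hFf : ∀ x, F x ≤ 2 * ⨆ k, ofReal (f k x) := fun x => by
    have h1 : (⨆ k, ofReal (f k x)) = (2⁻¹ * ⨆ k, ofReal (H k x)) ^ u x := by
      rw [ENNReal.mul_iSup, show ∀ y : ℝ≥0∞, y ^ u x = ENNReal.orderIsoRpow _ (hu0 x) y from fun y => rfl, OrderIso.map_iSup]
      refine iSup_congr fun k => ?_
      have := H0 k x
      change ofReal ((H k x / 2) ^ u x) = (2⁻¹ * ofReal (H k x)) ^ u x
      rw [← ENNReal.ofReal_rpow_of_nonneg (by positivity) (hu0 x).le, ENNReal.ofReal_div_of_pos two_pos, ENNReal.div_eq_inv_mul, ENNReal.ofReal_ofNat]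
    rw [h1]
    calc F x = 2 * (2⁻¹ * F x) := by rw [← mul_assoc, ENNReal.mul_inv_cancel (by simp) (by simp), one_mul]
      _ ≤ 2 * (2⁻¹ ^ u x * F x) := by
          refine mul_le_mul' le_rfl (mul_le_mul' ?_ le_rfl)
          conv_lhs => rw [← ENNReal.rpow_one 2⁻¹]
          exact ENNReal.rpow_le_rpow_of_exponent_ge (by simp) (by linarith [(huc x).2])
      _ = 2 * (2⁻¹ * F x ^ (u x)⁻¹) ^ u x := by
          rw [ENNReal.mul_rpow_of_nonneg _ _ (hu0 x).le, ← ENNReal.rpow_mul, inv_mul_cancel₀ (hu0 x).ne', ENNReal.rpow_one]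
      _ ≤ _ := mul_le_mul' le_rfl (ENNReal.rpow_le_rpow (mul_le_mul' le_rfl ((hg x).trans (HG x))) (hu0 x).le)
  have hSf : ∀ x, SS F x ≤ 2 * ⨆ k, SS (fun x => ofReal (f k x)) x := fun x => by
    refine iSup_le fun t => ?_
    have hfc : ∀ k, Continuous (f k) := fun k => ((Hc k).div_const 2).rpow huC fun x => Or.inr (hu0 x)
    calc _ ≤ ∫⁻ ω, 2 * ⨆ k, ofReal (f k (x - t.1 • ω)) ∂(unitSphereMeasure n) := lintegral_mono fun ω => hFf _
      _ = 2 * ⨆ k, ∫⁻ ω, ofReal (f k (x - t.1 • ω)) ∂(unitSphereMeasure n) := by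
          rw [lintegral_const_mul' _ _ (by simp)]
          congr 1
          refine lintegral_iSup (fun k => ?_) (fun k l hkl ω => ENNReal.ofReal_le_ofReal (hfm _ hkl))
          exact ENNReal.measurable_ofReal.comp ((hfc k).measurable.comp (by fun_prop))
      _ ≤ _ := mul_le_mul' le_rfl (iSup_mono fun k => le_iSup (fun t : {t : ℝ // 0 < t} => ∫⁻ ω, ofReal (f k (x - t.1 • ω)) ∂(unitSphereMeasure n)) t)
  calc _ ≤ ∫⁻ x, ⨆ k, (SS (fun x => ofReal (f k x)) x / ofReal C) ^ (u x)⁻¹ := by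
        refine lintegral_mono fun x => ?_
        have : SS F x / ofReal (2 * C) ≤ ⨆ k, SS (fun x => ofReal (f k x)) x / ofReal C := by
          rw [← ENNReal.iSup_div, ENNReal.ofReal_mul zero_le_two, ENNReal.ofReal_ofNat]
          refine (ENNReal.div_le_div_right (hSf x) _).trans (le_of_eq ?_)
          exact ENNReal.mul_div_mul_left _ _ (by simp) (by simp)
        refine (ENNReal.rpow_le_rpow this (hui x).le).trans (le_of_eq ?_)
        exact (ENNReal.orderIsoRpow _ (hui x)).map_iSup _
    _ = ⨆ k, ∫⁻ x, (SS (fun x => ofReal (f k x)) x / ofReal C) ^ (u x)⁻¹ := by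
        refine lintegral_iSup (fun k => ((key k).1.div_const _).pow huC.measurable.inv) fun k l hkl x => ?_
        refine ENNReal.rpow_le_rpow (ENNReal.div_le_div_right (iSup_mono fun t => lintegral_mono fun ω => ENNReal.ofReal_le_ofReal (hfm _ hkl)) _) (hui x).le
    _ ≤ 1 := iSup_le fun k => (key k).2

lemma sph_exp {n : ℕ} (hn : 3 ≤ n) {A B : ℝ} (hA : (n:ℝ) / ((n:ℝ) - 1) < A) (hAB : A ≤ B) (hB : B < A * ((n:ℝ) - 1)) {s : Rn n → ℝ} (hs : LogH s)
    (hsB : ∀ x, B⁻¹ ≤ s x) (hsA : ∀ x, s x ≤ A⁻¹) :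
    ∃ C : ℝ, 0 < C ∧ ∀ F : Rn n → ℝ≥0∞, Measurable F → ∫⁻ x, F x ^ (s x)⁻¹ ≤ 1 → ∫⁻ x, (SS F x / ofReal C) ^ (s x)⁻¹ ≤ 1 := by
  have hn' : (3:ℝ) ≤ n := by exact_mod_cast hn
  have hn0 : (0:ℝ) < n := by linarith
  have hn1 : (0:ℝ) < (n:ℝ) - 1 := by linarith
  have hA0 : 0 < A := lt_trans (by positivity) hA
  have hB0 : 0 < B := hA0.trans_le hAB
  rw [div_lt_iff₀ hn1] at hA
  obtain ⟨α, hα1, hαB, hαA⟩ : ∃ α : ℝ, 1 ≤ α ∧ B < α * n ∧ α * n < A * ((n:ℝ) - 1) := by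
    have h1 : (B + A * ((n:ℝ)-1)) / (2 * n) * n = (B + A * ((n:ℝ)-1)) / 2 := by field_simp
    refine ⟨max 1 ((B + A * ((n:ℝ)-1)) / (2 * n)), le_max_left _ _, ?_, ?_⟩
    · have := mul_le_mul_of_nonneg_right (le_max_right 1 ((B + A * ((n:ℝ)-1)) / (2 * n))) hn0.le
      linarith
    · rcases max_choice 1 ((B + A * ((n:ℝ)-1)) / (2 * n)) with h | h <;> rw [h] <;> linarith
  have hα0 : 0 < α := by linarith
  set e := min (α / B) (1 - α / A) with he
  have he1 : 1 / (n:ℝ) < e := by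
    refine lt_min ?_ ?_
    · rw [div_lt_div_iff₀ hn0 hB0]; linarith
    · rw [lt_sub_iff_add_lt, div_add_div _ _ hn0.ne' hA0.ne', div_lt_one (by positivity)]; linarith
  have he2 : e ≤ 1 / 2 := by
    have h1 : α / B ≤ α / A := div_le_div_of_nonneg_left hα0.le hA0 hAB
    have h2 := min_le_left (α / B) (1 - α / A)
    have h3 := min_le_right (α / B) (1 - α / A)
    linarith
  set m := (1 / (n:ℝ) + e) / 2 with hm
  have hm1 : 1 / (n:ℝ) < m := by linarith
  have hm2 : m < e := by linarith
  have hn3 : (0:ℝ) < 1 / n := by positivity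
  set θ := 1 - 2 * m with hθ
  have hθ0 : 0 < θ := by linarith
  have hθ1 : θ < 1 := by linarith
  set u : Rn n → ℝ := fun x => α * s x with hu
  have hue : ∀ x, e ≤ u x := fun x => (min_le_left _ _).trans (by
    rw [div_eq_mul_inv]; exact mul_le_mul_of_nonneg_left (hsB x) hα0.le)
  have hue' : ∀ x, u x ≤ 1 - e := fun x => by
    have h1 : u x ≤ α / A := by rw [div_eq_mul_inv]; exact mul_le_mul_of_nonneg_left (hsA x) hα0.le
    have := min_le_right (α / B) (1 - α / A)
    linarith
  set c := (e - m) / θ with hc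
  have hc0 : 0 < c := div_pos (by linarith) hθ0
  set v : Rn n → ℝ := fun x => (u x - m) / θ with hv
  have hvc : ∀ x, c ≤ v x := fun x => div_le_div_of_nonneg_right (by linarith [hue x]) hθ0.le
  have hvc' : ∀ x, v x ≤ 1 - c := fun x => by
    have h1 : v x + c ≤ 1 := by
      simp only [hv, hc]
      rw [← add_div, div_le_one hθ0]; linarith [hue' x]
    linarith
  have hsc := hs.continuous
  have huC : Continuous u := continuous_const.mul hsc
  have hvC : Continuous v := (huC.sub continuous_const).div_const _
  have hul : LogH u := by simpa using hs.affine α 0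
  have hvl : LogH v := by
    have := hul.affine θ⁻¹ (-m / θ)
    have h2 : v = fun x => θ⁻¹ * u x + -m / θ := by
      funext x; simp only [hv]; field_simp; ring
    rw [h2]; exact this
  obtain ⟨C, hC, h⟩ := sph_meas (n := n) (by omega) (u := u) (v := v) (θ := θ) (c := c) (hvl.inv hc0 hvc) (hul.inv (by linarith : (0:ℝ) < e) hue) huC hvC.measurable hc0 hvc hvc' hθ0.le hθ1.le
    (by
      have : 1 < m * n := by rwa [div_lt_iff₀ hn0] at hm1
      rw [hθ]; nlinarith) (fun x => by simp only [hv]; field_simp; ring)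
  have hs0 : ∀ x, 0 < s x := fun x => (inv_pos.2 hB0).trans_le (hsB x)
  have hrp : ∀ (x : Rn n) (y : ℝ≥0∞), (y ^ α) ^ (u x)⁻¹ = y ^ (s x)⁻¹ := fun x y => by
    rw [← ENNReal.rpow_mul, hu]
    congr 1
    have := (hs0 x).ne'
    field_simp
  refine ⟨C ^ α⁻¹, by positivity, fun F hF hF1 => ?_⟩
  have := h (fun x => F x ^ α) (hF.pow_const α) (by simpa only [hrp] using hF1)
  refine le_trans (lintegral_mono fun x => ?_) this
  rw [← hrp, ENNReal.div_rpow_of_nonneg _ _ hα0.le, ENNReal.ofReal_rpow_of_nonneg (by positivity) hα0.le, ← Real.rpow_mul hC.le, inv_mul_cancel₀ hα0.ne', Real.rpow_one]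
  refine ENNReal.rpow_le_rpow (ENNReal.div_le_div_right ?_ _) (inv_nonneg.2 (mul_pos hα0 (hs0 x)).le)
  have h1 : SS F x ^ α = ⨆ t : {t : ℝ // 0 < t}, (∫⁻ ω, F (x - t.1 • ω) ∂(unitSphereMeasure n)) ^ α := (ENNReal.orderIsoRpow _ hα0).map_iSup _
  rw [h1]
  refine iSup_mono fun t => jensen_rpow _ (sph_univ n) (hF.comp (by fun_prop)).aemeasurable hα1

lemma varModular_fin {n : ℕ} {E : Type*} [NormedAddCommGroup E] {p : Rn n → ℝ≥0∞} (hp : ∀ x, p x ≠ ∞) (f : Rn n → E) :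
    varModular p f = ∫⁻ x, ofReal ‖f x‖ ^ (p x).toReal := by
  simp [varModular, hp]

lemma stein_le_SS {n : ℕ} {f : Rn n → ℂ} {F : Rn n → ℝ≥0∞} {C c : ℝ} (hC : 0 < C) (hc : 0 < c) (hfF : ∀ x, ofReal (‖f x‖ / c) ≤ F x) (x : Rn n) :
    ofReal ‖‖steinSphericalMax f x‖ / (C * c)‖ ≤ SS F x / ofReal C := by
  by_cases hS : SS F x = ∞
  · rw [hS, ENNReal.top_div_of_ne_top ENNReal.ofReal_ne_top]; exact le_top
  have h1 : ∀ t : {t : ℝ // 0 < t}, ‖∫ y, f (x - t.1 • y) ∂(unitSphereMeasure n)‖ ≤ c * (SS F x).toReal := fun t => by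
    rw [← toReal_enorm, ← ENNReal.toReal_ofReal hc.le, ← ENNReal.toReal_mul]
    refine ENNReal.toReal_mono (ENNReal.mul_ne_top ENNReal.ofReal_ne_top hS) ?_
    calc _ ≤ ∫⁻ y, ‖f (x - t.1 • y)‖ₑ ∂(unitSphereMeasure n) := enorm_integral_le_lintegral_enorm _
      _ ≤ ∫⁻ y, ofReal c * F (x - t.1 • y) ∂(unitSphereMeasure n) := lintegral_mono fun y => by
          refine le_trans (le_of_eq ?_) (mul_le_mul' le_rfl (hfF _))
          rw [← ENNReal.ofReal_mul hc.le, mul_div_cancel₀ _ hc.ne', ofReal_norm]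
      _ = ofReal c * ∫⁻ y, F (x - t.1 • y) ∂(unitSphereMeasure n) := lintegral_const_mul' _ _ ENNReal.ofReal_ne_top
      _ ≤ _ := mul_le_mul' le_rfl (le_iSup (fun t : {t : ℝ // 0 < t} => ∫⁻ y, F (x - t.1 • y) ∂(unitSphereMeasure n)) t)
  have h2 : steinSphericalMax f x ≤ c * (SS F x).toReal := Real.iSup_le h1 (by positivity)
  have h3 : 0 ≤ steinSphericalMax f x := Real.iSup_nonneg fun t => norm_nonneg _
  rw [Real.norm_of_nonneg (by positivity), Real.norm_of_nonneg h3]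
  calc _ ≤ ofReal ((SS F x).toReal / C) := by
        refine ENNReal.ofReal_le_ofReal ?_
        rw [div_le_div_iff₀ (by positivity) hC]
        nlinarith
    _ = _ := by rw [ENNReal.ofReal_div_of_pos hC, ENNReal.ofReal_toReal hS]

lemma exists_majorant {n : ℕ} {f : Rn n → ℂ} (hf : AEStronglyMeasurable f volume) (c : ℝ) :
    ∃ F : Rn n → ℝ≥0∞, Measurable F ∧ (∀ x, ofReal (‖f x‖ / c) ≤ F x) ∧ ∀ᵐ x, F x = ofReal (‖f x‖ / c) := by
  classical
  obtain ⟨g, hg, hfg⟩ := hf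
  obtain ⟨N, hN, hNm, hN0⟩ := exists_measurable_superset_of_null (ae_iff.1 hfg)
  refine ⟨fun x => if x ∈ N then ∞ else ofReal (‖g x‖ / c), Measurable.ite hNm measurable_const (hg.measurable.norm.div_const c).ennreal_ofReal, fun x => ?_, ?_⟩
  · by_cases hx : x ∈ N
    · simp [hx]
    · have : f x = g x := by by_contra h; exact hx (hN h)
      simp [hx, this]
  · have : ∀ᵐ x, x ∉ N := measure_eq_zero_iff_ae_notMem.1 hN0
    filter_upwards [this, hfg] with x hx hx'
    simp [hx, hx']

/-- Let `n ≥ 3` and let `p ∈ P^log(ℝⁿ)` with `n/(n-1) < p⁻ ≤ p⁺ < p⁻(n-1)`.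
Then the spherical maximal operator `𝓜` is bounded on `L^{p(·)}(ℝⁿ)`:
`‖𝓜 f‖_{p(·)} ≤ C ‖f‖_{p(·)}` for all `f ∈ L^{p(·)}(ℝⁿ)`. -/
theorem stein_spherical_maximal_varLp
    (n : ℕ) (hn : 3 ≤ n)
    (p : Rn n → ℝ≥0∞) (hp : MemPLog p)
    (hlow : ENNReal.ofReal ((n : ℝ)/((n : ℝ) - 1)) < essInf p volume)
    (hhigh : essSup p volume < essInf p volume * ENNReal.ofReal ((n : ℝ) - 1)) :
    ∃ C : ℝ, 0 < C ∧ ∀ f : Rn n → ℂ, MemVarLp p f →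
      varNorm p (steinSphericalMax f) ≤ C * varNorm p f := by
  have hn' : (3:ℝ) ≤ n := by exact_mod_cast hn
  obtain ⟨-, hp1, hloc, hdec⟩ := hp
  set s : Rn n → ℝ := fun x => ((p x)⁻¹).toReal with hs
  have hsl : LogH s := ⟨hloc, hdec⟩
  have hsc := hsl.continuous
  set a := essInf p volume with ha
  set b := essSup p volume with hb
  have hbt : b ≠ ∞ := hhigh.ne_top
  have hab : ∀ᵐ x, a ≤ p x ∧ p x ≤ b := (ae_essInf_le).and (ae_le_essSup)
  have hab' : a ≤ b := by obtain ⟨x, h1, h2⟩ := hab.exists; exact h1.trans h2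
  have hat : a ≠ ∞ := (hab'.trans_lt hbt.lt_top).ne
  have hn1 : (0:ℝ) < (n:ℝ) - 1 := by linarith
  have hn2 : (0:ℝ) ≤ (n:ℝ) / ((n:ℝ) - 1) := by positivity
  have hA : (n:ℝ) / ((n:ℝ) - 1) < a.toReal := (ENNReal.ofReal_lt_iff_lt_toReal hn2 hat).1 hlow
  have hAB : a.toReal ≤ b.toReal := ENNReal.toReal_mono hbt hab'
  have hB : b.toReal < a.toReal * ((n:ℝ) - 1) := by
    have := (ENNReal.toReal_lt_toReal hbt (ENNReal.mul_ne_top hat ENNReal.ofReal_ne_top)).2 hhigh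
    rwa [ENNReal.toReal_mul, ENNReal.toReal_ofReal hn1.le] at this
  have hA0 : 0 < a.toReal := hn2.trans_lt hA
  have hB0 : 0 < b.toReal := hA0.trans_le hAB
  have ha0 : a ≠ 0 := fun h => by simp [h] at hA0
  have hall : ∀ x, b.toReal⁻¹ ≤ s x ∧ s x ≤ a.toReal⁻¹ := by
    have hcl : IsClosed {x | b.toReal⁻¹ ≤ s x ∧ s x ≤ a.toReal⁻¹} := (isClosed_le continuous_const hsc).inter (isClosed_le hsc continuous_const)
    have hd : Dense {x | b.toReal⁻¹ ≤ s x ∧ s x ≤ a.toReal⁻¹} := by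
      refine Measure.dense_of_ae (μ := volume) ?_
      filter_upwards [hab] with x hx
      rw [← ENNReal.toReal_inv, ← ENNReal.toReal_inv]
      have h0 : p x ≠ 0 := (zero_lt_one.trans_le (hp1 x)).ne'
      exact ⟨ENNReal.toReal_mono (ENNReal.inv_ne_top.2 h0) (ENNReal.inv_le_inv.2 hx.2), ENNReal.toReal_mono (ENNReal.inv_ne_top.2 ha0) (ENNReal.inv_le_inv.2 hx.1)⟩
    intro x
    have := hd.closure_eq
    rw [hcl.closure_eq] at this
    exact Set.eq_univ_iff_forall.1 this x
  have hs0 : ∀ x, 0 < s x := fun x => (inv_pos.2 hB0).trans_le (hall x).1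
  have hpt : ∀ x, p x ≠ ∞ := fun x h => by have := hs0 x; simp [hs, h] at this
  have hps : ∀ x, (p x).toReal = (s x)⁻¹ := fun x => by simp [hs, ENNReal.toReal_inv]
  have hp1' : ∀ x, 1 ≤ (p x).toReal := fun x => by
    have := ENNReal.toReal_mono (hpt x) (hp1 x)
    simpa using this
  obtain ⟨C, hC, h⟩ := sph_exp hn hA hAB hB hsl (fun x => (hall x).1) (fun x => (hall x).2)
  refine ⟨C, hC, fun f hf => ?_⟩
  obtain ⟨hfm, c0, hc0, hfin⟩ := hf
  have hne : {c : ℝ | 0 < c ∧ varModular p (fun x => ‖f x‖ / c) ≤ 1}.Nonempty := by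
    set M := varModular p (fun x => ‖f x‖ / c0) with hM
    set K := max 1 M.toReal with hK
    have hK1 : 1 ≤ K := le_max_left _ _
    have hK0 : 0 < K := by linarith
    refine ⟨c0 * K, by positivity, ?_⟩
    rw [varModular_fin hpt]
    calc _ ≤ ∫⁻ x, ofReal K⁻¹ * ofReal ‖‖f x‖ / c0‖ ^ (p x).toReal := by
          refine lintegral_mono fun x => ?_
          have h1 : ‖‖f x‖ / (c0 * K)‖ = K⁻¹ * ‖‖f x‖ / c0‖ := by
            rw [Real.norm_of_nonneg (by positivity), Real.norm_of_nonneg (by positivity)]; field_simp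
          rw [h1, ENNReal.ofReal_mul (by positivity), ENNReal.mul_rpow_of_nonneg _ _ (by linarith [hp1' x])]
          refine mul_le_mul' ?_ le_rfl
          conv_rhs => rw [← ENNReal.rpow_one (ofReal K⁻¹)]
          exact ENNReal.rpow_le_rpow_of_exponent_ge (ENNReal.ofReal_le_one.2 (inv_le_one_of_one_le₀ hK1)) (hp1' x)
      _ = ofReal K⁻¹ * M := by rw [lintegral_const_mul' _ _ ENNReal.ofReal_ne_top, hM, varModular_fin hpt]
      _ ≤ ofReal K⁻¹ * ofReal K := by
          refine mul_le_mul' le_rfl ?_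
          rw [← ENNReal.ofReal_toReal hfin.ne]
          exact ENNReal.ofReal_le_ofReal (le_max_right _ _)
      _ = 1 := by rw [← ENNReal.ofReal_mul (by positivity), inv_mul_cancel₀ hK0.ne', ENNReal.ofReal_one]
  rw [← div_le_iff₀' hC]
  refine le_csInf hne ?_
  rintro c ⟨hc, hc1⟩
  rw [div_le_iff₀' hC]
  refine csInf_le ⟨0, fun y hy => hy.1.le⟩ ⟨by positivity, ?_⟩
  obtain ⟨F, hF, hfF, hFe⟩ := exists_majorant hfm c
  rw [varModular_fin hpt] at hc1 ⊢
  have h1 : ∫⁻ x, F x ^ (s x)⁻¹ ≤ 1 := by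
    refine le_trans (le_of_eq (lintegral_congr_ae ?_)) hc1
    filter_upwards [hFe] with x hx
    rw [hx, hps, Real.norm_of_nonneg (by positivity)]
  refine le_trans (lintegral_mono fun x => ?_) (h F hF h1)
  rw [hps]
  exact ENNReal.rpow_le_rpow (stein_le_SS hC hc hfF x) (inv_nonneg.2 (hs0 x).le)
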